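/- arXiv:2009.12761 — 2 statements merged into one kernel-verified Lean document; each statement's English description precedes it below -/
import Mathlib

section
/- Let K be a number field of degree 6 over ℚ that is Galois over ℚ with cyclic Galois group, and suppose K contains elements α and β with α³ = 21α + 28 and β² = −1 (so K is the sextic cyclic CM field ℚ(α, i) of conductor 252, with class number 12 and whose cubic subfield has class number 3). Then there exist a generator σ of Gal(K/ℚ), a nonzero ideal 𝔠 of 𝒪_K, and a Shimura ideal character of type (σ, 𝔠). -/
open NumberField

/-- The action of `τ ∈ Gal(K/ℚ)` on ideals of the ring of integers of `K`,
via the restriction of `τ` to `𝓞 K`. -/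
noncomputable def idealConj {K : Type*} [Field K] [NumberField K] (τ : K ≃ₐ[ℚ] K)
    (I : Ideal (𝓞 K)) : Ideal (𝓞 K) :=
  Ideal.map (galRestrict ℤ ℚ K (𝓞 K) τ) I

/-- The cubic subfield `F` of `K`: the fixed field of `ρ = σ³`. -/
noncomputable def cubicFixedField {K : Type*} [Field K] [NumberField K] (σ : K ≃ₐ[ℚ] K) :
    IntermediateField ℚ K :=
  IntermediateField.fixedField (Subgroup.zpowers (σ ^ 3))

/-- A *Shimura ideal character of type `(σ, 𝔠)`* on a sextic cyclic CM field `K` with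
`σ` a generator of `Gal(K/ℚ)`, `ρ = σ³`, and `F` the cubic subfield (fixed field of `ρ`):
a map `ψ` from the nonzero ideals of `𝓞 K` coprime to `𝔠` to the nonzero elements of `K`
such that
(i)   `ψ (I * J) = ψ I * ψ J`;
(ii)  `ψ (s 𝓞 K) = s • σ⁴ s • σ⁵ s` whenever `s ≡ 1 mod 𝔠`;
(iii) for a prime `𝔭` of `𝓞 F` unramified in `K` (coprime to `𝔠`), `ψ (𝔭 𝓞 K) = N 𝔭`
      if `𝔭` splits in `K` and `ψ (𝔭 𝓞 K) = -N 𝔭` if `𝔭 𝓞 K` is prime;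
(iv)  `ψ I * ρ (ψ I) = N I` and `ψ I • 𝓞 K = I • σ⁴ I • σ⁵ I` as (fractional) ideals;
(v)   `ψ (σ I) = σ (ψ I)`.
Here the absolute norm `N` of an ideal is the cardinality of the corresponding quotient. -/
noncomputable def IsShimuraIdealChar {K : Type*} [Field K] [NumberField K]
    (σ : K ≃ₐ[ℚ] K) (𝔠 : Ideal (𝓞 K)) (ψ : Ideal (𝓞 K) → K) : Prop :=
  -- ψ takes nonzero values on nonzero ideals coprime to 𝔠
  (∀ I : Ideal (𝓞 K), I ≠ ⊥ → IsCoprime I 𝔠 → ψ I ≠ 0) ∧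
  -- (i) multiplicativity
  (∀ I J : Ideal (𝓞 K), I ≠ ⊥ → J ≠ ⊥ → IsCoprime I 𝔠 → IsCoprime J 𝔠 →
    ψ (I * J) = ψ I * ψ J) ∧
  -- (ii) value on principal ideals generated by `s ≡ 1 mod 𝔠`
  (∀ s : 𝓞 K, IsCoprime (Ideal.span {s}) 𝔠 → s - 1 ∈ 𝔠 →
    ψ (Ideal.span {s}) = (s : K) * (σ ^ 4) (s : K) * (σ ^ 5) (s : K)) ∧
  -- (iii) value on primes of the cubic subfield `F` unramified in `K`: such a prime either
  -- splits (`𝔭 𝓞 K` is a product of two distinct primes) or is inert (`𝔭 𝓞 K` is prime)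
  (∀ 𝔭 : Ideal (𝓞 (cubicFixedField σ)), 𝔭.IsPrime → 𝔭 ≠ ⊥ →
    IsCoprime (Ideal.map (algebraMap (𝓞 (cubicFixedField σ)) (𝓞 K)) 𝔭) 𝔠 →
    ((∃ Q₁ Q₂ : Ideal (𝓞 K), Q₁.IsPrime ∧ Q₂.IsPrime ∧ Q₁ ≠ Q₂ ∧
        Ideal.map (algebraMap (𝓞 (cubicFixedField σ)) (𝓞 K)) 𝔭 = Q₁ * Q₂) →
      ψ (Ideal.map (algebraMap (𝓞 (cubicFixedField σ)) (𝓞 K)) 𝔭)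
        = (Nat.card (𝓞 (cubicFixedField σ) ⧸ 𝔭) : K)) ∧
    ((Ideal.map (algebraMap (𝓞 (cubicFixedField σ)) (𝓞 K)) 𝔭).IsPrime →
      ψ (Ideal.map (algebraMap (𝓞 (cubicFixedField σ)) (𝓞 K)) 𝔭)
        = -(Nat.card (𝓞 (cubicFixedField σ) ⧸ 𝔭) : K))) ∧
  -- (iv) norm relation and ideal generation
  (∀ I : Ideal (𝓞 K), I ≠ ⊥ → IsCoprime I 𝔠 →
    ψ I * (σ ^ 3) (ψ I) = (Nat.card (𝓞 K ⧸ I) : K) ∧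
    FractionalIdeal.spanSingleton (nonZeroDivisors (𝓞 K)) (ψ I)
      = ((I * idealConj (σ ^ 4) I * idealConj (σ ^ 5) I : Ideal (𝓞 K)) :
          FractionalIdeal (nonZeroDivisors (𝓞 K)) K)) ∧
  -- (v) Galois equivariance with respect to σ
  (∀ I : Ideal (𝓞 K), I ≠ ⊥ → IsCoprime I 𝔠 → ψ (idealConj σ I) = σ (ψ I))


namespace Shi

section base
variable {K : Type*} [Field K] [NumberField K]

/-- restriction to the ring of integers -/
noncomputable def gr (τ : K ≃ₐ[ℚ] K) : 𝓞 K ≃ₐ[ℤ] 𝓞 K := galRestrict ℤ ℚ K (𝓞 K) τ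

lemma coe_gr (τ : K ≃ₐ[ℚ] K) (x : 𝓞 K) : ((gr τ x : 𝓞 K) : K) = τ (x : K) :=
  algebraMap_galRestrict_apply ℤ τ x

lemma gr_mul (τ τ' : K ≃ₐ[ℚ] K) (x : 𝓞 K) : gr (τ * τ') x = gr τ (gr τ' x) := by
  apply RingOfIntegers.ext
  simp [coe_gr]

lemma gr_one (x : 𝓞 K) : gr (1 : K ≃ₐ[ℚ] K) x = x := by
  apply RingOfIntegers.ext
  simp [coe_gr]

lemma ic_def (τ : K ≃ₐ[ℚ] K) (I : Ideal (𝓞 K)) : idealConj τ I = Ideal.map (gr τ) I := rfl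

lemma ic_mul (τ : K ≃ₐ[ℚ] K) (I J : Ideal (𝓞 K)) :
    idealConj τ (I * J) = idealConj τ I * idealConj τ J := by
  simp only [ic_def]; exact Ideal.map_mul _ _ _

lemma mem_ic (τ : K ≃ₐ[ℚ] K) (I : Ideal (𝓞 K)) (x : 𝓞 K) :
    gr τ x ∈ idealConj τ I ↔ x ∈ I := by
  rw [ic_def]
  constructor
  · intro h
    obtain ⟨y, hy, hxy⟩ := (Ideal.mem_map_iff_of_surjective _ (gr τ).surjective).1 h
    rwa [(gr τ).injective hxy] at hy
  · exact fun h => Ideal.mem_map_of_mem _ h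

lemma ic_comp (τ τ' : K ≃ₐ[ℚ] K) (I : Ideal (𝓞 K)) :
    idealConj (τ * τ') I = idealConj τ (idealConj τ' I) := by
  ext x
  obtain ⟨y, rfl⟩ := (gr (τ * τ')).surjective x
  rw [mem_ic, gr_mul, mem_ic, mem_ic]

lemma ic_one (I : Ideal (𝓞 K)) : idealConj (1 : K ≃ₐ[ℚ] K) I = I := by
  ext x
  rw [← gr_one x, mem_ic, gr_one]

lemma ic_span (τ : K ≃ₐ[ℚ] K) (x : 𝓞 K) :
    idealConj τ (Ideal.span {x}) = Ideal.span {gr τ x} := by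
  rw [ic_def, Ideal.map_span]; simp

lemma ic_inj (τ : K ≃ₐ[ℚ] K) {I J : Ideal (𝓞 K)} (h : idealConj τ I = idealConj τ J) : I = J := by
  ext x
  rw [← mem_ic τ, h, mem_ic]

lemma ic_bot (τ : K ≃ₐ[ℚ] K) : idealConj τ (⊥ : Ideal (𝓞 K)) = ⊥ := by
  rw [ic_def]; exact Ideal.map_bot

lemma ic_top (τ : K ≃ₐ[ℚ] K) : idealConj τ (⊤ : Ideal (𝓞 K)) = ⊤ := by
  rw [ic_def]; exact Ideal.map_top _

lemma ic_ne_bot (τ : K ≃ₐ[ℚ] K) {I : Ideal (𝓞 K)} (h : I ≠ ⊥) : idealConj τ I ≠ ⊥ := by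
  intro h'
  exact h (ic_inj τ (h'.trans (ic_bot τ).symm))

lemma ic_prime (τ : K ≃ₐ[ℚ] K) {I : Ideal (𝓞 K)} (h : I.IsPrime) : (idealConj τ I).IsPrime := by
  rw [ic_def]; exact Ideal.map_isPrime_of_equiv (gr τ)

lemma ic_absNorm (τ : K ≃ₐ[ℚ] K) (I : Ideal (𝓞 K)) :
    Ideal.absNorm (idealConj τ I) = Ideal.absNorm I := by
  rw [Ideal.absNorm_apply, Ideal.absNorm_apply, Submodule.cardQuot_apply, Submodule.cardQuot_apply]
  exact (Nat.card_congr (Ideal.quotientEquiv I (idealConj τ I) (gr τ).toRingEquiv rfl).toEquiv).symm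

/-- the standing data -/
structure Setup (σ : K ≃ₐ[ℚ] K) (β : K) : Prop where
  gen : ∀ τ : K ≃ₐ[ℚ] K, τ ∈ Subgroup.zpowers σ
  ord : orderOf σ = 6
  sb : σ β = -β
  bb : β ^ 2 = -1
  deg : Module.finrank ℚ K = 6

variable {σ : K ≃ₐ[ℚ] K} {β : K}

lemma Setup.six (h : Setup σ β) : σ ^ 6 = 1 := by rw [← h.ord]; exact pow_orderOf_eq_one σ

lemma Setup.exists_pow (h : Setup σ β) (τ : K ≃ₐ[ℚ] K) : ∃ k < 6, τ = σ ^ k := by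
  obtain ⟨n, rfl⟩ := mem_powers_iff_mem_zpowers.mpr (h.gen τ)
  refine ⟨n % 6, Nat.mod_lt _ (by norm_num), ?_⟩
  simp only
  rw [← h.ord, pow_mod_orderOf]
end base
end Shi


namespace Shi

section two
variable {K : Type*} [Field K] [NumberField K] [IsGalois ℚ K]
variable {σ : K ≃ₐ[ℚ] K} {β : K}

lemma Setup.beta_pow (h : Setup σ β) (k : ℕ) : (σ ^ k) β = (-1) ^ k * β := by
  induction k with
  | zero => simp
  | succ n ih => rw [pow_succ', AlgEquiv.mul_apply, ih, map_mul, h.sb, map_pow, map_neg, map_one]; ring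

lemma Setup.beta_ne (h : Setup σ β) : β ≠ 0 := by
  intro hb
  have := h.bb
  rw [hb] at this
  norm_num at this

lemma Setup.conj (h : Setup σ β) (φ : K →+* ℂ) (x : K) :
    φ ((σ ^ 3) x) = (starRingEnd ℂ) (φ x) := by
  obtain ⟨ν, hν⟩ := ComplexEmbedding.exists_comp_symm_eq_of_comp_eq (k := ℚ) φ
    (ComplexEmbedding.conjugate φ) (by ext; simp)
  obtain ⟨k, hk, hk'⟩ := h.exists_pow ν.symm
  have key : ∀ y, φ ((σ ^ k) y) = (starRingEnd ℂ) (φ y) := by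
    intro y
    rw [← hk']
    exact RingHom.congr_fun hν y
  have h2 : (σ ^ k) ^ 2 = 1 := by
    ext y
    apply φ.injective
    rw [pow_two, AlgEquiv.mul_apply, key, key]
    simp
  rw [← pow_mul] at h2
  have h3 := orderOf_dvd_of_pow_eq_one h2
  rw [h.ord] at h3
  have hb : φ β ^ 2 = -1 := by rw [← map_pow, h.bb]; simp
  have hre : (starRingEnd ℂ) (φ β) = - φ β := by
    have : (φ β - Complex.I) * (φ β + Complex.I) = 0 := by
      have := Complex.I_sq
      linear_combination hb - this
    rcases mul_eq_zero.1 this with h' | h'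
    · rw [sub_eq_zero.1 h']; simp
    · rw [eq_neg_of_add_eq_zero_left h']; simp
  have hkodd : k ≠ 0 := by
    rintro rfl
    have := key β
    rw [hre, pow_zero, AlgEquiv.one_apply] at this
    have h0 : φ β = 0 := by linear_combination this / 2
    exact h.beta_ne (φ.injective (by simpa using h0))
  have : k = 3 := by omega
  rw [← key, this]

lemma Setup.root_aux (h : Setup σ β) {u : K} {n : ℕ} (hn : 0 < n) (hu : u ^ n = 1) : u ^ 4 = 1 := by
  have ho : 0 < orderOf u := orderOf_pos_iff.2 (isOfFinOrder_iff_pow_eq_one.2 ⟨n, hn, hu⟩)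
  have hb4 : IsPrimitiveRoot β 4 := by
    apply IsPrimitiveRoot.mk_of_lt _ (by norm_num)
    · linear_combination (β ^ 2 - 1) * h.bb
    · intro l hl hl4 hbl
      have hb := h.bb
      have h1 : β ≠ 1 := by rintro rfl; norm_num at hb
      have h2 : β ^ 2 ≠ 1 := by rw [hb]; norm_num
      interval_cases l
      · exact h1 (by simpa using hbl)
      · exact h2 hbl
      · apply h.beta_ne
        have h4 : β ^ 4 = 1 := by linear_combination (β ^ 2 - 1) * h.bb
        exfalso; apply h1; linear_combination h4 - β * hbl
  have hz := (IsPrimitiveRoot.orderOf u).pow_mul_pow_lcm hb4 ho.ne' (by norm_num)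
  set L := Nat.lcm (orderOf u) 4
  have hL : 0 < L := Nat.lcm_pos ho (by norm_num)
  set z := u ^ (orderOf u / (orderOf u).factorizationLCMLeft 4) * β ^ (4 / (orderOf u).factorizationLCMRight 4) with hzdef
  have hdvd : L.totient ∣ 6 := by
    rw [← h.deg]
    have hm := Polynomial.cyclotomic_eq_minpoly_rat hz hL
    have : (minpoly ℚ z).natDegree = L.totient := by rw [← hm, Polynomial.natDegree_cyclotomic]
    rw [← this]
    exact minpoly.degree_dvd (Algebra.IsIntegral.isIntegral z)
  have h4L : 4 ∣ L := Nat.dvd_lcm_right _ _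
  obtain ⟨k, hk⟩ := h4L
  have hk' : L = 2 * (2 * k) := by omega
  have hk0 : 0 < k := by omega
  have h2k : L.totient = 2 * (2 * k).totient := by
    rw [hk', Nat.totient_mul_of_prime_of_dvd Nat.prime_two ⟨k, rfl⟩]
  have hk1 : k = 1 := by
    by_contra hne
    have : Even (2 * k).totient := Nat.totient_even (by omega)
    obtain ⟨r, hr⟩ := this
    rw [h2k, hr] at hdvd
    have hr3 : 0 < (2*k).totient := Nat.totient_pos.2 (by omega)
    have : r ≤ 6 := by
      have := Nat.le_of_dvd (by norm_num) hdvd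
      omega
    interval_cases r <;> omega
  have : orderOf u ∣ 4 := by
    have : orderOf u ∣ L := Nat.dvd_lcm_left _ _
    rwa [hk, hk1] at this
  exact orderOf_dvd_iff_pow_eq_one.1 this

lemma Setup.units (h : Setup σ β) {u : K} (hu : IsIntegral ℤ u) (h1 : u * (σ ^ 3) u = 1) :
    u = 1 ∨ u = -1 ∨ u = β ∨ u = -β := by
  obtain ⟨n, hn, hun⟩ := Embeddings.pow_eq_one_of_norm_eq_one K ℂ hu (fun φ => by
    have h2 := congrArg φ h1
    rw [map_mul, h.conj, Complex.mul_conj, map_one] at h2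
    have h3 : Complex.normSq (φ u) = 1 := by exact_mod_cast h2
    rw [Complex.normSq_eq_norm_sq] at h3
    nlinarith [norm_nonneg (φ u)])
  have h4 := h.root_aux hn hun
  have : (u - 1) * ((u + 1) * ((u - β) * (u + β))) = 0 := by
    linear_combination h4 - (u ^ 2 - 1) * h.bb
  rcases mul_eq_zero.1 this with h' | h'
  · left; exact sub_eq_zero.1 h'
  rcases mul_eq_zero.1 h' with h' | h'
  · right; left; exact eq_neg_of_add_eq_zero_left h'
  rcases mul_eq_zero.1 h' with h' | h'
  · right; right; left; exact sub_eq_zero.1 h'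
  · right; right; right; exact eq_neg_of_add_eq_zero_left h'

lemma Setup.fixed_rat (h : Setup σ β) {x : K} (hx : σ x = x) : ∃ q : ℚ, x = q := by
  have : x ∈ (⊥ : IntermediateField ℚ K) := by
    rw [IsGalois.mem_bot_iff_fixed]
    intro τ
    obtain ⟨k, -, rfl⟩ := h.exists_pow τ
    induction k with
    | zero => simp
    | succ n ih => rw [pow_succ, AlgEquiv.mul_apply, hx, ih]
  obtain ⟨q, hq⟩ := IntermediateField.mem_bot.1 this
  exact ⟨q, by rw [← hq]; simp⟩

lemma rat_int {q : ℚ} (hq : IsIntegral ℤ (q : K)) : ∃ n : ℤ, q = n := by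
  have : IsIntegral ℤ q := by
    rw [← isIntegral_algebraMap_iff (R := ℤ) (A := ℚ) (B := K) (algebraMap ℚ K).injective]
    simpa using hq
  obtain ⟨n, hn⟩ := IsIntegrallyClosed.isIntegral_iff.1 this
  exact ⟨n, by rw [← hn]; simp⟩

lemma Setup.fixed_int (h : Setup σ β) {x : K} (hi : IsIntegral ℤ x) (hx : σ x = x) :
    ∃ n : ℤ, x = n := by
  obtain ⟨q, rfl⟩ := h.fixed_rat hx
  obtain ⟨n, rfl⟩ := rat_int hi
  exact ⟨n, by simp⟩

lemma Setup.beta_int (h : Setup σ β) : IsIntegral ℤ β :=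
  ⟨Polynomial.X ^ 2 + 1, by monicity!, by simp [h.bb]⟩

/-- `i` in the ring of integers -/
noncomputable def Setup.io (h : Setup σ β) : 𝓞 K := ⟨β, h.beta_int⟩

lemma Setup.coe_io (h : Setup σ β) : ((h.io : 𝓞 K) : K) = β := rfl

/-- the embedding of the Gaussian integers -/
noncomputable def Setup.e (h : Setup σ β) : GaussianInt →+* 𝓞 K :=
  Zsqrtd.lift ⟨h.io, by
    apply RingOfIntegers.ext
    simp [h.coe_io, ← h.bb, pow_two]⟩

lemma Setup.coe_e (h : Setup σ β) (g : GaussianInt) :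
    ((h.e g : 𝓞 K) : K) = g.re + g.im * β := by
  simp [Setup.e, h.coe_io]

lemma Setup.coe_e_pow (h : Setup σ β) (g : GaussianInt) (k : ℕ) :
    (σ ^ k) ((h.e g : 𝓞 K) : K) = g.re + (-1) ^ k * g.im * β := by
  rw [h.coe_e, map_add, map_mul, h.beta_pow]
  simp; ring

lemma Setup.fixed2 (h : Setup σ β) {x : K} (hi : IsIntegral ℤ x) (hx : (σ ^ 2) x = x) :
    ∃ g : GaussianInt, x = (h.e g : 𝓞 K) := by
  have hx' : σ (σ x) = x := by rw [pow_two, AlgEquiv.mul_apply] at hx; exact hx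
  have his : IsIntegral ℤ (σ x) := hi.map (σ : K →ₐ[ℚ] K)
  obtain ⟨A, hA⟩ := h.fixed_int (hi.add his) (by rw [map_add, hx']; ring)
  obtain ⟨B, hB⟩ := h.fixed_int ((his.sub hi).mul h.beta_int) (by rw [map_mul, map_sub, hx', h.sb]; ring)
  obtain ⟨C, hC⟩ := h.fixed_int (hi.mul his) (by rw [map_mul, hx']; ring)
  have hb := h.bb
  have h1 : ((A ^ 2 + B ^ 2 : ℤ) : K) = ((4 * C : ℤ) : K) := by
    push_cast
    rw [← hA, ← hB, ← hC]
    linear_combination (σ x - x) ^ 2 * hb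
  have h2 : A ^ 2 + B ^ 2 = 4 * C := by exact_mod_cast h1
  have hpar : A % 2 = 0 ∧ B % 2 = 0 := by
    rcases Int.even_or_odd' A with ⟨a, rfl | rfl⟩ <;> rcases Int.even_or_odd' B with ⟨b, rfl | rfl⟩
    · omega
    · exfalso
      have : 4 * (a * a + b * b + b) + 1 = 4 * C := by linarith
      omega
    · exfalso
      have : 4 * (a * a + b * b + a) + 1 = 4 * C := by linarith
      omega
    · exfalso
      have : 4 * (a * a + b * b + a + b) + 2 = 4 * C := by linarith
      omega
  obtain ⟨a, ha⟩ : ∃ a, A = 2 * a := ⟨A / 2, by omega⟩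
  obtain ⟨b, hb'⟩ : ∃ b, B = 2 * b := ⟨B / 2, by omega⟩
  refine ⟨⟨a, b⟩, ?_⟩
  rw [h.coe_e]
  simp only
  rw [ha] at hA
  rw [hb'] at hB
  push_cast at hA hB
  linear_combination hA / 2 + β * hB / 2 - (σ x - x) / 2 * hb
end two
end Shi

namespace Shi

section three
variable {K : Type*} [Field K] [NumberField K] [IsGalois ℚ K]
variable {σ : K ≃ₐ[ℚ] K} {β : K}

/-- the relative norm to `ℚ(i)`, on integers -/
noncomputable def rn (σ : K ≃ₐ[ℚ] K) (x : 𝓞 K) : 𝓞 K := x * gr (σ ^ 2) x * gr (σ ^ 4) x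

/-- the relative norm to `ℚ(i)`, on ideals -/
noncomputable def rnI (σ : K ≃ₐ[ℚ] K) (I : Ideal (𝓞 K)) : Ideal (𝓞 K) :=
  I * idealConj (σ ^ 2) I * idealConj (σ ^ 4) I

lemma rnI_mul (I J : Ideal (𝓞 K)) : rnI σ (I * J) = rnI σ I * rnI σ J := by
  simp only [rnI, ic_mul]; ring

lemma rnI_span (x : 𝓞 K) : rnI σ (Ideal.span {x}) = Ideal.span {rn σ x} := by
  simp only [rnI, rn, ic_span, Ideal.span_singleton_mul_span_singleton]

lemma rnI_absNorm (I : Ideal (𝓞 K)) : Ideal.absNorm (rnI σ I) = Ideal.absNorm I ^ 3 := by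
  simp only [rnI, map_mul, ic_absNorm]; ring

lemma Setup.rn_fixed (h : Setup σ β) (x : 𝓞 K) : ∃ g : GaussianInt, rn σ x = h.e g := by
  obtain ⟨g, hg⟩ := h.fixed2 (x := ((rn σ x : 𝓞 K) : K)) (RingOfIntegers.isIntegral_coe _) (by
    simp only [rn, map_mul, coe_gr]
    simp only [← AlgEquiv.mul_apply, ← pow_add]
    norm_num [h.six]
    ring)
  exact ⟨g, RingOfIntegers.ext hg⟩

lemma Setup.relgen (h : Setup σ β) {I : Ideal (𝓞 K)} (hI : I ≠ ⊥) :
    ∃ g : GaussianInt, rnI σ I = Ideal.span {h.e g} := by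
  let 𝔟 : Ideal GaussianInt := Ideal.span {g | ∃ x ∈ I, h.e g = rn σ x}
  obtain ⟨g0, hg0⟩ := (IsPrincipalIdealRing.principal 𝔟).principal
  have hg0' : 𝔟 = Ideal.span {g0} := hg0
  refine ⟨g0, ?_⟩
  have hle : 𝔟 ≤ Ideal.comap h.e (rnI σ I) := by
    rw [Ideal.span_le]
    rintro g ⟨x, hx, hg⟩
    change h.e g ∈ rnI σ I
    rw [hg]
    exact Ideal.mul_mem_mul (Ideal.mul_mem_mul hx ((mem_ic _ _ _).2 hx)) ((mem_ic _ _ _).2 hx)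
  have h1 : Ideal.span {h.e g0} ≤ rnI σ I := by
    rw [Ideal.span_singleton_le_iff_mem]
    apply hle
    rw [hg0']
    exact Ideal.mem_span_singleton_self _
  set n : 𝓞 K := (Ideal.absNorm I : 𝓞 K) with hn
  have hn0 : n ≠ 0 := by
    rw [hn]
    have : Ideal.absNorm I ≠ 0 := by rwa [Ne, Ideal.absNorm_eq_zero_iff]
    exact_mod_cast this
  obtain ⟨a, ha⟩ := IsDedekindDomain.exists_sup_span_eq (I := Ideal.span {n} * I) (J := I)
    Ideal.mul_le_right (mul_ne_zero (by simpa using hn0) hI)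
  have haI : Ideal.span {a} ≤ I := by
    conv_rhs => rw [← ha]
    exact le_sup_right
  obtain ⟨J, hJ⟩ := Ideal.dvd_iff_le.2 haI
  have hcop : IsCoprime (Ideal.span {n}) J := by
    rw [Ideal.isCoprime_iff_sup_eq]
    rw [hJ, mul_comm, ← Ideal.mul_sup] at ha
    exact mul_left_cancel₀ hI (ha.trans (by rw [Ideal.mul_top]))
  have hmem : ∀ x ∈ I, Ideal.span {h.e g0} ∣ Ideal.span {rn σ x} := by
    intro x hx
    obtain ⟨g, hg⟩ := h.rn_fixed x
    have : g ∈ 𝔟 := Ideal.subset_span ⟨x, hx, hg.symm⟩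
    rw [hg0', Ideal.mem_span_singleton] at this
    rw [hg, Ideal.dvd_iff_le, Ideal.span_singleton_le_span_singleton]
    exact map_dvd h.e this
  have hcopk : ∀ k : ℕ, IsCoprime (Ideal.span {n}) (idealConj (σ ^ k) J) := by
    intro k
    rw [Ideal.isCoprime_iff_sup_eq] at hcop ⊢
    have h2 := congrArg (idealConj (σ ^ k)) hcop
    rw [ic_top, ic_def, Ideal.map_sup, ← ic_def, ← ic_def, ic_span, hn, map_natCast] at h2
    exact h2
  have hcop3 : IsCoprime (Ideal.span {h.e g0}) (rnI σ J) := by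
    have h3 : IsCoprime (Ideal.span {rn σ n}) (rnI σ J) := by
      have : rn σ n = n ^ 3 := by simp only [rn, hn, map_natCast]; ring
      rw [this, ← Ideal.span_singleton_pow]
      exact IsCoprime.pow_left ((hcop.mul_right (hcopk 2)).mul_right (hcopk 4))
    exact h3.of_isCoprime_of_dvd_left (hmem n (Ideal.absNorm_mem I))
  refine le_antisymm ?_ h1
  rw [← Ideal.dvd_iff_le]
  apply hcop3.dvd_of_dvd_mul_right
  rw [← rnI_mul, ← hJ, rnI_span]
  exact hmem a (Ideal.span_singleton_le_iff_mem _ |>.1 haI)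
end three
end Shi

namespace Shi

section four
variable {K : Type*} [Field K] [NumberField K] [IsGalois ℚ K]
variable {σ : K ≃ₐ[ℚ] K} {β : K}

lemma Setup.prod_univ (h : Setup σ β) (f : (K ≃ₐ[ℚ] K) → K) :
    ∏ τ : K ≃ₐ[ℚ] K, f τ = ∏ k ∈ Finset.range 6, f (σ ^ k) := by
  symm
  apply Finset.prod_nbij (fun k => σ ^ k)
  · simp
  · intro a ha b hb hab
    apply pow_injOn_Iio_orderOf _ _ hab
    · simpa [h.ord] using ha
    · simpa [h.ord] using hb
  · intro τ _
    obtain ⟨k, hk, rfl⟩ := h.exists_pow τ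
    exact ⟨k, by simpa using hk, rfl⟩
  · simp

lemma Setup.sum_univ (h : Setup σ β) (f : (K ≃ₐ[ℚ] K) → K) :
    ∑ τ : K ≃ₐ[ℚ] K, f τ = ∑ k ∈ Finset.range 6, f (σ ^ k) := by
  symm
  apply Finset.sum_nbij (fun k => σ ^ k)
  · simp
  · intro a ha b hb hab
    apply pow_injOn_Iio_orderOf _ _ hab
    · simpa [h.ord] using ha
    · simpa [h.ord] using hb
  · intro τ _
    obtain ⟨k, hk, rfl⟩ := h.exists_pow τ
    exact ⟨k, by simpa using hk, rfl⟩
  · simp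

lemma Setup.norm_eq (h : Setup σ β) (x : 𝓞 K) :
    ((Algebra.norm ℤ x : ℤ) : K) = (rn σ x : 𝓞 K) * (σ ^ 3) ((rn σ x : 𝓞 K) : K) := by
  have h1 := Algebra.norm_eq_prod_automorphisms ℚ (x : K)
  rw [h.prod_univ, ← Algebra.coe_norm_int] at h1
  have h2 : algebraMap ℚ K ((Algebra.norm ℤ x : ℤ) : ℚ) = ((Algebra.norm ℤ x : ℤ) : K) := by simp
  rw [← h2, h1]
  simp only [rn, map_mul, coe_gr]
  simp only [← AlgEquiv.mul_apply, ← pow_add]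
  have h7 : σ ^ 7 = σ := by rw [pow_succ, h.six, one_mul]
  simp [Finset.prod_range_succ, h7]
  ring

lemma Setup.conj_nonneg (h : Setup σ β) (x : K) (n : ℤ) (hx : (n : K) = x * (σ ^ 3) x) : 0 ≤ n := by
  let φ : K →+* ℂ := Classical.choice (inferInstance : Nonempty _)
  have h2 := congrArg φ hx
  rw [map_mul, h.conj, Complex.mul_conj, map_intCast] at h2
  have h3 : (n : ℝ) = Complex.normSq (φ x) := by exact_mod_cast h2
  have := Complex.normSq_nonneg (φ x)
  rw [← h3] at this
  exact_mod_cast this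

lemma Setup.absNorm_eq (h : Setup σ β) (x : 𝓞 K) :
    ((Ideal.absNorm (Ideal.span {x}) : ℕ) : K) =
      (rn σ x : 𝓞 K) * (σ ^ 3) ((rn σ x : 𝓞 K) : K) := by
  rw [← h.norm_eq, Ideal.absNorm_span_singleton]
  have := h.conj_nonneg _ _ (h.norm_eq x)
  have h2 : ((Algebra.norm ℤ x).natAbs : ℤ) = Algebra.norm ℤ x := Int.natAbs_of_nonneg this
  rw [← Int.cast_natCast, h2]

lemma Setup.trace_eq (h : Setup σ β) (x : 𝓞 K) :
    ((Algebra.trace ℤ (𝓞 K) x : ℤ) : K) = ∑ k ∈ Finset.range 6, (σ ^ k) (x : K) := by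
  have h1 := trace_eq_sum_automorphisms (K := ℚ) (x : K)
  rw [h.sum_univ, ← Algebra.coe_trace_int] at h1
  rw [← h1]
  simp

/-- the cubic element -/
structure Cub (σ : K ≃ₐ[ℚ] K) (α : K) : Prop where
  eqn : α ^ 3 = 21 * α + 28
  fix : (σ ^ 3) α = α
  s1 : α + σ α + σ (σ α) = 0
  s2 : α * α + α * σ α + σ α * σ α = 21

lemma no_root (h : Setup σ β) {r : K} (hr : r ^ 3 = 21 * r + 28) : σ r ≠ r := by
  intro hf
  have hi : IsIntegral ℤ r := ⟨Polynomial.X ^ 3 - (21 * Polynomial.X + 28), by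
    apply Polynomial.Monic.sub_of_left (Polynomial.monic_X_pow 3)
    rw [show ((21 * Polynomial.X + 28 : Polynomial ℤ)) = Polynomial.C 21 * Polynomial.X + Polynomial.C 28 by simp]
    exact lt_of_le_of_lt Polynomial.degree_linear_le (by rw [Polynomial.degree_X_pow]; norm_num), by
    simp [hr]⟩
  obtain ⟨n, rfl⟩ := h.fixed_int hi hf
  have h1 : n ^ 3 = 21 * n + 28 := by exact_mod_cast hr
  have h2 : ∀ m : ZMod 5, m ^ 3 ≠ 21 * m + 28 := by decide
  apply h2 n
  exact_mod_cast congrArg (Int.cast : ℤ → ZMod 5) h1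

lemma Setup.cub (h : Setup σ β) {α : K} (hα : α ^ 3 = 21 * α + 28) : Cub σ α := by
  have h1 : (σ α) ^ 3 = 21 * σ α + 28 := by rw [← map_pow, hα]; simp [map_ofNat]
  have h2 : (σ (σ α)) ^ 3 = 21 * σ (σ α) + 28 := by rw [← map_pow, h1]; simp [map_ofNat]
  have n1 := no_root h hα
  have hq : α * α + α * σ α + σ α * σ α = 21 := by
    have : (σ α - α) * (α * α + α * σ α + σ α * σ α - 21) = 0 := by linear_combination h1 - hα
    rcases mul_eq_zero.1 this with h' | h'
    · exact absurd (sub_eq_zero.1 h') n1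
    · linear_combination h'
  have hs : α + σ α + σ (σ α) = 0 := by
    have : (σ (σ α) - α) * ((σ (σ α) - σ α) * (α + σ α + σ (σ α))) = 0 := by
      linear_combination (σ (σ α)) * hq - (σ (σ α)) * hq + h2 - hα - (σ (σ α) - α) * hq
    rcases mul_eq_zero.1 this with h' | h'
    · exfalso
      have h'' := sub_eq_zero.1 h'
      apply no_root h (r := -(α + σ α))
      · linear_combination -hα - h1 - 3 * (α * hq - hα)
      · rw [map_neg, map_add, h'']; ring
    rcases mul_eq_zero.1 h' with h' | h'
    · exact absurd (σ.injective (sub_eq_zero.1 h')) n1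
    · exact h'
  refine ⟨hα, ?_, hs, hq⟩
  have h3 := congrArg σ hs
  rw [map_add, map_add, map_zero] at h3
  have : (σ ^ 3) α = σ (σ (σ α)) := rfl
  rw [this]
  linear_combination h3 - hs
end four
end Shi

namespace Shi
section five
variable {K : Type*} [Field K] [NumberField K] [IsGalois ℚ K] {σ : K ≃ₐ[ℚ] K} {β α : K}

lemma tr_one (h : Setup σ β) (ha : Cub σ α) {y : 𝓞 K} {A B C : ℚ} {n : ℤ}
    (hy : (y : K) = A + B * α + C * α ^ 2) (hn : (n : ℚ) = 6 * A + 84 * C) :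
    Algebra.trace ℤ (𝓞 K) y = n := by
  have h1 := h.trace_eq y
  have e3 : (σ ^ 3) α = α := ha.fix
  have e4 : (σ ^ 4) α = σ α := by rw [pow_succ', AlgEquiv.mul_apply, e3]
  have e5 : (σ ^ 5) α = σ (σ α) := by rw [pow_succ', AlgEquiv.mul_apply, e4]
  have e2 : (σ ^ 2) α = σ (σ α) := rfl
  have hn' : (n : K) = 6 * A + 84 * C := by exact_mod_cast congrArg (Rat.cast : ℚ → K) hn
  rw [hy] at h1
  have h2 : ((Algebra.trace ℤ (𝓞 K) y : ℤ) : K) = n := by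
    rw [h1, hn']
    simp only [Finset.sum_range_succ, Finset.sum_range_zero, map_add, map_mul, map_pow, map_ratCast, e2, e3, e4, e5, pow_zero, pow_one, AlgEquiv.one_apply]
    linear_combination (2 * B + 2 * C * (σ (σ α) - α - σ α)) * ha.s1 + 4 * C * ha.s2
  exact_mod_cast h2

lemma tr_two (h : Setup σ β) (ha : Cub σ α) {y : 𝓞 K} {A B C : ℚ}
    (hy : (y : K) = β * (A + B * α + C * α ^ 2)) :
    Algebra.trace ℤ (𝓞 K) y = 0 := by
  have h1 := h.trace_eq y
  have e3 : (σ ^ 3) α = α := ha.fix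
  have e4 : (σ ^ 4) α = σ α := by rw [pow_succ', AlgEquiv.mul_apply, e3]
  have e5 : (σ ^ 5) α = σ (σ α) := by rw [pow_succ', AlgEquiv.mul_apply, e4]
  have e2 : (σ ^ 2) α = σ (σ α) := rfl
  rw [hy] at h1
  have h2 : ((Algebra.trace ℤ (𝓞 K) y : ℤ) : K) = (0 : ℤ) := by
    rw [h1]
    simp only [Finset.sum_range_succ, Finset.sum_range_zero, map_add, map_mul, map_pow, map_ratCast, e2, e3, e4, e5, h.beta_pow]
    simp
    ring
  exact_mod_cast h2

lemma Cub.int (ha : Cub σ α) : IsIntegral ℤ α := ⟨Polynomial.X ^ 3 - (21 * Polynomial.X + 28), by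
    apply Polynomial.Monic.sub_of_left (Polynomial.monic_X_pow 3)
    rw [show ((21 * Polynomial.X + 28 : Polynomial ℤ)) = Polynomial.C 21 * Polynomial.X + Polynomial.C 28 by simp]
    exact lt_of_le_of_lt Polynomial.degree_linear_le (by rw [Polynomial.degree_X_pow]; norm_num), by
    simp [ha.eqn]⟩

lemma Cub.int2 (ha : Cub σ α) : IsIntegral ℤ ((α ^ 2 + α) / 2) := 
  ⟨Polynomial.X ^ 3 - (21 * Polynomial.X ^ 2 - 84 * Polynomial.X + 28), by
    apply Polynomial.Monic.sub_of_left (Polynomial.monic_X_pow 3)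
    rw [show ((21 * Polynomial.X ^ 2 - 84 * Polynomial.X + 28 : Polynomial ℤ)) = Polynomial.C 21 * Polynomial.X ^ 2 + Polynomial.C (-84) * Polynomial.X + Polynomial.C 28 by simp; ring]
    exact lt_of_le_of_lt Polynomial.degree_quadratic_le (by rw [Polynomial.degree_X_pow]; norm_num), by
    simp
    linear_combination (α ^ 3 / 8 + 3 / 8 * α ^ 2 - 9 / 4 * α + 1) * ha.eqn⟩

/-- generator as an integer -/
noncomputable def Cub.al (ha : Cub σ α) : 𝓞 K := ⟨α, ha.int⟩

lemma Cub.coe_al (ha : Cub σ α) : ((ha.al : 𝓞 K) : K) = α := rfl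

/-- half generator as an integer -/
noncomputable def Cub.om (ha : Cub σ α) : 𝓞 K := ⟨(α ^ 2 + α) / 2, ha.int2⟩

lemma Cub.coe_om (ha : Cub σ α) : ((ha.om : 𝓞 K) : K) = (α ^ 2 + α) / 2 := rfl

/-- the family used for the discriminant bound -/
noncomputable def Cub.u (ha : Cub σ α) : Fin 3 → 𝓞 K := ![1, ha.al, ha.om]

/-- rational coordinates of products -/
def cA : Fin 3 → Fin 3 → ℚ := ![![1, 0, 0], ![0, 0, 14], ![0, 14, 14]]
/-- rational coordinates of products -/
def cB : Fin 3 → Fin 3 → ℚ := ![![0, 1, 1 / 2], ![1, 0, 21 / 2], ![1 / 2, 21 / 2, 35 / 2]]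
/-- rational coordinates of products -/
def cC : Fin 3 → Fin 3 → ℚ := ![![0, 0, 1 / 2], ![0, 1, 1 / 2], ![1 / 2, 1 / 2, 11 / 2]]
/-- trace form -/
def TT : Matrix (Fin 3) (Fin 3) ℤ := !![6, 0, 42; 0, 84, 126; 42, 126, 546]

lemma Cub.u_mul (ha : Cub σ α) (i j : Fin 3) :
    ((ha.u i : 𝓞 K) : K) * (ha.u j : 𝓞 K) = cA i j + cB i j * α + cC i j * α ^ 2 := by
  have := ha.eqn
  fin_cases i <;> fin_cases j <;> simp [Cub.u, cA, cB, cC, Cub.coe_al, Cub.coe_om]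
  · ring
  · ring
  · linear_combination (1 / 2 : K) * this
  · ring
  · linear_combination (1 / 2 : K) * this
  · linear_combination (α / 4 + 1 / 2 : K) * this

lemma Setup.discr_le (h : Setup σ β) (ha : Cub σ α) : |discr K| ≤ 31752 ^ 2 := by
  let v : Fin 3 ⊕ Fin 3 → 𝓞 K := Sum.elim ha.u (fun i => h.io * ha.u i)
  have h1 : Algebra.traceMatrix ℤ v = Matrix.fromBlocks TT 0 0 (-TT) := by
    ext i j
    rw [Algebra.traceMatrix_apply, Algebra.traceForm_apply]
    have hT : ∀ i j, ((TT i j : ℤ) : ℚ) = 6 * cA i j + 84 * cC i j := by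
      intro i j
      fin_cases i <;> fin_cases j <;> simp [TT, cA, cC] <;> norm_num
    rcases i with i | i <;> rcases j with j | j
    · apply tr_one h ha (A := cA i j) (B := cB i j) (C := cC i j) _ (hT i j)
      simp only [v, Sum.elim_inl, map_mul, ha.u_mul]
    · apply tr_two h ha (A := cA i j) (B := cB i j) (C := cC i j)
      simp only [v, Sum.elim_inl, Sum.elim_inr, map_mul, ← ha.u_mul, h.coe_io]
      ring
    · apply tr_two h ha (A := cA i j) (B := cB i j) (C := cC i j)
      simp only [v, Sum.elim_inl, Sum.elim_inr, map_mul, ← ha.u_mul, h.coe_io]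
      ring
    · apply tr_one h ha (A := -cA i j) (B := -cB i j) (C := -cC i j) _
      · simp [hT]; ring
      simp only [v, Sum.elim_inr, map_mul, h.coe_io]
      push_cast
      linear_combination (((ha.u i : 𝓞 K) : K) * (ha.u j : 𝓞 K)) * h.bb - ha.u_mul i j
  have h2 : Algebra.discr ℤ v = -(31752 ^ 2) := by
    rw [Algebra.discr_def, h1, Matrix.det_fromBlocks_zero₂₁]
    have : TT.det = 31752 := by simp [TT, Matrix.det_fin_three]
    rw [Matrix.det_neg, this]
    norm_num
  have hc : Fintype.card (Module.Free.ChooseBasisIndex ℤ (𝓞 K)) = Fintype.card (Fin 3 ⊕ Fin 3) := by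
    rw [← Module.finrank_eq_card_chooseBasisIndex, RingOfIntegers.rank, h.deg]; rfl
  let b := (RingOfIntegers.basis K).reindex (Fintype.equivOfCardEq hc)
  have h3 := Algebra.discr_of_matrix_vecMul b (b.toMatrix v)
  rw [Module.Basis.toMatrix_map_vecMul, NumberField.discr_eq_discr, h2] at h3
  have h4 : (b.toMatrix v).det ≠ 0 := by
    intro h0; rw [h0] at h3; norm_num at h3
  have h5 := congrArg abs h3
  rw [abs_mul, abs_neg, abs_pow, abs_pow, sq_abs, sq_abs] at h5
  have h6 : 1 ≤ (b.toMatrix v).det ^ 2 := by have := sq_pos_of_ne_zero h4; omega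
  have h7 := abs_nonneg (discr K)
  nlinarith

lemma Setup.small (h : Setup σ β) (ha : Cub σ α) {I : Ideal (𝓞 K)} (hI : I ≠ ⊥) :
    ∃ (x y : 𝓞 K) (J : Ideal (𝓞 K)), x ≠ 0 ∧ y ≠ 0 ∧ J ≠ ⊥ ∧ Ideal.absNorm J ≤ 1012 ∧
      Ideal.span {x} * I = Ideal.span {y} * J := by
  have hI' : I ∈ nonZeroDivisors (Ideal (𝓞 K)) := mem_nonZeroDivisors_of_ne_zero hI
  obtain ⟨J, hJ, hn⟩ := exists_ideal_in_class_of_norm_le (ClassGroup.mk0 ⟨I, hI'⟩)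
  obtain ⟨x, y, hx, hy, hxy⟩ := ClassGroup.mk0_eq_mk0_iff.1 hJ.symm
  refine ⟨x, y, J, hx, hy, nonZeroDivisors.coe_ne_zero J, ?_, hxy⟩
  have hd : √|((discr K : ℤ) : ℝ)| ≤ 31752 := by
    rw [Real.sqrt_le_left (by norm_num)]
    exact_mod_cast h.discr_le ha
  have hp : InfinitePlace.nrComplexPlaces K ≤ 3 := by
    have := InfinitePlace.card_add_two_mul_card_eq_rank K
    rw [h.deg] at this
    omega
  have h1 : (4 / Real.pi) ^ InfinitePlace.nrComplexPlaces K ≤ (4 / Real.pi) ^ 3 := by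
    apply pow_le_pow_right₀ _ hp
    rw [le_div_iff₀ Real.pi_pos]
    linarith [Real.pi_le_four]
  have h2 : (4 / Real.pi) ^ 3 ≤ (4 / 3.14) ^ 3 := by
    apply pow_le_pow_left₀ (by positivity)
    exact div_le_div_of_nonneg_left (by norm_num) (by norm_num) Real.pi_gt_d2.le
  rw [h.deg] at hn
  have h3 : ((Ideal.absNorm (J : Ideal (𝓞 K)) : ℕ) : ℝ) < 1013 := by
    refine lt_of_le_of_lt hn ?_
    have h4 : (4 / Real.pi) ^ InfinitePlace.nrComplexPlaces K * ((Nat.factorial 6 : ℕ) / (6 : ℕ) ^ 6 * √|((discr K : ℤ) : ℝ)|) ≤ (4 / 3.14) ^ 3 * ((Nat.factorial 6 : ℕ) / (6 : ℕ) ^ 6 * 31752) := by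
      apply mul_le_mul (h1.trans h2) _ (by positivity) (by positivity)
      exact mul_le_mul_of_nonneg_left hd (by positivity)
    refine lt_of_le_of_lt h4 ?_
    norm_num [Nat.factorial]
  have : Ideal.absNorm (J : Ideal (𝓞 K)) < 1013 := by exact_mod_cast h3
  omega
end five
end Shi

namespace Shi
section six
variable {K : Type*} [Field K] [NumberField K] [IsGalois ℚ K] {σ : K ≃ₐ[ℚ] K} {β α : K}

/-- `ρ I / I` is generated by `ρ t / t`. -/
def S (σ : K ≃ₐ[ℚ] K) (I : Ideal (𝓞 K)) : Prop :=
  ∃ t : 𝓞 K, t ≠ 0 ∧ Ideal.span {t} * idealConj (σ ^ 3) I = Ideal.span {gr (σ ^ 3) t} * I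

lemma gr_ne {τ : K ≃ₐ[ℚ] K} {t : 𝓞 K} (ht : t ≠ 0) : gr τ t ≠ 0 := by
  simpa using ht

lemma Setup.gr33 (h : Setup σ β) (t : 𝓞 K) : gr (σ ^ 3) (gr (σ ^ 3) t) = t := by
  rw [← gr_mul, ← pow_add, h.six, gr_one]

lemma Setup.ic33 (h : Setup σ β) (I : Ideal (𝓞 K)) : idealConj (σ ^ 3) (idealConj (σ ^ 3) I) = I := by
  rw [← ic_comp, ← pow_add, h.six, ic_one]

lemma S_mul {I J : Ideal (𝓞 K)} (hI : S σ I) (hJ : S σ J) : S σ (I * J) := by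
  obtain ⟨t, ht, h1⟩ := hI
  obtain ⟨u, hu, h2⟩ := hJ
  refine ⟨t * u, mul_ne_zero ht hu, ?_⟩
  rw [ic_mul, map_mul, ← Ideal.span_singleton_mul_span_singleton, ← Ideal.span_singleton_mul_span_singleton]
  calc _ = (Ideal.span {t} * idealConj (σ ^ 3) I) * (Ideal.span {u} * idealConj (σ ^ 3) J) := by ring
    _ = _ := by rw [h1, h2]; ring

lemma S_cancel (h : Setup σ β) {I J : Ideal (𝓞 K)} (hJ0 : J ≠ ⊥) (hI : S σ (I * J)) (hJ : S σ J) : S σ I := by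
  obtain ⟨t, ht, h1⟩ := hI
  obtain ⟨u, hu, h2⟩ := hJ
  refine ⟨t * gr (σ ^ 3) u, mul_ne_zero ht (gr_ne hu), ?_⟩
  rw [ic_mul] at h1
  rw [map_mul, h.gr33, ← Ideal.span_singleton_mul_span_singleton, ← Ideal.span_singleton_mul_span_singleton]
  have h3 : idealConj (σ ^ 3) J ≠ 0 := ic_ne_bot _ hJ0
  apply mul_right_cancel₀ h3
  calc _ = Ideal.span {gr (σ ^ 3) u} * (Ideal.span {t} * (idealConj (σ ^ 3) I * idealConj (σ ^ 3) J)) := by ring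
    _ = Ideal.span {gr (σ ^ 3) t} * I * (Ideal.span {gr (σ ^ 3) u} * J) := by rw [h1]; ring
    _ = _ := by rw [← h2]; ring

lemma S_span {t : 𝓞 K} (ht : t ≠ 0) : S σ (Ideal.span {t}) :=
  ⟨t, ht, by rw [ic_span, mul_comm]⟩

lemma S_amb {I : Ideal (𝓞 K)} (hI : idealConj (σ ^ 3) I = I) : S σ I :=
  ⟨1, one_ne_zero, by rw [hI, map_one]⟩

lemma S_ic {I : Ideal (𝓞 K)} (k : ℕ) (hI : S σ I) : S σ (idealConj (σ ^ k) I) := by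
  obtain ⟨t, ht, h1⟩ := hI
  refine ⟨gr (σ ^ k) t, gr_ne ht, ?_⟩
  rw [← ic_comp, ← gr_mul, ← pow_add, add_comm, pow_add, ic_comp, gr_mul, ← ic_span, ← ic_mul, h1,
    ic_mul, ic_span]

lemma Setup.e_gr (h : Setup σ β) (g : GaussianInt) (k : ℕ) : gr (σ ^ (2 * k)) (h.e g) = h.e g := by
  apply RingOfIntegers.ext
  rw [coe_gr, h.coe_e_pow, h.coe_e]; simp [pow_mul]

lemma Setup.e_gr' (h : Setup σ β) (g : GaussianInt) (k : ℕ) :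
    gr (σ ^ (2 * k + 1)) (h.e g) = h.e (star g) := by
  apply RingOfIntegers.ext
  rw [coe_gr, h.coe_e_pow, h.coe_e]; simp [pow_mul, pow_succ]

lemma Setup.rn_e (h : Setup σ β) (g : GaussianInt) : rn σ (h.e g) = h.e (g ^ 3) := by
  rw [rn, h.e_gr g 1, h.e_gr g 2, map_pow]; ring

lemma gnorm (g : GaussianInt) : ((g.norm : ℤ) : GaussianInt) = g * star g := Zsqrtd.norm_eq_mul_conj g

lemma Setup.absNorm_rn (h : Setup σ β) {x : 𝓞 K} {g : GaussianInt} (hx : rn σ x = h.e g) :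
    ((Ideal.absNorm (Ideal.span {x}) : ℕ) : ℤ) = g.norm := by
  have h1 := h.absNorm_eq x
  rw [hx, ← coe_gr, h.e_gr' g 1, ← map_mul, ← map_mul, ← gnorm, map_intCast, map_intCast] at h1
  exact_mod_cast h1

lemma Setup.absNorm_e (h : Setup σ β) (g : GaussianInt) :
    ((Ideal.absNorm (Ideal.span {h.e g}) : ℕ) : ℤ) = g.norm ^ 3 := by
  rw [h.absNorm_rn (h.rn_e g), pow_succ, pow_two, Zsqrtd.norm_mul, Zsqrtd.norm_mul]; ring

lemma Setup.gen_norm (h : Setup σ β) {I : Ideal (𝓞 K)} {g : GaussianInt}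
    (hg : rnI σ I = Ideal.span {h.e g}) : ((Ideal.absNorm I : ℕ) : ℤ) = g.norm := by
  have h1 := h.absNorm_e g
  rw [← hg, rnI_absNorm] at h1
  push_cast at h1
  exact (Odd.strictMono_pow (n := 3) (by decide)).injective h1

lemma prime_eq {P Q : Ideal (𝓞 K)} (hP : P.IsPrime) (hQ : Q.IsPrime) (h0 : P ≠ ⊥) (hle : P ≤ Q) : P = Q :=
  (Ideal.IsPrime.isMaximal hP h0).eq_of_le hQ.ne_top hle

lemma prime_of_rnI {P Q : Ideal (𝓞 K)} (hP : P.IsPrime) (hQ : Q.IsPrime) (h0 : P ≠ ⊥)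
    (hle : rnI σ P ≤ Q) : ∃ k, idealConj (σ ^ (2 * k)) P = Q := by
  rw [rnI, hQ.mul_le, hQ.mul_le] at hle
  rcases hle with (hle | hle) | hle
  · exact ⟨0, by simpa [ic_one] using prime_eq hP hQ h0 hle⟩
  · exact ⟨1, prime_eq (ic_prime _ hP) hQ (ic_ne_bot _ h0) hle⟩
  · exact ⟨2, prime_eq (ic_prime _ hP) hQ (ic_ne_bot _ h0) hle⟩

lemma ic_rnI (k : ℕ) (I : Ideal (𝓞 K)) : idealConj (σ ^ k) (rnI σ I) = rnI σ (idealConj (σ ^ k) I) := by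
  simp only [rnI, ic_mul, ← ic_comp, ← pow_add, add_comm]

lemma Setup.amb (h : Setup σ β) {P : Ideal (𝓞 K)} (hP : P.IsPrime) (h0 : P ≠ ⊥) {g : GaussianInt}
    (hg : rnI σ P = Ideal.span {h.e g}) (ha : Associated (star g) g) : idealConj (σ ^ 3) P = P := by
  have h1 : rnI σ (idealConj (σ ^ 3) P) = rnI σ P := by
    rw [← ic_rnI, hg, ic_span, h.e_gr' g 1, Ideal.span_singleton_eq_span_singleton]
    exact ha.map h.e
  obtain ⟨k, hk⟩ := prime_of_rnI (σ := σ) hP (ic_prime (σ ^ 3) hP) h0 (by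
    rw [← h1, rnI]; exact Ideal.mul_le_left.trans Ideal.mul_le_left)
  have h2 : ∀ Q, idealConj (σ ^ (2 * k)) (idealConj (σ ^ (2 * k)) (idealConj (σ ^ (2 * k)) Q)) = Q := by
    intro Q
    rw [← ic_comp, ← ic_comp, ← pow_add, ← pow_add, show 2 * k + 2 * k + 2 * k = 6 * k by ring, pow_mul, h.six, one_pow, ic_one]
  have h3 : ∀ Q, idealConj (σ ^ (2 * k)) (idealConj (σ ^ 3) Q) = idealConj (σ ^ 3) (idealConj (σ ^ (2 * k)) Q) := by
    intro Q
    rw [← ic_comp, ← ic_comp, ← pow_add, ← pow_add, add_comm]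
  have h4 := h2 P
  rw [hk, h3, hk, h.ic33, hk] at h4
  exact h4

lemma star_assoc_of {q : GaussianInt} (hq : Prime q) (hs : Associated (star q) q) {g : GaussianInt} {n : ℕ}
    (hg : g ∣ q ^ n) : Associated (star g) g := by
  obtain ⟨i, -, hi⟩ := (dvd_prime_pow hq n).1 hg
  have : Associated (star g) (star (q ^ i)) := hi.map (starRingEnd GaussianInt)
  rw [star_pow] at this
  exact this.trans ((hs.pow_pow (n := i)).trans hi.symm)

lemma star_assoc {g : GaussianInt} {p n : ℕ} (hp : p.Prime) (hp' : p = 2 ∨ p % 4 = 3)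
    (hg : g.norm = (p : ℤ) ^ n) : Associated (star g) g := by
  have := Fact.mk hp
  have hd : g ∣ (p : GaussianInt) ^ n := ⟨star g, by rw [← gnorm, hg]; simp⟩
  rcases hp' with rfl | h3
  · have hq : Prime (⟨1, 1⟩ : GaussianInt) := by
      rw [← irreducible_iff_prime]
      refine Zsqrtd.norm_eq_one_iff.not.1 (by decide) |> fun hu => ⟨hu, ?_⟩
      intro a b hab
      have h1 := congrArg (fun z : GaussianInt => z.norm.natAbs) hab
      simp only [Zsqrtd.norm_mul, Int.natAbs_mul] at h1
      have h2 : (⟨1, 1⟩ : GaussianInt).norm.natAbs = 2 := by decide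
      rw [h2] at h1
      rcases (Nat.dvd_prime Nat.prime_two).1 ⟨_, h1⟩ with h | h
      · left; exact Zsqrtd.norm_eq_one_iff.1 h
      · right; rw [h] at h1; exact Zsqrtd.norm_eq_one_iff.1 (by omega)
    have hu : IsUnit (⟨0, -1⟩ : GaussianInt) := Zsqrtd.norm_eq_one_iff.1 (by decide)
    apply star_assoc_of hq (n := 2 * n)
    rotate_left
    · refine Associated.symm ⟨hu.unit, ?_⟩
      ext <;> simp
    · rw [pow_mul]
      refine hd.trans (pow_dvd_pow_of_dvd ⟨⟨0, 1⟩, ?_⟩ n)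
      ext <;> simp [sq]
  · apply star_assoc_of (GaussianInt.prime_of_nat_prime_of_mod_four_eq_three p h3) _ hd
    simp

lemma nat_ne {n : ℕ} (hn : n ≠ 0) : (n : 𝓞 K) ≠ 0 := by exact_mod_cast hn

lemma Setup.norm_prime (h : Setup σ β) {P : Ideal (𝓞 K)} (hP : P.IsPrime) {p : ℕ} (hp : p.Prime) 
    (hm : (p : 𝓞 K) ∈ P) : ∃ k, 1 ≤ k ∧ Ideal.absNorm P = p ^ k := by
  have h1 : Ideal.absNorm P ∣ p ^ 6 := by
    have := Ideal.absNorm_dvd_absNorm_of_le ((Ideal.span_singleton_le_iff_mem P).2 hm)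
    have h2 := h.absNorm_e (p : GaussianInt)
    rw [map_natCast] at h2
    have h3 : Ideal.absNorm (Ideal.span {(p : 𝓞 K)}) = p ^ 6 := by
      have : ((p : GaussianInt)).norm = (p : ℤ) ^ 2 := by simp [Zsqrtd.norm]; ring
      rw [this, ← pow_mul] at h2
      exact_mod_cast h2
    rwa [h3] at this
  obtain ⟨k, -, hk⟩ := (Nat.dvd_prime_pow hp).1 h1
  refine ⟨k, ?_, hk⟩
  rcases k with _ | k
  · exfalso
    rw [pow_zero, Ideal.absNorm_eq_one_iff] at hk
    exact hP.ne_top hk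
  · omega

lemma exists_prime {P : Ideal (𝓞 K)} (hP : P.IsPrime) {n : ℕ} (hn : n ≠ 0) (hm : (n : 𝓞 K) ∈ P) :
    ∃ p, p.Prime ∧ p ∣ n ∧ (p : 𝓞 K) ∈ P := by
  induction n using Nat.recOnMul with
  | zero => exact absurd rfl hn
  | one => exact absurd ((Ideal.eq_top_iff_one _).2 (by simpa using hm)) hP.ne_top
  | prime p hp => exact ⟨p, hp, dvd_rfl, hm⟩
  | mul a b iha ihb =>
    rw [Nat.cast_mul] at hm
    rcases hP.mem_or_mem hm with h1 | h1
    · obtain ⟨p, hp, hd, hq⟩ := iha (by rintro rfl; simp at hn) h1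
      exact ⟨p, hp, hd.mul_right _, hq⟩
    · obtain ⟨p, hp, hd, hq⟩ := ihb (by rintro rfl; simp at hn) h1
      exact ⟨p, hp, hd.mul_left _, hq⟩

lemma Setup.S_ram (h : Setup σ β) {P : Ideal (𝓞 K)} (hP : P.IsPrime) (h0 : P ≠ ⊥) {p : ℕ} (hp : p.Prime) 
    (hp' : p = 2 ∨ p % 4 = 3) (hm : (p : 𝓞 K) ∈ P) : S σ P := by
  obtain ⟨k, -, hk⟩ := h.norm_prime hP hp hm
  obtain ⟨g, hg⟩ := h.relgen h0
  apply S_amb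
  apply h.amb hP h0 hg
  apply star_assoc hp hp' (n := k)
  rw [← h.gen_norm hg, hk]; simp

/-- all primes over `p` are in `S` -/
def SP (σ : K ≃ₐ[ℚ] K) (p : ℕ) : Prop := ∀ P : Ideal (𝓞 K), P.IsPrime → P ≠ ⊥ → (p : 𝓞 K) ∈ P → S σ P

lemma S_of_primes {J : Ideal (𝓞 K)} (hJ : J ≠ ⊥)
    (hp : ∀ p, p.Prime → p ∣ Ideal.absNorm J → SP σ p) : S σ J := by
  induction J using UniqueFactorizationMonoid.induction_on_prime with
  | h₁ => exact absurd rfl hJ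
  | h₂ J hu =>
    rw [Ideal.isUnit_iff] at hu
    rw [hu]; apply S_amb; rw [ic_top]
  | h₃ J P hJ0 hPp ih =>
    have hP := Ideal.isPrime_of_prime hPp
    rw [map_mul] at hp
    apply S_mul
    · obtain ⟨p, hp', hd, hm⟩ := exists_prime hP (n := Ideal.absNorm P) 
        (by rw [Ne, Ideal.absNorm_eq_zero_iff]; exact hPp.ne_zero) (Ideal.absNorm_mem P)
      exact hp p hp' (hd.mul_right _) P hP hPp.ne_zero hm
    · exact ih hJ0 (fun p hp' hd => hp p hp' (hd.mul_left _))

lemma Setup.conjugate (h : Setup σ β) {P Q : Ideal (𝓞 K)} (hP : P.IsPrime) (hQ : Q.IsPrime) (h0 : P ≠ ⊥)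
    {p : ℕ} (hp : p.Prime) (hmP : (p : 𝓞 K) ∈ P) (hmQ : (p : 𝓞 K) ∈ Q) : ∃ k, Q = idealConj (σ ^ k) P := by
  obtain ⟨g, hg⟩ := h.relgen h0
  obtain ⟨k, hk1, hk⟩ := h.norm_prime hP hp hmP
  have h1 : rnI σ P * idealConj (σ ^ 3) (rnI σ P) ≤ Q := by
    rw [hg, ic_span, h.e_gr' g 1, Ideal.span_singleton_mul_span_singleton, ← map_mul, ← gnorm, map_intCast,
      ← h.gen_norm hg, hk, Ideal.span_singleton_le_iff_mem]
    push_cast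
    exact Ideal.pow_mem_of_mem Q hmQ k hk1
  rcases hQ.mul_le.1 h1 with h1 | h1
  · obtain ⟨k, hk⟩ := prime_of_rnI hP hQ h0 h1
    exact ⟨_, hk.symm⟩
  · rw [ic_rnI] at h1
    obtain ⟨k, hk⟩ := prime_of_rnI (ic_prime _ hP) hQ (ic_ne_bot _ h0) h1
    exact ⟨2 * k + 3, by rw [← hk, ← ic_comp, ← pow_add]⟩
end six
end Shi

namespace Shi
section seven
variable {K : Type*} [Field K] [NumberField K] [IsGalois ℚ K] {σ : K ≃ₐ[ℚ] K} {β α : K}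

lemma Setup.rn_lin (h : Setup σ β) (ha : Cub σ α) (a b : GaussianInt) :
    rn σ (h.e a - h.e b * ha.al) = h.e (a ^ 3 - 21 * a * b ^ 2 - 28 * b ^ 3) := by
  apply RingOfIntegers.ext
  have e2 : (σ ^ 2) α = σ (σ α) := rfl
  have e4 : (σ ^ 4) α = σ α := by rw [pow_succ', AlgEquiv.mul_apply, ha.fix]
  have f2 : gr (σ ^ 2) (h.e a - h.e b * ha.al) = h.e a - h.e b * gr (σ ^ 2) ha.al := by
    rw [map_sub, map_mul, h.e_gr a 1, h.e_gr b 1]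
  have f4 : gr (σ ^ 4) (h.e a - h.e b * ha.al) = h.e a - h.e b * gr (σ ^ 4) ha.al := by
    rw [map_sub, map_mul, h.e_gr a 2, h.e_gr b 2]
  rw [rn, f2, f4]
  simp only [map_mul, map_sub, map_pow, coe_gr, ha.coe_al, e2, e4, map_ofNat]
  generalize algebraMap (𝓞 K) K (h.e a) = A
  generalize algebraMap (𝓞 K) K (h.e b) = B
  have hc : σ (σ α) = -α - σ α := by linear_combination ha.s1
  rw [hc]
  linear_combination (A * B ^ 2) * (-ha.s2) + B ^ 3 * (-ha.eqn + α * ha.s2)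

lemma Setup.cert (h : Setup σ β) (ha : Cub σ α) {p m : ℕ} (hp : p.Prime) (a b : GaussianInt)
    (hn : Zsqrtd.norm (a ^ 3 - 21 * a * b ^ 2 - 28 * b ^ 3) = ((p * m : ℕ) : ℤ)) (hm : ¬ p ∣ m)
    (hq : ∀ q, q.Prime → q ∣ m → SP σ q) : SP σ p := by
  have h1 := h.absNorm_rn (h.rn_lin ha a b)
  rw [hn] at h1
  have h1' : Ideal.absNorm (Ideal.span {h.e a - h.e b * ha.al}) = p * m := by exact_mod_cast h1
  set t := h.e a - h.e b * ha.al
  have hm0 : m ≠ 0 := by rintro rfl; simp at hm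
  have ht : t ≠ 0 := by
    intro ht
    rw [ht] at h1'
    simp at h1'
    rcases h1' with h1' | h1'
    · exact hp.ne_zero h1'
    · exact hm0 h1'
  have key : ∃ P : Ideal (𝓞 K), P.IsPrime ∧ (p : 𝓞 K) ∈ P ∧ t ∈ P := by
    by_contra hcon
    push Not at hcon
    have h2 : Ideal.span {(p : 𝓞 K)} ⊔ Ideal.span {t} = ⊤ := by
      by_contra hne
      obtain ⟨M, hM, hle⟩ := Ideal.exists_le_maximal _ hne
      exact hcon M hM.isPrime (hle (Ideal.mem_sup_left (Ideal.mem_span_singleton_self _)))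
        (hle (Ideal.mem_sup_right (Ideal.mem_span_singleton_self _)))
    -- every prime containing `t` gives a prime divisor other than `p`
    have h3 : ∀ J : Ideal (𝓞 K), J ≠ ⊥ → t ∈ J → ¬ p ∣ Ideal.absNorm J := by
      intro J hJ
      induction J using UniqueFactorizationMonoid.induction_on_prime with
      | h₁ => exact absurd rfl hJ
      | h₂ J hu =>
        intro _
        rw [Ideal.isUnit_iff] at hu
        rw [hu]; simpa using hp.ne_one
      | h₃ J P hJ0 hPp ih =>
        intro htJ hd
        have hP := Ideal.isPrime_of_prime hPp
        rw [map_mul, hp.dvd_mul] at hd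
        rcases hd with hd | hd
        · obtain ⟨q, hq', hd', hmq⟩ := exists_prime hP (n := Ideal.absNorm P) 
            (by rw [Ne, Ideal.absNorm_eq_zero_iff]; exact hPp.ne_zero) (Ideal.absNorm_mem P)
          obtain ⟨k, -, hk⟩ := h.norm_prime hP hq' hmq
          rw [hk] at hd
          have := (Nat.prime_dvd_prime_iff_eq hp hq').1 (hp.dvd_of_dvd_pow hd)
          subst this
          exact hcon P hP hmq (Ideal.mul_le_left htJ)
        · exact ih hJ0 (Ideal.mul_le_right htJ) hd
    refine h3 (Ideal.span {t}) (by simpa using ht) (Ideal.mem_span_singleton_self _) ?_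
    rw [h1']; exact dvd_mul_right _ _
  obtain ⟨P', hP', hpP', htP'⟩ := key
  have hP0 : P' ≠ ⊥ := by rintro rfl; exact ht (by simpa using htP')
  obtain ⟨J, hJ⟩ := Ideal.dvd_iff_le.2 ((Ideal.span_singleton_le_iff_mem P').2 htP')
  have hJ0 : J ≠ ⊥ := by
    rintro rfl
    rw [Ideal.mul_bot, Ideal.span_singleton_eq_bot] at hJ
    exact ht hJ
  obtain ⟨k, hk1, hk⟩ := h.norm_prime hP' hp hpP'
  have h4 : p ^ k * Ideal.absNorm J = p * m := by rw [← hk, ← map_mul, ← hJ, h1']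
  obtain ⟨j, rfl⟩ : ∃ j, k = j + 1 := ⟨k - 1, by omega⟩
  have h5 : p ^ j * Ideal.absNorm J = m := by
    apply Nat.eq_of_mul_eq_mul_left hp.pos
    rw [← h4]; ring
  have hSJ : S σ J := S_of_primes hJ0 (fun q hq' hd => hq q hq' (by rw [← h5]; exact hd.mul_left _))
  have hS' : S σ P' := by
    apply S_cancel h hJ0 _ hSJ
    rw [← hJ]; exact S_span ht
  intro P hP h0 hpP
  obtain ⟨k, rfl⟩ := h.conjugate hP' hP hP0 hp hpP' hpP
  exact S_ic k hS'

lemma Cub.root (ha : Cub σ α) {P : Ideal (𝓞 K)} (hP : P.IsPrime) {p : ℕ} (hp : p.Prime)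
    (hn : Ideal.absNorm P = p) : ∃ n : ℕ, n < p ∧ (n ^ 3 + 21 * (p - n) + 28 * (p - 1)) % p = 0 := by
  have hc : Nat.card (𝓞 K ⧸ P) = p := by
    rw [← hn, Ideal.absNorm_apply]; rfl
  have hpP : (p : 𝓞 K) ∈ P := by rw [← hn]; exact Ideal.absNorm_mem P
  have := Fact.mk hp
  have hz : ((p : ℕ) : 𝓞 K ⧸ P) = 0 := by
    rw [← map_natCast (Ideal.Quotient.mk P), Ideal.Quotient.eq_zero_iff_mem]; exact hpP
  have hch : CharP (𝓞 K ⧸ P) p := by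
    have : Nontrivial (𝓞 K ⧸ P) := Ideal.Quotient.nontrivial_iff.2 hP.ne_top
    exact (CharP.charP_iff_prime_eq_zero hp).2 hz
  have : Finite (𝓞 K ⧸ P) := Nat.finite_of_card_ne_zero (by rw [hc]; exact hp.ne_zero)
  let f := ZMod.castHom (dvd_refl p) (𝓞 K ⧸ P)
  have hf : Function.Bijective f := by
    rw [Nat.bijective_iff_injective_and_card]
    exact ⟨f.injective, by rw [hc, Nat.card_zmod]⟩
  obtain ⟨z, hz1⟩ := hf.2 (Ideal.Quotient.mk P ha.al)
  have heq : ha.al ^ 3 = 21 * ha.al + 28 := by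
    apply RingOfIntegers.ext
    simp only [map_pow, map_add, map_mul, map_ofNat, ha.coe_al, ha.eqn]
  have h2 : z ^ 3 = 21 * z + 28 := by
    apply hf.1
    rw [map_pow, map_add, map_mul, map_ofNat, map_ofNat, hz1, ← map_pow, heq, map_add, map_mul, map_ofNat, map_ofNat]
  refine ⟨z.val, z.val_lt, ?_⟩
  rw [← Nat.dvd_iff_mod_eq_zero, ← CharP.cast_eq_zero_iff (ZMod p) p]
  have := hp.one_le
  push_cast [Nat.cast_sub z.val_lt.le, Nat.cast_sub this]
  simp
  linear_combination h2

/-- primes with a certificate -/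
def LL : List ℕ := [61, 157, 173, 181, 193, 197, 313, 317, 409, 433, 449, 457, 569, 661, 677, 701, 709, 757,
  821, 881, 929, 937, 941, 953, 977, 1009]

/-- the finite check -/
def chk (p : ℕ) : Bool := p ≤ 1 || p % 4 != 1 || (List.range 32).any (fun d => 1 < d && d < p && p % d == 0) ||
  LL.contains p || (List.range p).all (fun n => (n ^ 3 + 21 * (p - n) + 28 * (p - 1)) % p != 0)

lemma table0 : (List.range 1013).all chk = true := by
  decide +kernel

lemma table {p : ℕ} (hp : p.Prime) (hlt : p < 1013) (h4 : p % 4 = 1) (hr : ∃ n : ℕ, n < p ∧ (n ^ 3 + 21 * (p - n) + 28 * (p - 1)) % p = 0) :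
    p ∈ LL := by
  have h1 := (List.all_eq_true.1 table0) p (List.mem_range.2 hlt)
  simp only [chk, Bool.or_eq_true, decide_eq_true_eq, bne_iff_ne, List.any_eq_true, List.all_eq_true, List.mem_range, Bool.and_eq_true, beq_iff_eq, List.contains_iff_mem] at h1
  rcases h1 with (((h1 | h1) | ⟨d, -, h1⟩) | h1) | h1
  · exact absurd h1 (not_le.2 hp.one_lt)
  · exact absurd h4 h1
  · rcases (Nat.dvd_prime hp).1 (Nat.dvd_of_mod_eq_zero h1.2) with h | h <;> omega
  · exact h1
  · obtain ⟨n, hn, hn'⟩ := hr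
    exact absurd hn' (h1 n hn)

end seven
end Shi

namespace Shi
section eight
variable {K : Type*} [Field K] [NumberField K] [IsGalois ℚ K] {σ : K ≃ₐ[ℚ] K} {β α : K}

lemma Setup.SP_ram (h : Setup σ β) {p : ℕ} (hp : p.Prime) (hp' : p = 2 ∨ p % 4 = 3) : SP σ p :=
  fun _ hP h0 hm => h.S_ram hP h0 hp hp' hm

lemma Setup.cert' (h : Setup σ β) (ha : Cub σ α) {p : ℕ} (m : ℕ) (hp : p.Prime) (x y z w : ℤ)
    (hn : Zsqrtd.norm ((⟨x, y⟩ : GaussianInt) ^ 3 - 21 * ⟨x, y⟩ * ⟨z, w⟩ ^ 2 - 28 * ⟨z, w⟩ ^ 3) = ((p * m : ℕ) : ℤ)) (hm : ¬ p ∣ m)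
    (hq : m ∣ 288) : SP σ p := by
  apply h.cert ha hp _ _ hn hm
  intro q hq1 hq2
  have h1 : q ∣ 2 ^ 5 * 3 ^ 2 := hq2.trans hq
  rcases (Nat.Prime.dvd_mul hq1).1 h1 with h2 | h2
  · have := (Nat.prime_dvd_prime_iff_eq hq1 Nat.prime_two).1 (hq1.dvd_of_dvd_pow h2)
    exact h.SP_ram hq1 (Or.inl this)
  · have := (Nat.prime_dvd_prime_iff_eq hq1 Nat.prime_three).1 (hq1.dvd_of_dvd_pow h2)
    exact h.SP_ram hq1 (Or.inr (by rw [this]))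

lemma Setup.SP61 (h : Setup σ β) (ha : Cub σ α) : SP σ 61 :=
  h.cert' ha 4 (by norm_num) (-2) (-1) 1 0 (by decide) (by norm_num) (by norm_num)

lemma Setup.cert61 (h : Setup σ β) (ha : Cub σ α) {p : ℕ} (hp : p.Prime) (x y z w : ℤ)
    (hn : Zsqrtd.norm ((⟨x, y⟩ : GaussianInt) ^ 3 - 21 * ⟨x, y⟩ * ⟨z, w⟩ ^ 2 - 28 * ⟨z, w⟩ ^ 3) = ((p * 61 : ℕ) : ℤ)) (hm : ¬ p ∣ 61) :
    SP σ p := by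
  apply h.cert ha hp _ _ hn hm
  intro q hq1 hq2
  rw [(Nat.prime_dvd_prime_iff_eq hq1 (by norm_num)).1 hq2]
  exact h.SP61 ha

lemma Setup.SP_list (h : Setup σ β) (ha : Cub σ α) {p : ℕ} (hp : p.Prime) (hL : p ∈ LL) : SP σ p := by
  simp only [LL, List.mem_cons, List.not_mem_nil, or_false] at hL
  rcases hL with rfl | rfl | rfl | rfl | rfl | rfl | rfl | rfl | rfl | rfl | rfl | rfl | rfl | rfl | rfl | rfl | rfl | rfl | rfl | rfl | rfl | rfl | rfl | rfl | rfl | rfl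
  · exact h.cert' ha 4 hp (-2) (-1) (1) (0) (by decide) (by norm_num) (by norm_num)
  · exact h.cert' ha 2 hp (-3) (-1) (1) (0) (by decide) (by norm_num) (by norm_num)
  · exact h.cert' ha 4 hp (-4) (-1) (1) (0) (by decide) (by norm_num) (by norm_num)
  · exact h.cert' ha 36 hp (-3) (-2) (0) (1) (by decide) (by norm_num) (by norm_num)
  · exact h.cert' ha 2 hp (-1) (-1) (0) (1) (by decide) (by norm_num) (by norm_num)
  · exact h.cert' ha 8 hp (-2) (-2) (0) (1) (by decide) (by norm_num) (by norm_num)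
  · exact h.cert' ha 4 hp (-3) (-2) (2) (1) (by decide) (by norm_num) (by norm_num)
  · exact h.cert' ha 4 hp (-1) (0) (0) (-1) (by decide) (by norm_num) (by norm_num)
  · exact h.cert61 ha hp (-7) (-2) (2) (0) (by decide) (by norm_num)
  · exact h.cert' ha 1 hp (-2) (-1) (1) (1) (by decide) (by norm_num) (by norm_num)
  · exact h.cert' ha 36 hp (-7) (-2) (2) (1) (by decide) (by norm_num) (by norm_num)
  · exact h.cert' ha 4 hp (-7) (-4) (2) (1) (by decide) (by norm_num) (by norm_num)
  · exact h.cert' ha 32 hp (-4) (0) (2) (-1) (by decide) (by norm_num) (by norm_num)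
  · exact h.cert' ha 2 hp (-3) (-1) (2) (1) (by decide) (by norm_num) (by norm_num)
  · exact h.cert' ha 18 hp (-3) (-1) (0) (-1) (by decide) (by norm_num) (by norm_num)
  · exact h.cert' ha 1 hp (-4) (-3) (1) (1) (by decide) (by norm_num) (by norm_num)
  · exact h.cert' ha 32 hp (-4) (0) (0) (-1) (by decide) (by norm_num) (by norm_num)
  · exact h.cert' ha 36 hp (-3) (-4) (0) (-1) (by decide) (by norm_num) (by norm_num)
  · exact h.cert' ha 4 hp (-2) (0) (0) (-1) (by decide) (by norm_num) (by norm_num)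
  · exact h.cert' ha 36 hp (-2) (-1) (1) (2) (by decide) (by norm_num) (by norm_num)
  · exact h.cert' ha 4 hp (-4) (-2) (1) (0) (by decide) (by norm_num) (by norm_num)
  · exact h.cert' ha 1 hp (-3) (-2) (1) (1) (by decide) (by norm_num) (by norm_num)
  · exact h.cert61 ha hp (-1) (0) (0) (-2) (by decide) (by norm_num)
  · exact h.cert' ha 8 hp (-2) (-2) (1) (2) (by decide) (by norm_num) (by norm_num)
  · exact h.cert' ha 9 hp (-5) (-2) (1) (1) (by decide) (by norm_num) (by norm_num)
  · exact h.cert' ha 8 hp (-2) (-2) (0) (-1) (by decide) (by norm_num) (by norm_num)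

lemma Setup.S_deg1 (h : Setup σ β) (ha : Cub σ α) {P : Ideal (𝓞 K)} (hP : P.IsPrime) (h0 : P ≠ ⊥) {p : ℕ}
    (hp : p.Prime) (h4 : p % 4 = 1) (hlt : p < 1013) (hn : Ideal.absNorm P = p) : S σ P :=
  h.SP_list ha hp (table hp hlt h4 (ha.root hP hp hn)) P hP h0 (by rw [← hn]; exact Ideal.absNorm_mem P)

lemma Setup.SP_one (h : Setup σ β) (ha : Cub σ α) {p : ℕ} (hp : p.Prime) (h4 : p % 4 = 1) (hlt : p < 1013) :
    SP σ p := by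
  intro P hP h0 hpP
  have := Fact.mk hp
  obtain ⟨a, b, hab⟩ := Nat.Prime.sq_add_sq (p := p) (by omega)
  have key : ∃ g : GaussianInt, g.norm = p ∧ h.e g ∈ P := by
    have hN : (⟨a, b⟩ : GaussianInt).norm = p := by
      rw [Zsqrtd.norm_def, ← hab]; push_cast; ring
    have h1 := gnorm ⟨a, b⟩
    rw [hN] at h1
    have h2 : h.e ⟨a, b⟩ * h.e (star ⟨a, b⟩) ∈ P := by
      rw [← map_mul, ← h1]; simpa using hpP
    rcases hP.mem_or_mem h2 with h2 | h2
    · exact ⟨_, hN, h2⟩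
    · exact ⟨_, by rw [Zsqrtd.norm_conj, hN], h2⟩
  obtain ⟨g, hg, hgP⟩ := key
  have hNg : Ideal.absNorm (Ideal.span {h.e g}) = p ^ 3 := by
    have := h.absNorm_e g
    rw [hg] at this
    exact_mod_cast this
  have hg0 : h.e g ≠ 0 := by
    intro h1
    rw [h1] at hNg
    simp at hNg
    exact pow_ne_zero 3 hp.ne_zero hNg.symm
  obtain ⟨J, hJ⟩ := Ideal.dvd_iff_le.2 ((Ideal.span_singleton_le_iff_mem P).2 hgP)
  obtain ⟨k, hk1, hk⟩ := h.norm_prime hP hp hpP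
  have hm : p ^ k * Ideal.absNorm J = p ^ 3 := by rw [← hk, ← map_mul, ← hJ, hNg]
  have hk3 : k ≤ 3 := (Nat.pow_dvd_pow_iff_le_right hp.one_lt).1 ⟨_, hm.symm⟩
  have hJ0 : J ≠ ⊥ := by
    rintro rfl
    rw [Ideal.mul_bot, Ideal.span_singleton_eq_bot] at hJ
    exact hg0 hJ
  interval_cases k
  · exact h.S_deg1 ha hP h0 hp h4 hlt (by rw [hk, pow_one])
  · have hJn : Ideal.absNorm J = p := by
      apply Nat.eq_of_mul_eq_mul_left (pow_pos hp.pos 2)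
      rw [hm]; ring
    have hJp : J.IsPrime := Ideal.isPrime_of_irreducible_absNorm (by rw [hJn]; exact hp)
    exact S_cancel h hJ0 (by rw [← hJ]; exact S_span hg0) (h.S_deg1 ha hJp hJ0 hp h4 hlt hJn)
  · have hJn : Ideal.absNorm J = 1 := by
      apply Nat.eq_of_mul_eq_mul_left (pow_pos hp.pos 3)
      rw [hm]; ring
    rw [Ideal.absNorm_eq_one_iff] at hJn
    rw [hJn, Ideal.mul_top] at hJ
    rw [← hJ]; exact S_span hg0

lemma Setup.S_all (h : Setup σ β) (ha : Cub σ α) {I : Ideal (𝓞 K)} (hI : I ≠ ⊥) : S σ I := by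
  obtain ⟨x, y, J, hx, hy, hJ, hn, he⟩ := h.small ha hI
  have hSJ : S σ J := by
    apply S_of_primes hJ
    intro p hp hd
    have hle : p ≤ 1012 := (Nat.le_of_dvd (Nat.pos_of_ne_zero (by rwa [Ne, Ideal.absNorm_eq_zero_iff])) hd).trans hn
    by_cases h4 : p % 4 = 1
    · exact h.SP_one ha hp h4 (by omega)
    · apply h.SP_ram hp
      rcases hp.eq_two_or_odd with h2 | h2 <;> omega
  apply S_cancel h (J := Ideal.span {x}) (by simpa using hx) _ (S_span hx)
  rw [mul_comm, he]
  exact S_mul (S_span hy) hSJ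
end eight
end Shi

namespace Shi
section nine
variable {K : Type*} [Field K] [NumberField K] [IsGalois ℚ K] {σ : K ≃ₐ[ℚ] K} {β α : K}

/-- primary Gaussian integers -/
def Prim (g : GaussianInt) : Prop := g.im % 2 = 0 ∧ (g.re + g.im) % 4 = 1

/-- the four units -/
def Mu (v : GaussianInt) : Prop := v = ⟨1, 0⟩ ∨ v = ⟨-1, 0⟩ ∨ v = ⟨0, 1⟩ ∨ v = ⟨0, -1⟩

lemma Mu.star {v : GaussianInt} (hv : Mu v) : Mu (star v) := by
  rcases hv with rfl | rfl | rfl | rfl <;> simp [Mu, Zsqrtd.ext_iff]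

lemma Mu.mul_star {v : GaussianInt} (hv : Mu v) : v * Star.star v = 1 := by
  rcases hv with rfl | rfl | rfl | rfl <;> decide

lemma Mu.star_cube {v : GaussianInt} (hv : Mu v) : (Star.star v) ^ 3 = v := by
  rcases hv with rfl | rfl | rfl | rfl <;> decide

lemma Mu.cube {v : GaussianInt} (hv : Mu v) (h : v ^ 3 = 1) : v = 1 := by
  rcases hv with rfl | rfl | rfl | rfl <;> first | rfl | (exact absurd h (by decide))

lemma Prim.mul {g g' : GaussianInt} (hg : Prim g) (hg' : Prim g') : Prim (g * g') := by
  obtain ⟨h1, h2⟩ := hg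
  obtain ⟨h3, h4⟩ := hg'
  obtain ⟨a, ha⟩ : ∃ a, g.im = 2 * a := ⟨g.im / 2, by omega⟩
  obtain ⟨c, hc⟩ : ∃ c, g'.im = 2 * c := ⟨g'.im / 2, by omega⟩
  obtain ⟨b, hb⟩ : ∃ b, g.re = 4 * b + 1 - 2 * a := ⟨(g.re + g.im) / 4, by omega⟩
  obtain ⟨d, hd⟩ : ∃ d, g'.re = 4 * d + 1 - 2 * c := ⟨(g'.re + g'.im) / 4, by omega⟩
  constructor
  · rw [Zsqrtd.im_mul, ha, hb, hc, hd]
    ring_nf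
    omega
  · rw [Zsqrtd.im_mul, Zsqrtd.re_mul, ha, hb, hc, hd]
    ring_nf
    omega

lemma Prim.star {g : GaussianInt} (hg : Prim g) : Prim (star g) := by
  obtain ⟨h1, h2⟩ := hg
  constructor
  · rw [Zsqrtd.im_star]; omega
  · rw [Zsqrtd.im_star, Zsqrtd.re_star]; omega

lemma Prim.unit {g v : GaussianInt} (hg : Prim g) (hv : Mu v) (h : Prim (v * g)) : v = 1 := by
  obtain ⟨h1, h2⟩ := hg
  obtain ⟨h3, h4⟩ := h
  rw [Zsqrtd.im_mul] at h3 h4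
  rw [Zsqrtd.re_mul] at h4
  rcases hv with rfl | rfl | rfl | rfl
  · rfl
  all_goals exfalso; simp only at h3 h4; omega

lemma exists_prim {g : GaussianInt} (hg : g.norm % 2 = 1) : ∃ v, Mu v ∧ Prim (v * g) := by
  have hpar : (g.re + g.im) % 2 = 1 := by
    rw [Zsqrtd.norm_def] at hg
    rcases Int.even_or_odd' g.re with ⟨a, ha | ha⟩ <;> rcases Int.even_or_odd' g.im with ⟨b, hb | hb⟩ <;>
      rw [ha, hb] at hg ⊢ <;> ring_nf at hg <;> omega
  have key : Prim (⟨1, 0⟩ * g) ∨ Prim (⟨-1, 0⟩ * g) ∨ Prim (⟨0, 1⟩ * g) ∨ Prim (⟨0, -1⟩ * g) := by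
    simp only [Prim, Zsqrtd.im_mul, Zsqrtd.re_mul]
    omega
  rcases key with k | k | k | k
  · exact ⟨_, Or.inl rfl, k⟩
  · exact ⟨_, Or.inr (Or.inl rfl), k⟩
  · exact ⟨_, Or.inr (Or.inr (Or.inl rfl)), k⟩
  · exact ⟨_, Or.inr (Or.inr (Or.inr rfl)), k⟩

lemma oext {u v : 𝓞 K} (h : (u : K) = (v : K)) : u = v := RingOfIntegers.ext h

lemma cmul (u v : 𝓞 K) : ((u * v : 𝓞 K) : K) = (u : K) * (v : K) := rfl
lemma cone : ((1 : 𝓞 K) : K) = 1 := rfl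
lemma cpow (u : 𝓞 K) (n : ℕ) : ((u ^ n : 𝓞 K) : K) = (u : K) ^ n := map_pow (algebraMap (𝓞 K) K) u n

lemma ss_of {x : K} {a b : 𝓞 K} {A : Ideal (𝓞 K)} (hb : b ≠ 0) (hx : (b : K) * x = a)
    (h : Ideal.span {a} = Ideal.span {b} * A) :
    FractionalIdeal.spanSingleton (nonZeroDivisors (𝓞 K)) x = (A : FractionalIdeal (nonZeroDivisors (𝓞 K)) K) := by
  have hb' : FractionalIdeal.spanSingleton (nonZeroDivisors (𝓞 K)) (b : K) ≠ 0 := by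
    rw [Ne, FractionalIdeal.spanSingleton_eq_zero_iff]; simpa using hb
  apply mul_left_cancel₀ hb'
  rw [FractionalIdeal.spanSingleton_mul_spanSingleton, hx, ← FractionalIdeal.coeIdeal_span_singleton, h,
    FractionalIdeal.coeIdeal_mul, FractionalIdeal.coeIdeal_span_singleton]

lemma of_ss {x : K} {A : Ideal (𝓞 K)}
    (h : FractionalIdeal.spanSingleton (nonZeroDivisors (𝓞 K)) x = (A : FractionalIdeal (nonZeroDivisors (𝓞 K)) K)) :
    ∃ a b : 𝓞 K, b ≠ 0 ∧ (b : K) * x = a ∧ Ideal.span {a} = Ideal.span {b} * A := by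
  obtain ⟨a, b, hb, hab⟩ := IsFractionRing.div_surjective (A := 𝓞 K) x
  have hb0 : b ≠ 0 := nonZeroDivisors.ne_zero hb
  have hx : (b : K) * x = a := by
    rw [← hab]; exact mul_div_cancel₀ _ (by simpa using hb0)
  refine ⟨a, b, hb0, hx, ?_⟩
  apply FractionalIdeal.coeIdeal_injective (K := K)
  beta_reduce
  rw [FractionalIdeal.coeIdeal_mul, ← h, FractionalIdeal.coeIdeal_span_singleton,
    FractionalIdeal.coeIdeal_span_singleton, FractionalIdeal.spanSingleton_mul_spanSingleton, hx]

lemma Setup.e_inj (h : Setup σ β) : Function.Injective h.e := by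
  rw [injective_iff_map_eq_zero]
  intro g hg
  have h1 : h.e (g * Star.star g) = 0 := by rw [map_mul, hg, zero_mul]
  rw [← gnorm, map_intCast] at h1
  exact GaussianInt.norm_eq_zero.1 (by exact_mod_cast h1)

lemma Setup.unit_e (h : Setup σ β) {u : 𝓞 K} (hu : u * gr (σ ^ 3) u = 1) : ∃ v, Mu v ∧ u = h.e v := by
  have h1 : (u : K) * (σ ^ 3) (u : K) = 1 := by
    rw [← coe_gr, ← map_mul, hu, map_one]
  rcases h.units (RingOfIntegers.isIntegral_coe u) h1 with h2 | h2 | h2 | h2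
  · exact ⟨_, Or.inl rfl, oext (Eq.trans h2 (by rw [h.coe_e]; simp))⟩
  · exact ⟨_, Or.inr (Or.inl rfl), oext (Eq.trans h2 (by rw [h.coe_e]; simp))⟩
  · exact ⟨_, Or.inr (Or.inr (Or.inl rfl)), oext (Eq.trans h2 (by rw [h.coe_e]; simp))⟩
  · exact ⟨_, Or.inr (Or.inr (Or.inr rfl)), oext (Eq.trans h2 (by rw [h.coe_e]; simp))⟩

lemma Setup.uniq_g (h : Setup σ β) {g1 g2 : GaussianInt} (h0 : g1 ≠ 0)
    (he : Ideal.span {h.e g1} = Ideal.span {h.e g2}) : ∃ v, Mu v ∧ g2 = v * g1 := by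
  have hN : g1.norm = g2.norm := by
    have h1 := h.absNorm_e g1
    rw [he, h.absNorm_e g2] at h1
    exact ((Odd.strictMono_pow (n := 3) (by decide)).injective h1).symm
  obtain ⟨u, hu⟩ := Ideal.span_singleton_eq_span_singleton.1 he
  have h1 : (u : 𝓞 K) * gr (σ ^ 3) u = 1 := by
    have h2 := congrArg (fun z => z * gr (σ ^ 3) z) hu
    simp only [map_mul] at h2
    rw [h.e_gr' g1 1, h.e_gr' g2 1] at h2
    have h3 : h.e (g1 * Star.star g1) * ((u : 𝓞 K) * gr (σ ^ 3) u) = h.e (g2 * Star.star g2) := by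
      rw [map_mul, map_mul, ← h2]; ring
    rw [← gnorm, ← gnorm, ← hN] at h3
    have h4 : h.e (g1.norm : GaussianInt) ≠ 0 := by
      rw [map_intCast]
      have := (GaussianInt.norm_eq_zero (x := g1)).not.2 h0
      exact_mod_cast this
    exact mul_left_cancel₀ h4 (h3.trans (mul_one _).symm)
  obtain ⟨v, hv, hv'⟩ := h.unit_e h1
  refine ⟨v, hv, h.e_inj ?_⟩
  rw [map_mul, ← hv', ← hu, mul_comm]

lemma Setup.prim_uniq (h : Setup σ β) {g1 g2 : GaussianInt} (h0 : g1 ≠ 0) (hp1 : Prim g1) (hp2 : Prim g2)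
    (he : Ideal.span {h.e g1} = Ideal.span {h.e g2}) : g2 = g1 := by
  obtain ⟨v, hv, hg⟩ := h.uniq_g h0 he
  rw [hg] at hp2
  rw [hg, hp1.unit hv hp2, one_mul]

/-- the defining property of the value of the character -/
structure Good (h : Setup σ β) (I : Ideal (𝓞 K)) (x : K) (g : GaussianInt) : Prop where
  prim : Prim g
  gen : rnI σ I = Ideal.span {h.e g}
  rel : x * (σ ^ 2) x * (σ ^ 4) x = (h.e (g ^ 2 * Star.star g) : 𝓞 K)
  norm : x * (σ ^ 3) x = (Ideal.absNorm I : K)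
  ideal : FractionalIdeal.spanSingleton (nonZeroDivisors (𝓞 K)) x
      = ((I * idealConj (σ ^ 4) I * idealConj (σ ^ 5) I : Ideal (𝓞 K)) :
          FractionalIdeal (nonZeroDivisors (𝓞 K)) K)

lemma Good.ne_zero {h : Setup σ β} {I : Ideal (𝓞 K)} {x : K} {g : GaussianInt} (hG : Good h I x g)
    (hI : I ≠ ⊥) : x ≠ 0 := by
  rintro rfl
  have := hG.norm
  rw [zero_mul] at this
  have h2 : Ideal.absNorm I ≠ 0 := by rwa [Ne, Ideal.absNorm_eq_zero_iff]
  exact h2 (by exact_mod_cast this.symm)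

lemma Setup.g_ne (h : Setup σ β) {I : Ideal (𝓞 K)} {g : GaussianInt} (hg : rnI σ I = Ideal.span {h.e g})
    (hI : I ≠ ⊥) : g ≠ 0 := by
  rintro rfl
  have := h.gen_norm hg
  have h2 : Ideal.absNorm I ≠ 0 := by rwa [Ne, Ideal.absNorm_eq_zero_iff]
  apply h2
  rw [Zsqrtd.norm_zero] at this
  exact_mod_cast this

lemma Good.uniq {h : Setup σ β} {I : Ideal (𝓞 K)} {x y : K} {g g' : GaussianInt} (hx : Good h I x g)
    (hy : Good h I y g') (hI : I ≠ ⊥) : x = y := by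
  have hg := h.prim_uniq (h.g_ne hx.gen hI) hx.prim hy.prim (hx.gen.symm.trans hy.gen)
  subst hg
  have hmem : x ∈ FractionalIdeal.spanSingleton (nonZeroDivisors (𝓞 K)) y := by
    rw [hy.ideal, ← hx.ideal]; exact FractionalIdeal.mem_spanSingleton_self _ _
  obtain ⟨a, ha⟩ := (FractionalIdeal.mem_spanSingleton _).1 hmem
  have ha' : x = (a : K) * y := by rw [← ha, Algebra.smul_def]
  have hy0 := hy.ne_zero hI
  have h1 : a * gr (σ ^ 3) a = 1 := by
    apply oext
    rw [cmul, coe_gr, cone]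
    have h2 := hx.norm
    rw [← hy.norm, ha', map_mul] at h2
    have h3 : y * (σ ^ 3) y ≠ 0 := mul_ne_zero hy0 (by simpa using hy0)
    apply mul_right_cancel₀ h3
    linear_combination h2
  obtain ⟨v, hv, rfl⟩ := h.unit_e h1
  have h2 := hx.rel
  rw [← hy.rel, ha'] at h2
  simp only [map_mul] at h2
  have e2 : (σ ^ 2) ((h.e v : 𝓞 K) : K) = (h.e v : 𝓞 K) := by rw [← coe_gr, h.e_gr v 1]
  have e4 : (σ ^ 4) ((h.e v : 𝓞 K) : K) = (h.e v : 𝓞 K) := by rw [← coe_gr, h.e_gr v 2]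
  rw [e2, e4] at h2
  have h3 : y * (σ ^ 2) y * (σ ^ 4) y ≠ 0 :=
    mul_ne_zero (mul_ne_zero hy0 (by simpa using hy0)) (by simpa using hy0)
  have h4 : ((h.e v : 𝓞 K) : K) ^ 3 = 1 := by
    apply mul_right_cancel₀ h3
    linear_combination h2
  have h5 : v ^ 3 = 1 := by
    apply h.e_inj
    apply oext
    rw [map_pow, cpow, h4, map_one, cone]
  rw [hv.cube h5] at ha'
  simpa using ha'

lemma Good.mul {h : Setup σ β} {I J : Ideal (𝓞 K)} {x y : K} {g g' : GaussianInt} (hx : Good h I x g)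
    (hy : Good h J y g') : Good h (I * J) (x * y) (g * g') where
  prim := hx.prim.mul hy.prim
  gen := by rw [rnI_mul, hx.gen, hy.gen, Ideal.span_singleton_mul_span_singleton, map_mul]
  rel := by
    have : (g * g') ^ 2 * Star.star (g * g') = (g ^ 2 * Star.star g) * (g' ^ 2 * Star.star g') := by
      rw [star_mul]; ring
    rw [this, map_mul h.e]
    refine Eq.trans ?_ (map_mul (algebraMap (𝓞 K) K) _ _).symm
    refine Eq.trans ?_ (congrArg₂ (· * ·) hx.rel hy.rel)
    simp only [map_mul]; ring
  norm := by
    rw [map_mul Ideal.absNorm, Nat.cast_mul, ← hx.norm, ← hy.norm, map_mul]; ring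
  ideal := by
    rw [← FractionalIdeal.spanSingleton_mul_spanSingleton, hx.ideal, hy.ideal, ← FractionalIdeal.coeIdeal_mul]
    congr 1
    simp only [ic_mul]; ring

lemma Good.conj {h : Setup σ β} {I : Ideal (𝓞 K)} {x : K} {g : GaussianInt} (hx : Good h I x g) :
    Good h (idealConj σ I) (σ x) (Star.star g) where
  prim := hx.prim.star
  gen := by
    have := ic_rnI (σ := σ) 1 I
    rw [pow_one] at this
    rw [← this, hx.gen, ic_span]
    have h2 := h.e_gr' g 0
    rw [mul_zero, zero_add, pow_one] at h2
    rw [h2]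
  rel := by
    have h2 := h.e_gr' (g ^ 2 * Star.star g) 0
    rw [mul_zero, zero_add, pow_one] at h2
    have : (Star.star g) ^ 2 * Star.star (Star.star g) = Star.star (g ^ 2 * Star.star g) := by
      rw [star_mul, star_pow, mul_comm]
    rw [this, ← h2, coe_gr, ← hx.rel]
    simp only [map_mul, ← AlgEquiv.mul_apply, ← pow_succ, ← pow_succ']
  norm := by
    rw [ic_absNorm]
    have := congrArg σ hx.norm
    rw [map_natCast, map_mul] at this
    rw [← this]
    simp only [← AlgEquiv.mul_apply, ← pow_succ, ← pow_succ']
  ideal := by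
    obtain ⟨a, b, hb, hx', hs⟩ := of_ss hx.ideal
    refine ss_of (a := gr σ a) (b := gr σ b) (gr_ne hb) ?_ ?_
    · rw [coe_gr, coe_gr, ← map_mul, hx']
    · have := congrArg (idealConj σ) hs
      simp only [ic_mul, ic_span, ← ic_comp, ← pow_succ'] at this
      simp only [← ic_comp, ← pow_succ, this]
end nine
end Shi

namespace Shi
section ten
variable {K : Type*} [Field K] [NumberField K] [IsGalois ℚ K] {σ : K ≃ₐ[ℚ] K} {β α : K}

lemma Setup.rn_one_mod (h : Setup σ β) {s : 𝓞 K} (hs : s - 1 ∈ Ideal.span {(4 : 𝓞 K)}) :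
    ∃ c : GaussianInt, rn σ s = h.e (1 + 4 * c) := by
  obtain ⟨a, ha⟩ := Ideal.mem_span_singleton.1 hs
  have hs' : s = 1 + 4 * a := by linear_combination ha
  obtain ⟨g, hg⟩ := h.rn_fixed s
  obtain ⟨c', hc'⟩ : ∃ c', rn σ s = 1 + 4 * c' := by
    rw [rn, hs']
    simp only [map_add, map_mul, map_one, map_ofNat]
    exact ⟨a + gr (σ ^ 2) a + gr (σ ^ 4) a + 4 * (a * gr (σ ^ 2) a + a * gr (σ ^ 4) a +
      gr (σ ^ 2) a * gr (σ ^ 4) a) + 16 * (a * gr (σ ^ 2) a * gr (σ ^ 4) a), by ring⟩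
  have h1 : gr (σ ^ 2) c' = c' := by
    have h2 := h.e_gr g 1
    rw [mul_one, ← hg, hc', map_add, map_one, map_mul, map_ofNat] at h2
    have h3 : (4 : 𝓞 K) ≠ 0 := by norm_num
    exact mul_left_cancel₀ h3 (add_left_cancel h2)
  obtain ⟨c, hc⟩ := h.fixed2 (x := (c' : K)) (RingOfIntegers.isIntegral_coe _) (by rw [← coe_gr, h1])
  refine ⟨c, ?_⟩
  rw [hc', map_add, map_one, map_mul, map_ofNat, oext hc]

lemma prim_one_mod (c : GaussianInt) : Prim (1 + 4 * c) := by
  have h1 : (1 + 4 * c).re = 1 + 4 * c.re := by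
    simp [Zsqrtd.re_mul]
  have h2 : (1 + 4 * c).im = 4 * c.im := by
    simp [Zsqrtd.im_mul]
  constructor
  · rw [h2]; omega
  · rw [h1, h2]; omega

lemma Prim.norm_mod {g : GaussianInt} (hg : Prim g) : g.norm % 2 = 1 := by
  obtain ⟨h1, h2⟩ := hg
  obtain ⟨a, ha⟩ : ∃ a, g.im = 2 * a := ⟨g.im / 2, by omega⟩
  obtain ⟨b, hb⟩ : ∃ b, g.re = 2 * b + 1 := ⟨g.re / 2, by omega⟩
  rw [Zsqrtd.norm_def, ha, hb]
  ring_nf; omega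

lemma norm_mod4 {g : GaussianInt} (hg : g.norm % 2 = 1) : g.norm % 4 = 1 := by
  rw [Zsqrtd.norm_def] at hg ⊢
  rcases Int.even_or_odd' g.re with ⟨a, ha | ha⟩ <;> rcases Int.even_or_odd' g.im with ⟨b, hb | hb⟩ <;>
      rw [ha, hb] at hg ⊢ <;> ring_nf at hg ⊢ <;> omega

lemma Setup.odd (h : Setup σ β) {I : Ideal (𝓞 K)} (hc : IsCoprime I (Ideal.span {(4 : 𝓞 K)})) {g : GaussianInt}
    (hg : rnI σ I = Ideal.span {h.e g}) : g.norm % 2 = 1 := by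
  obtain ⟨a, ha, b, hb, hab⟩ := Ideal.isCoprime_iff_exists.1 hc
  obtain ⟨c, hc⟩ := h.rn_one_mod (s := a) (by
    have : a - 1 = - b := by linear_combination hab
    rw [this]; exact neg_mem hb)
  have hm : rn σ a ∈ rnI σ I :=
    Ideal.mul_mem_mul (Ideal.mul_mem_mul ha ((mem_ic _ _ _).2 ha)) ((mem_ic _ _ _).2 ha)
  rw [hg, hc] at hm
  have h1 := Ideal.absNorm_dvd_absNorm_of_le ((Ideal.span_singleton_le_iff_mem _).2 hm)
  have h2 : g.norm ^ 3 ∣ (1 + 4 * c).norm ^ 3 := by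
    rw [← h.absNorm_e, ← h.absNorm_e]; exact_mod_cast h1
  have h3 := (prim_one_mod c).norm_mod
  have h4 : Odd ((1 + 4 * c).norm ^ 3) := (Int.odd_iff.2 h3).pow
  have h5 : g.norm ∣ (1 + 4 * c).norm ^ 3 := (dvd_pow_self _ (by norm_num)).trans h2
  obtain ⟨q, hq⟩ := h5
  rw [hq] at h4
  exact Int.odd_iff.1 (Int.Odd.of_mul_right (Int.mul_comm _ _ ▸ h4))

lemma Setup.gr_gr (h : Setup σ β) (i j : ℕ) (x : 𝓞 K) : gr (σ ^ i) (gr (σ ^ j) x) = gr (σ ^ ((i + j) % 6)) x := by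
  rw [← gr_mul, ← pow_add, ← h.ord, pow_mod_orderOf]

lemma Setup.ic_ic (h : Setup σ β) (i j : ℕ) (I : Ideal (𝓞 K)) :
    idealConj (σ ^ i) (idealConj (σ ^ j) I) = idealConj (σ ^ ((i + j) % 6)) I := by
  rw [← ic_comp, ← pow_add, ← h.ord, pow_mod_orderOf]

lemma Setup.exists_good (h : Setup σ β) (hα : Cub σ α) {I : Ideal (𝓞 K)} (hI : I ≠ ⊥)
    (hc : IsCoprime I (Ideal.span {(4 : 𝓞 K)})) : ∃ x g, Good h I x g := by
  obtain ⟨g0, hg0⟩ := h.relgen hI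
  obtain ⟨v0, hv0, hp⟩ := exists_prim (h.odd hc hg0)
  set g := v0 * g0 with hgdef
  have hg : rnI σ I = Ideal.span {h.e g} := by
    rw [hg0, hgdef, Ideal.span_singleton_eq_span_singleton, map_mul]
    have hu : IsUnit (h.e v0) := (IsUnit.of_mul_eq_one _ hv0.mul_star).map h.e
    exact (associated_isUnit_mul_left_iff hu).2 (Associated.refl _) |>.symm
  have hgn : g ≠ 0 := h.g_ne hg hI
  obtain ⟨t, ht, hS⟩ := h.S_all hα hI
  obtain ⟨r, hr⟩ := h.rn_fixed t
  have hr' : rn σ (gr (σ ^ 3) t) = h.e (star r) := by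
    rw [← h.e_gr' r 1, ← hr]
    simp only [rn, map_mul, h.gr_gr]
  have hrn : r ≠ 0 := by
    rintro rfl
    rw [map_zero, rn] at hr
    exact mul_ne_zero (mul_ne_zero ht (gr_ne ht)) (gr_ne ht) hr
  have hspan : Ideal.span {h.e (star r * g)} = Ideal.span {h.e (r * star g)} := by
    have h1 := congrArg (rnI σ) hS
    rw [rnI_mul, rnI_mul, rnI_span, rnI_span, ← ic_rnI, hg, ic_span, hr, hr', h.e_gr' g 1,
      Ideal.span_singleton_mul_span_singleton, Ideal.span_singleton_mul_span_singleton, ← map_mul, ← map_mul] at h1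
    exact h1.symm
  obtain ⟨v, hv, hvr⟩ := h.uniq_g (mul_ne_zero (star_ne_zero.2 hrn) hgn) hspan
  have hI0 : Ideal.span {gr (σ ^ 2) t} * idealConj (σ ^ 5) I = Ideal.span {gr (σ ^ 5) t} * idealConj (σ ^ 2) I := by
    have h1 := congrArg (idealConj (σ ^ 2)) hS
    simpa only [ic_mul, ic_span, h.gr_gr, h.ic_ic] using h1
  have t2 : gr (σ ^ 2) t ≠ 0 := gr_ne ht
  have t2' : ((gr (σ ^ 2) t : 𝓞 K) : K) ≠ 0 := fun hh => t2 (oext hh)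
  set A : 𝓞 K := h.e (star v * g) * gr (σ ^ 5) t with hA
  obtain ⟨x, hx⟩ : ∃ x : K, ((gr (σ ^ 2) t : 𝓞 K) : K) * x = A := ⟨A / (gr (σ ^ 2) t : 𝓞 K), mul_div_cancel₀ _ t2'⟩
  refine ⟨x, g, hp, hg, ?_, ?_, ?_⟩
  · have hrA : rn σ A = h.e (r * (g ^ 2 * star g)) := by
      have h5 : rn σ (gr (σ ^ 5) t) = h.e (star r) := by
        rw [← h.e_gr' r 2, ← hr]
        simp only [rn, map_mul, h.gr_gr]
      have h6 : rn σ A = rn σ (h.e (star v * g)) * rn σ (gr (σ ^ 5) t) := by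
        rw [hA]; simp only [rn, map_mul]; ring
      rw [h6, h5, h.rn_e, ← map_mul, mul_pow, hv.star_cube]
      congr 1
      linear_combination (-g ^ 2) * hvr
    have hrt : rn σ (gr (σ ^ 2) t) = h.e r := by
      rw [← h.e_gr r 1, ← hr]
      simp only [rn, map_mul, h.gr_gr]
    have h7 : ((rn σ (gr (σ ^ 2) t) : 𝓞 K) : K) * (x * (σ ^ 2) x * (σ ^ 4) x) = (rn σ A : 𝓞 K) := by
      simp only [rn, cmul]
      rw [coe_gr (σ ^ 2) A, coe_gr (σ ^ 4) A, ← hx, map_mul, map_mul, coe_gr (σ ^ 2) (gr _ _), coe_gr (σ ^ 4) (gr _ _)]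
      ring
    rw [hrA, map_mul h.e, cmul, hrt] at h7
    refine mul_left_cancel₀ (fun hh => hrn (h.e_inj (oext ?_))) h7
    rw [hh, map_zero]; rfl
  · have h7 : ((gr (σ ^ 2) t : 𝓞 K) : K) * (gr (σ ^ 5) t : 𝓞 K) * (x * (σ ^ 3) x) = (A * gr (σ ^ 3) A : 𝓞 K) := by
      have h8 := h.gr_gr 3 2 t
      norm_num at h8
      rw [cmul, coe_gr (σ ^ 3) A, ← hx, map_mul, ← coe_gr (σ ^ 3) (gr (σ ^ 2) t), h8]
      ring
    have h9 : A * gr (σ ^ 3) A = gr (σ ^ 2) t * gr (σ ^ 5) t * (Ideal.absNorm I : 𝓞 K) := by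
      have h8 := h.gr_gr 3 5 t
      norm_num at h8
      have h10 : ((Ideal.absNorm I : ℕ) : 𝓞 K) = h.e (g * star g) := by
        rw [← gnorm, ← h.gen_norm hg, map_intCast, Int.cast_natCast]
      rw [hA, map_mul (gr (σ ^ 3)), h.e_gr' _ 1, h8, h10]
      have h11 : (star v * g) * star (star v * g) = g * star g := by
        rw [star_mul, star_star]
        linear_combination (g * star g) * hv.mul_star
      rw [← h11, map_mul h.e (star v * g)]; ring
    rw [h9, cmul, cmul] at h7
    have t5' : ((gr (σ ^ 5) t : 𝓞 K) : K) ≠ 0 := fun hh => (gr_ne ht : gr (σ ^ 5) t ≠ 0) (oext hh)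
    exact (mul_left_cancel₀ (mul_ne_zero t2' t5') h7).trans (map_natCast (algebraMap (𝓞 K) K) _)
  · refine ss_of t2 hx ?_
    have hu : IsUnit (h.e (star v)) := (IsUnit.of_mul_eq_one _ hv.star.mul_star).map h.e
    rw [hA, ← Ideal.span_singleton_mul_span_singleton, map_mul, Ideal.span_singleton_mul_left_unit hu, ← hg, rnI]
    calc _ = (Ideal.span {gr (σ ^ 5) t} * idealConj (σ ^ 2) I) * (I * idealConj (σ ^ 4) I) := by ring
      _ = _ := by rw [← hI0]; ring
end ten
end Shi

namespace Shi
section eleven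
variable {K : Type*} [Field K] [NumberField K] [IsGalois ℚ K] {σ : K ≃ₐ[ℚ] K} {β α : K}

lemma ic_coprime (τ : K ≃ₐ[ℚ] K) {I : Ideal (𝓞 K)} (hc : IsCoprime I (Ideal.span {(4 : 𝓞 K)})) :
    IsCoprime (idealConj τ I) (Ideal.span {(4 : 𝓞 K)}) := by
  rw [Ideal.isCoprime_iff_sup_eq] at hc ⊢
  have h2 := congrArg (idealConj τ) hc
  rw [ic_top, ic_def, Ideal.map_sup, ← ic_def, ← ic_def, ic_span, map_ofNat] at h2
  exact h2

lemma ss_int {a : 𝓞 K} {A : Ideal (𝓞 K)} (h : Ideal.span {a} = A) :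
    FractionalIdeal.spanSingleton (nonZeroDivisors (𝓞 K)) (a : K) = (A : FractionalIdeal (nonZeroDivisors (𝓞 K)) K) := by
  rw [← h, FractionalIdeal.coeIdeal_span_singleton]

lemma mul_coprime {I J : Ideal (𝓞 K)} (hI : IsCoprime I (Ideal.span {(4 : 𝓞 K)}))
    (hJ : IsCoprime J (Ideal.span {(4 : 𝓞 K)})) : IsCoprime (I * J) (Ideal.span {(4 : 𝓞 K)}) := hI.mul_left hJ

lemma Setup.good_span (h : Setup σ β) {s : 𝓞 K} (hs : s - 1 ∈ Ideal.span {(4 : 𝓞 K)}) :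
    Ideal.span {s} ≠ ⊥ ∧ ∃ g, Good h (Ideal.span {s}) ((s : K) * (σ ^ 4) (s : K) * (σ ^ 5) (s : K)) g := by
  obtain ⟨c, hc⟩ := h.rn_one_mod hs
  set g := 1 + 4 * c with hg
  have hp : Prim g := prim_one_mod c
  have hX : (s : K) * (σ ^ 4) (s : K) * (σ ^ 5) (s : K) = (s * gr (σ ^ 4) s * gr (σ ^ 5) s : 𝓞 K) := by
    rw [cmul, cmul, coe_gr, coe_gr]
  constructor
  · rw [Ne, Ideal.span_singleton_eq_bot]
    rintro rfl
    have h1 := hp.norm_mod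
    rw [← h.absNorm_rn hc] at h1
    simp at h1
  · rw [hX]
    refine ⟨g, hp, by rw [rnI_span, hc], ?_, ?_, ?_⟩
    · rw [← coe_gr, ← coe_gr, ← cmul, ← cmul]
      congr 1
      have h5 := h.e_gr' g 2
      rw [← hc] at h5
      rw [map_mul h.e, map_pow h.e, ← h5, ← hc]
      simp only [rn, map_mul, h.gr_gr]
      norm_num
      simp only [gr_one]
      ring
    · rw [h.absNorm_eq, ← coe_gr, ← coe_gr, ← cmul, ← cmul]
      congr 1
      simp only [rn, map_mul, h.gr_gr]
      norm_num
      ring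
    · refine ss_int ?_
      simp only [ic_span, Ideal.span_singleton_mul_span_singleton]

lemma Setup.amb_good (h : Setup σ β) {I : Ideal (𝓞 K)} (hI : I ≠ ⊥) (ham : idealConj (σ ^ 3) I = I)
    {x : K} {g : GaussianInt} (hx : Good h I x g) :
    x = (g.re : K) ∧ (Ideal.absNorm I : ℤ) = g.re ^ 2 ∧ g.re % 4 = 1 := by
  have hst : star g = g := by
    apply h.prim_uniq (h.g_ne hx.gen hI) hx.prim hx.prim.star
    rw [← h.e_gr' g 1, ← ic_span, ← hx.gen, ic_rnI]
    exact congrArg (rnI σ) ham.symm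
  have him : g.im = 0 := by
    have := congrArg Zsqrtd.im hst
    rw [Zsqrtd.im_star] at this; omega
  have hN := h.gen_norm hx.gen
  have hgood : Good h I ((h.e g : 𝓞 K) : K) g := by
    refine ⟨hx.prim, hx.gen, ?_, ?_, ?_⟩
    · rw [← coe_gr, ← coe_gr, h.e_gr g 1, h.e_gr g 2, hst, ← cmul, ← cmul, ← map_mul, ← map_mul]
      congr 2; ring
    · rw [← coe_gr, h.e_gr' g 1, ← cmul, ← map_mul, ← gnorm, map_intCast, ← hN, Int.cast_natCast]
      exact map_natCast (algebraMap (𝓞 K) K) _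
    · refine ss_int ?_
      rw [← hx.gen, rnI]
      have h1 : idealConj (σ ^ 5) I = idealConj (σ ^ 2) I := by
        have := h.ic_ic 2 3 I
        norm_num at this
        rw [← this, ham]
      rw [h1]; ring
  refine ⟨?_, ?_, ?_⟩
  · rw [hx.uniq hgood hI, h.coe_e, him]; simp
  · rw [hN, Zsqrtd.norm_def, him]; ring
  · have := hx.prim.2
    rwa [him, add_zero] at this


lemma coe_F (y : 𝓞 (cubicFixedField σ)) :
    ((algebraMap (𝓞 (cubicFixedField σ)) (𝓞 K) y : 𝓞 K) : K) = ((y : cubicFixedField σ) : K) := rfl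

lemma gr_F (y : 𝓞 (cubicFixedField σ)) :
    gr (σ ^ 3) (algebraMap (𝓞 (cubicFixedField σ)) (𝓞 K) y) = algebraMap (𝓞 (cubicFixedField σ)) (𝓞 K) y := by
  apply oext
  rw [coe_gr, coe_F]
  exact (y : cubicFixedField σ).2 ⟨σ ^ 3, Subgroup.mem_zpowers _⟩

lemma amb_F (p : Ideal (𝓞 (cubicFixedField σ))) :
    idealConj (σ ^ 3) (Ideal.map (algebraMap (𝓞 (cubicFixedField σ)) (𝓞 K)) p) =
      Ideal.map (algebraMap (𝓞 (cubicFixedField σ)) (𝓞 K)) p := by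
  have h1 : ((gr (σ ^ 3) : 𝓞 K ≃ₐ[ℤ] 𝓞 K) : 𝓞 K →+* 𝓞 K).comp (algebraMap (𝓞 (cubicFixedField σ)) (𝓞 K)) =
    algebraMap (𝓞 (cubicFixedField σ)) (𝓞 K) := RingHom.ext gr_F
  conv_rhs => rw [← h1, ← Ideal.map_map]
  rfl

lemma Setup.absNorm_F (h : Setup σ β) (p : Ideal (𝓞 (cubicFixedField σ))) :
    Ideal.absNorm (Ideal.map (algebraMap (𝓞 (cubicFixedField σ)) (𝓞 K)) p) =
      (Nat.card (𝓞 (cubicFixedField σ) ⧸ p)) ^ 2 := by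
  rw [Ideal.absNorm_algebraMap]
  have h2 : Module.finrank (𝓞 (cubicFixedField σ)) (𝓞 K) = 2 := by
    rw [← IsFractionRing.finrank_eq (𝓞 (cubicFixedField σ)) (cubicFixedField σ) (𝓞 K) K]
    refine (IntermediateField.finrank_fixedField_eq_card (Subgroup.zpowers (σ ^ 3))).trans ?_
    rw [Nat.card_zpowers, orderOf_pow, h.ord]; norm_num
  rw [h2]; rfl

lemma dvd_F {p : Ideal (𝓞 (cubicFixedField σ))} (hp : p.IsPrime) (hp0 : p ≠ ⊥) {Q : Ideal (𝓞 K)} (hQ : Q.IsPrime)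
    (hle : Ideal.map (algebraMap (𝓞 (cubicFixedField σ)) (𝓞 K)) p ≤ Q) :
    Nat.card (𝓞 (cubicFixedField σ) ⧸ p) ∣ Ideal.absNorm Q := by
  have := hp.isMaximal hp0
  let _ := Ideal.Quotient.field p
  let f : 𝓞 (cubicFixedField σ) ⧸ p →+* 𝓞 K ⧸ Q :=
    Ideal.Quotient.lift p ((Ideal.Quotient.mk Q).comp (algebraMap (𝓞 (cubicFixedField σ)) (𝓞 K)))
      (fun a ha => Ideal.Quotient.eq_zero_iff_mem.2 (hle (Ideal.mem_map_of_mem _ ha)))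
  have hf : Function.Injective f := f.injective
  exact AddSubgroup.card_dvd_of_injective f.toAddMonoidHom hf

lemma Setup.inert_F (h : Setup σ β) {p : Ideal (𝓞 (cubicFixedField σ))} (hp : p.IsPrime) (hp0 : p ≠ ⊥)
    (hI : (Ideal.map (algebraMap (𝓞 (cubicFixedField σ)) (𝓞 K)) p).IsPrime)
    (hc : IsCoprime (Ideal.map (algebraMap (𝓞 (cubicFixedField σ)) (𝓞 K)) p) (Ideal.span {(4 : 𝓞 K)})) :
    Nat.card (𝓞 (cubicFixedField σ) ⧸ p) % 4 = 3 := by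
  have := hp.isMaximal hp0
  let _ := Ideal.Quotient.field p
  by_contra hn
  have : Finite (𝓞 (cubicFixedField σ) ⧸ p) := Ideal.finiteQuotientOfFreeOfNeBot p hp0
  let _ := Fintype.ofFinite (𝓞 (cubicFixedField σ) ⧸ p)
  rw [Nat.card_eq_fintype_card] at hn
  obtain ⟨z, hz⟩ := FiniteField.isSquare_neg_one_iff.2 hn
  obtain ⟨s, rfl⟩ := Ideal.Quotient.mk_surjective z
  have hs : s * s + 1 ∈ p := by
    rw [← Ideal.Quotient.eq_zero_iff_mem, map_add, map_mul, ← hz, map_one]; ring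
  set I := Ideal.map (algebraMap (𝓞 (cubicFixedField σ)) (𝓞 K)) p with hIdef
  set S := algebraMap (𝓞 (cubicFixedField σ)) (𝓞 K) s with hS
  have hs' : S * S + 1 ∈ I := by
    have := Ideal.mem_map_of_mem (algebraMap (𝓞 (cubicFixedField σ)) (𝓞 K)) hs
    rwa [map_add, map_mul, map_one] at this
  set i : 𝓞 K := h.e ⟨0, 1⟩ with hi
  have hii : i * i = -1 := by
    rw [hi, ← map_mul, ← map_one h.e, ← map_neg]; rfl
  have hri : gr (σ ^ 3) i = -i := by
    rw [hi, h.e_gr' _ 1, ← map_neg]; rfl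
  have hrI : ∀ y, y ∈ I → gr (σ ^ 3) y ∈ I := by
    intro y hy
    have := (mem_ic (σ ^ 3) I y).2 hy
    rwa [hIdef, amb_F] at this
  have hprod : (S - i) * (S + i) ∈ I := by
    have : (S - i) * (S + i) = S * S + 1 := by linear_combination (-1 : 𝓞 K) * hii
    rwa [this]
  have h2 : S - i ∈ I ∧ S + i ∈ I := by
    rcases hI.mem_or_mem hprod with h3 | h3
    · refine ⟨h3, ?_⟩
      have := hrI _ h3
      rwa [map_sub, hri, gr_F, sub_neg_eq_add] at this
    · refine ⟨?_, h3⟩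
      have := hrI _ h3
      rwa [map_add, hri, gr_F, ← sub_eq_add_neg] at this
  have h4 : (4 : 𝓞 K) ∈ I := by
    have h5 := I.mul_mem_left (-2 * i) (I.sub_mem h2.2 h2.1)
    have h6 : -2 * i * (S + i - (S - i)) = 4 := by linear_combination (-4 : 𝓞 K) * hii
    rwa [h6] at h5
  apply hI.ne_top
  rw [Ideal.isCoprime_iff_sup_eq, sup_eq_left.2 ((Ideal.span_singleton_le_iff_mem I).2 h4)] at hc
  exact hc
end eleven
end Shi

namespace Shi
section twelve
variable {K : Type*} [Field K] [NumberField K] [IsGalois ℚ K] {σ : K ≃ₐ[ℚ] K} {β α : K}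

lemma Setup.main (h : Setup σ β) (hα : Cub σ α) :
    ∃ ψ : Ideal (𝓞 K) → K, IsShimuraIdealChar σ (Ideal.span {(4 : 𝓞 K)}) ψ := by
  have hex : ∀ I : Ideal (𝓞 K), ∃ x : K, I ≠ ⊥ → IsCoprime I (Ideal.span {(4 : 𝓞 K)}) → ∃ g, Good h I x g := by
    intro I
    by_cases hI : I ≠ ⊥ ∧ IsCoprime I (Ideal.span {(4 : 𝓞 K)})
    · obtain ⟨x, hx⟩ := h.exists_good hα hI.1 hI.2
      exact ⟨x, fun _ _ => hx⟩
    · exact ⟨0, fun h1 h2 => absurd ⟨h1, h2⟩ hI⟩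
  choose ψ hψ using hex
  refine ⟨ψ, ?_, ?_, ?_, ?_, ?_, ?_⟩
  · intro I hI hc
    obtain ⟨g, hg⟩ := hψ I hI hc
    exact hg.ne_zero hI
  · intro I J hI hJ hcI hcJ
    obtain ⟨g, hg⟩ := hψ I hI hcI
    obtain ⟨g', hg'⟩ := hψ J hJ hcJ
    have h0 : I * J ≠ ⊥ := mul_ne_zero hI hJ
    obtain ⟨g'', hg''⟩ := hψ (I * J) h0 (mul_coprime hcI hcJ)
    exact hg''.uniq (hg.mul hg') h0
  · intro s hc hs
    obtain ⟨h0, g, hg⟩ := h.good_span hs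
    obtain ⟨g', hg'⟩ := hψ _ h0 hc
    exact hg'.uniq hg h0
  · intro p hp hp0 hc
    have h0 : Ideal.map (algebraMap (𝓞 (cubicFixedField σ)) (𝓞 K)) p ≠ ⊥ := by
      rw [Ne, Ideal.map_eq_bot_iff_of_injective (FaithfulSMul.algebraMap_injective _ _)]
      exact hp0
    obtain ⟨g, hg⟩ := hψ _ h0 hc
    obtain ⟨h1, h2, h3⟩ := h.amb_good h0 (amb_F p) hg
    rw [h.absNorm_F] at h2
    have hnorm := h.absNorm_F p
    have hdvd := fun Q hQ hle => dvd_F (σ := σ) hp hp0 (Q := Q) hQ hle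
    have hin := fun hI => h.inert_F hp hp0 hI hc
    set n := Nat.card (𝓞 (cubicFixedField σ) ⧸ p) with hn
    have hn0 : n ≠ 0 := by
      intro hh
      rw [hh] at hnorm
      exact h0 (Ideal.absNorm_eq_zero_iff.1 (by simpa using hnorm))
    have h4 : g.re = n ∨ g.re = -n := by
      rw [← sq_eq_sq_iff_eq_or_eq_neg, ← h2]; push_cast; rfl
    constructor
    · rintro ⟨Q₁, Q₂, hQ₁, hQ₂, -, hQ⟩
      obtain ⟨a, ha⟩ := hdvd Q₁ hQ₁ (by rw [hQ]; exact Ideal.mul_le_left)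
      obtain ⟨b, hb⟩ := hdvd Q₂ hQ₂ (by rw [hQ]; exact Ideal.mul_le_right)
      rw [hQ, map_mul, ha, hb] at hnorm
      have hab : a * b = 1 := by
        have : n ^ 2 * (a * b) = n ^ 2 * 1 := by linear_combination hnorm
        exact Nat.eq_of_mul_eq_mul_left (by positivity) this
      have ha1 : a = 1 := Nat.eq_one_of_mul_eq_one_right hab
      rw [ha1, mul_one] at ha
      have hQ0 : Q₁ ≠ ⊥ := by
        rintro rfl
        exact hn0 (by rw [← ha, Ideal.absNorm_bot])
      rw [hQ] at hc
      have hc1 := hc.of_mul_left_left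
      obtain ⟨g', hg'⟩ := h.relgen hQ0
      have h5 := norm_mod4 (h.odd hc1 hg')
      rw [← h.gen_norm hg', ha] at h5
      have h6 : g.re = n := by omega
      rw [h1, h6, Int.cast_natCast]
    · intro hI
      have h5 := hin hI
      have h6 : g.re = -n := by omega
      rw [h1, h6, Int.cast_neg, Int.cast_natCast]
  · intro I hI hc
    obtain ⟨g, hg⟩ := hψ I hI hc
    exact ⟨hg.norm, hg.ideal⟩
  · intro I hI hc
    obtain ⟨g, hg⟩ := hψ I hI hc
    have h0 := ic_ne_bot σ hI
    obtain ⟨g', hg'⟩ := hψ _ h0 (ic_coprime σ hc)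
    exact hg'.uniq hg.conj h0

end twelve
end Shi

/-- For the sextic cyclic CM field ℚ(α, i) of conductor 252 there exists a Shimura ideal character. -/
theorem stmt_12 (K : Type*) [Field K] [NumberField K]
    (hdeg : Module.finrank ℚ K = 6) [IsGalois ℚ K] (hcyc : IsCyclic (K ≃ₐ[ℚ] K))
    (α β : K) (hα : α ^ 3 = 21 * α + 28) (hβ : β ^ 2 = (-1 : K)) :
    ∃ (σ : K ≃ₐ[ℚ] K) (𝔠 : Ideal (𝓞 K)) (ψ : Ideal (𝓞 K) → K),
      (∀ τ : K ≃ₐ[ℚ] K, τ ∈ Subgroup.zpowers σ) ∧ 𝔠 ≠ ⊥ ∧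
      IsShimuraIdealChar σ 𝔠 ψ := by
  obtain ⟨σ, hσ⟩ := hcyc.exists_generator
  have ho : orderOf σ = 6 := by
    rw [orderOf_eq_card_of_forall_mem_zpowers hσ, IsGalois.card_aut_eq_finrank, hdeg]
  have hsb : σ β = -β := by
    have h1 : (σ β) ^ 2 = β ^ 2 := by rw [← map_pow, hβ, map_neg, map_one]
    rcases sq_eq_sq_iff_eq_or_eq_neg.1 h1 with h2 | h2
    · exfalso
      have h3 : ∀ τ : K ≃ₐ[ℚ] K, τ β = β := by
        intro τ
        obtain ⟨n, rfl⟩ := mem_powers_iff_mem_zpowers.mpr (hσ τ)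
        change (σ ^ n) β = β
        induction n with
        | zero => rfl
        | succ k ih => rw [pow_succ, AlgEquiv.mul_apply, h2, ih]
      obtain ⟨q, hq⟩ := (IsGalois.mem_range_algebraMap_iff_fixed β).2 h3
      have h4 : q ^ 2 = -1 := by
        apply (algebraMap ℚ K).injective
        rw [map_pow, hq, hβ, map_neg, map_one]
      nlinarith [sq_nonneg q]
    · exact h2
  have h : Shi.Setup σ β := ⟨hσ, ho, hsb, hβ, hdeg⟩
  obtain ⟨ψ, hψ⟩ := h.main (h.cub hα)
  refine ⟨σ, Ideal.span {(4 : 𝓞 K)}, ψ, hσ, ?_, hψ⟩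
  rw [Ne, Ideal.span_singleton_eq_bot]
  norm_num
end

section
/- Let K be a number field of degree 6 over ℚ that is Galois over ℚ with cyclic Galois group, and suppose K contains elements α and β with α³ = 21α − 7 and β² = −3 (so K is the sextic cyclic CM field ℚ(α, √−3) of conductor 21, whose group of roots of unity has order 6). Then there exist a generator σ of Gal(K/ℚ), a nonzero ideal 𝔠 of 𝒪_K, and a map ψ from the nonzero ideals of 𝒪_K coprime to 𝔠 to the nonzero elements of K satisfying conditions (i), (ii), (iii), (iv) of a Shimura ideal character of type (σ, 𝔠) together with the ρ-equivariance condition ψ(ρ(I)) = ρ(ψ(I)) for every I coprime to 𝔠 (in place of the full σ-equivariance condition (v)). -/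
open NumberField

/-- The variant of a *Shimura ideal character of type `(σ, 𝔠)`* satisfying conditions
(i)–(iv) together with `ρ`-equivariance (`ρ = σ³`) in place of the full `σ`-equivariance
condition (v). Here `F` is the cubic subfield of `K` (the fixed field of `ρ`), and the
absolute norm `N` of an ideal is the cardinality of the corresponding quotient. -/
noncomputable def IsShimuraIdealCharRho {K : Type*} [Field K] [NumberField K]
    (σ : K ≃ₐ[ℚ] K) (𝔠 : Ideal (𝓞 K)) (ψ : Ideal (𝓞 K) → K) : Prop :=
  -- ψ takes nonzero values on nonzero ideals coprime to 𝔠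
  (∀ I : Ideal (𝓞 K), I ≠ ⊥ → IsCoprime I 𝔠 → ψ I ≠ 0) ∧
  -- (i) multiplicativity
  (∀ I J : Ideal (𝓞 K), I ≠ ⊥ → J ≠ ⊥ → IsCoprime I 𝔠 → IsCoprime J 𝔠 →
    ψ (I * J) = ψ I * ψ J) ∧
  -- (ii) value on principal ideals generated by `s ≡ 1 mod 𝔠`
  (∀ s : 𝓞 K, IsCoprime (Ideal.span {s}) 𝔠 → s - 1 ∈ 𝔠 →
    ψ (Ideal.span {s}) = (s : K) * (σ ^ 4) (s : K) * (σ ^ 5) (s : K)) ∧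
  -- (iii) value on primes of the cubic subfield `F` unramified in `K`: such a prime either
  -- splits (`𝔭 𝓞 K` is a product of two distinct primes) or is inert (`𝔭 𝓞 K` is prime)
  (∀ 𝔭 : Ideal (𝓞 (cubicFixedField σ)), 𝔭.IsPrime → 𝔭 ≠ ⊥ →
    IsCoprime (Ideal.map (algebraMap (𝓞 (cubicFixedField σ)) (𝓞 K)) 𝔭) 𝔠 →
    ((∃ Q₁ Q₂ : Ideal (𝓞 K), Q₁.IsPrime ∧ Q₂.IsPrime ∧ Q₁ ≠ Q₂ ∧
        Ideal.map (algebraMap (𝓞 (cubicFixedField σ)) (𝓞 K)) 𝔭 = Q₁ * Q₂) →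
      ψ (Ideal.map (algebraMap (𝓞 (cubicFixedField σ)) (𝓞 K)) 𝔭)
        = (Nat.card (𝓞 (cubicFixedField σ) ⧸ 𝔭) : K)) ∧
    ((Ideal.map (algebraMap (𝓞 (cubicFixedField σ)) (𝓞 K)) 𝔭).IsPrime →
      ψ (Ideal.map (algebraMap (𝓞 (cubicFixedField σ)) (𝓞 K)) 𝔭)
        = -(Nat.card (𝓞 (cubicFixedField σ) ⧸ 𝔭) : K))) ∧
  -- (iv) norm relation and ideal generation
  (∀ I : Ideal (𝓞 K), I ≠ ⊥ → IsCoprime I 𝔠 →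
    ψ I * (σ ^ 3) (ψ I) = (Nat.card (𝓞 K ⧸ I) : K) ∧
    FractionalIdeal.spanSingleton (nonZeroDivisors (𝓞 K)) (ψ I)
      = ((I * idealConj (σ ^ 4) I * idealConj (σ ^ 5) I : Ideal (𝓞 K)) :
          FractionalIdeal (nonZeroDivisors (𝓞 K)) K)) ∧
  -- ρ-equivariance, where ρ = σ³ (in place of condition (v))
  (∀ I : Ideal (𝓞 K), I ≠ ⊥ → IsCoprime I 𝔠 →
    ψ (idealConj (σ ^ 3) I) = (σ ^ 3) (ψ I))


theorem gen_order {K : Type*} [Field K] [NumberField K] [IsGalois ℚ K]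
    (hdeg : Module.finrank ℚ K = 6) (σ : K ≃ₐ[ℚ] K) (hσ : ∀ τ, τ ∈ Subgroup.zpowers σ) :
    orderOf σ = 6 := by
  rw [orderOf_eq_card_of_forall_mem_zpowers hσ, IsGalois.card_aut_eq_finrank, hdeg]

theorem sh_fixed {K : Type*} [Field K] [NumberField K] [IsGalois ℚ K]
    (σ : K ≃ₐ[ℚ] K) (hσ : ∀ τ, τ ∈ Subgroup.zpowers σ) (x : K) (hx : σ x = x) :
    ∃ q : ℚ, (q : K) = x := by
  have h : ∀ f : Gal(K/ℚ), f x = x := by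
    intro f
    have hs : σ ∈ MulAction.stabilizer (K ≃ₐ[ℚ] K) x := hx
    exact (Subgroup.zpowers_le.2 hs) (hσ f)
  obtain ⟨q, hq⟩ := (IsGalois.mem_range_algebraMap_iff_fixed (F := ℚ) x).2 h
  exact ⟨q, by simpa using hq⟩

theorem no_root (q : ℚ) (h : q ^ 3 = q ^ 2 + 2 * q - 1) : False := by
  have hi : IsIntegral ℤ q := by
    refine ⟨.X ^ 3 - .X ^ 2 - 2 * .X + 1, by monicity!, ?_⟩
    simp only [Polynomial.eval₂_add, Polynomial.eval₂_sub, Polynomial.eval₂_mul, Polynomial.eval₂_pow, Polynomial.eval₂_X, Polynomial.eval₂_one, Polynomial.eval₂_ofNat]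
    linear_combination h
  obtain ⟨n, rfl⟩ := IsIntegrallyClosed.isIntegral_iff.1 hi
  have h2 : (n : ℤ) ^ 3 = n ^ 2 + 2 * n - 1 := by
    have : ((n : ℚ)) ^ 3 = n ^ 2 + 2 * n - 1 := by simpa using h
    exact_mod_cast this
  have h3 := congrArg (fun t : ℤ => (t : ZMod 2)) h2
  push_cast at h3
  generalize (n : ZMod 2) = m at h3
  revert m; decide

/-- The choice of generator and of integral elements. -/
theorem sh_data (K : Type*) [Field K] [NumberField K]
    (hdeg : Module.finrank ℚ K = 6) [IsGalois ℚ K] (hcyc : IsCyclic (K ≃ₐ[ℚ] K))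
    (α β : K) (hα : α ^ 3 = 21 * α - 7) (hβ : β ^ 2 = (-3 : K)) :
    ∃ σ : K ≃ₐ[ℚ] K, (∀ τ, τ ∈ Subgroup.zpowers σ) ∧ ∃ z w : 𝓞 K,
      z ^ 3 = z ^ 2 + 2 * z - 1 ∧ w ^ 2 = - 1 - w ∧
      galRestrict ℤ ℚ K (𝓞 K) σ z = 2 - z ^ 2 ∧ galRestrict ℤ ℚ K (𝓞 K) σ w = - 1 - w := by
  obtain ⟨σ₀, hσ₀⟩ := hcyc
  obtain ⟨z, hz⟩ : ∃ z : K, z = (α + 1) / 3 := ⟨_, rfl⟩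
  obtain ⟨w, hw⟩ : ∃ w : K, w = (β - 1) / 2 := ⟨_, rfl⟩
  have hz3 : z ^ 3 = z ^ 2 + 2 * z - 1 := by
    rw [hz]; field_simp; linear_combination hα
  have hw2 : w ^ 2 = - 1 - w := by
    rw [hw]; field_simp; linear_combination hβ
  have hzi : IsIntegral ℤ z := by
    refine ⟨.X ^ 3 - .X ^ 2 - 2 * .X + 1, by monicity!, ?_⟩
    simp only [Polynomial.eval₂_add, Polynomial.eval₂_sub, Polynomial.eval₂_mul, Polynomial.eval₂_pow, Polynomial.eval₂_X, Polynomial.eval₂_one, Polynomial.eval₂_ofNat]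
    linear_combination hz3
  have hwi : IsIntegral ℤ w := by
    refine ⟨.X ^ 2 + .X + 1, by monicity!, ?_⟩
    simp only [Polynomial.eval₂_add, Polynomial.eval₂_sub, Polynomial.eval₂_mul, Polynomial.eval₂_pow, Polynomial.eval₂_X, Polynomial.eval₂_one, Polynomial.eval₂_ofNat]
    linear_combination hw2
  have key : ∀ σ : K ≃ₐ[ℚ] K, (∀ τ, τ ∈ Subgroup.zpowers σ) → σ w = -1 - w ∧
      (σ z = 2 - z ^ 2 ∨ σ z = z ^ 2 - z - 1) := by
    intro σ hσ
    constructor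
    · have h1 : (σ w - w) * (σ w - (-1 - w)) = 0 := by
        have := congrArg σ hw2
        simp only [map_pow, map_sub, map_neg, map_one] at this
        linear_combination this - hw2
      rcases mul_eq_zero.1 h1 with h | h
      · obtain ⟨q, hq⟩ := sh_fixed σ hσ w (sub_eq_zero.1 h)
        rw [← hq] at hw2
        have : q ^ 2 = -1 - q := by exact_mod_cast hw2
        nlinarith [sq_nonneg (q + 1/2)]
      · exact sub_eq_zero.1 h
    · have h1 : (σ z - z) * ((σ z - (2 - z ^ 2)) * (σ z - (z ^ 2 - z - 1))) = 0 := by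
        have := congrArg σ hz3
        simp only [map_pow, map_sub, map_add, map_mul, map_ofNat, map_one] at this
        generalize σ z = y at *
        linear_combination (-y * z + y + z^2 - 3) * hz3 + this + (2 - y) * hz3
      rcases mul_eq_zero.1 h1 with h | h
      · obtain ⟨q, hq⟩ := sh_fixed σ hσ z (sub_eq_zero.1 h)
        rw [← hq] at hz3
        exact (no_root q (by exact_mod_cast hz3)).elim
      · rcases mul_eq_zero.1 h with h | h
        · exact Or.inl (sub_eq_zero.1 h)
        · exact Or.inr (sub_eq_zero.1 h)
  have fin : ∀ σ : K ≃ₐ[ℚ] K, (∀ τ, τ ∈ Subgroup.zpowers σ) → σ z = 2 - z ^ 2 →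
    ∃ σ : K ≃ₐ[ℚ] K, (∀ τ, τ ∈ Subgroup.zpowers σ) ∧ ∃ z w : 𝓞 K,
      z ^ 3 = z ^ 2 + 2 * z - 1 ∧ w ^ 2 = - 1 - w ∧
      galRestrict ℤ ℚ K (𝓞 K) σ z = 2 - z ^ 2 ∧ galRestrict ℤ ℚ K (𝓞 K) σ w = - 1 - w := by
    intro σ hσ hs
    refine ⟨σ, hσ, ⟨z, hzi⟩, ⟨w, hwi⟩, ?_, ?_, ?_, ?_⟩
    · apply RingOfIntegers.ext; simpa using! hz3
    · apply RingOfIntegers.ext; exact hw2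
    · apply RingOfIntegers.ext
      rw [show ((galRestrict ℤ ℚ K (𝓞 K) σ ⟨z, hzi⟩ : 𝓞 K) : K) = σ z from algebraMap_galRestrict_apply ℤ σ _]
      simpa using! hs
    · apply RingOfIntegers.ext
      rw [show ((galRestrict ℤ ℚ K (𝓞 K) σ ⟨w, hwi⟩ : 𝓞 K) : K) = σ w from algebraMap_galRestrict_apply ℤ σ _]
      simpa using! (key σ hσ).1
  rcases (key σ₀ hσ₀).2 with h | h
  · exact fin σ₀ hσ₀ h
  · have h' : ∀ τ, τ ∈ Subgroup.zpowers σ₀⁻¹ := by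
      rw [Subgroup.zpowers_inv]; exact fun τ => hσ₀ τ
    refine fin σ₀⁻¹ h' ?_
    rcases (key _ h').2 with h2 | h2
    · exact h2
    · exfalso
      have h3 : z = σ₀ (z ^ 2 - z - 1) := by
        rw [← h2]; exact (AlgEquiv.apply_symm_apply σ₀ z).symm
      simp only [map_pow, map_sub, map_one, h] at h3
      have h5 : z ^ 4 = 3 * z ^ 2 + z - 1 := by linear_combination (z + 1) * hz3
      have : 2 - z ^ 2 = z := by
        linear_combination -h3 - h5 + 2 * hz3
      have h6 : 2 * z = 3 := by linear_combination hz3 + (z - 2) * this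
      have h7 : (7 : K) = 0 := by linear_combination (-4) * this - (2 * z + 5) * h6
      norm_num at h7

theorem sh_prod {G M : Type*} [Group G] [Fintype G] [CommMonoid M] (σ : G)
    (hσ : ∀ τ, τ ∈ Subgroup.zpowers σ) (ho : orderOf σ = 6) (f : G → M) :
    ∏ τ, f τ = ∏ i ∈ Finset.range 6, f (σ ^ i) := by
  classical
  rw [← ho, ← IsCyclic.image_range_orderOf hσ, Finset.prod_image]
  intro i hi j hj h
  simp only [Finset.coe_range, Set.mem_Iio] at hi hj
  exact pow_injOn_Iio_orderOf hi hj h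

theorem sh_sum {G M : Type*} [Group G] [Fintype G] [AddCommMonoid M] (σ : G)
    (hσ : ∀ τ, τ ∈ Subgroup.zpowers σ) (ho : orderOf σ = 6) (f : G → M) :
    ∑ τ, f τ = ∑ i ∈ Finset.range 6, f (σ ^ i) := by
  classical
  rw [← ho, ← IsCyclic.image_range_orderOf hσ, Finset.sum_image]
  intro i hi j hj h
  simp only [Finset.coe_range, Set.mem_Iio] at hi hj
  exact pow_injOn_Iio_orderOf hi hj h

/-- shorthand for the automorphism on integers -/
noncomputable def gR {K : Type*} [Field K] [NumberField K] (τ : K ≃ₐ[ℚ] K) :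
    𝓞 K ≃ₐ[ℤ] 𝓞 K := galRestrict ℤ ℚ K (𝓞 K) τ

theorem gR_coe {K : Type*} [Field K] [NumberField K] (τ : K ≃ₐ[ℚ] K) (x : 𝓞 K) :
    ((gR τ x : 𝓞 K) : K) = τ x := algebraMap_galRestrict_apply ℤ τ _

theorem gR_mul {K : Type*} [Field K] [NumberField K] (τ υ : K ≃ₐ[ℚ] K) (x : 𝓞 K) :
    gR (τ * υ) x = gR τ (gR υ x) := by
  simp [gR, map_mul]

theorem sh_norm {K : Type*} [Field K] [NumberField K] [IsGalois ℚ K]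
    (hdeg : Module.finrank ℚ K = 6) (σ : K ≃ₐ[ℚ] K) (hσ : ∀ τ, τ ∈ Subgroup.zpowers σ)
    (x : 𝓞 K) : ((Algebra.norm ℤ x : ℤ) : 𝓞 K) = ∏ i ∈ Finset.range 6, gR (σ ^ i) x := by
  rw [← sh_prod σ hσ (gen_order hdeg σ hσ) (fun τ => gR τ x)]
  apply RingOfIntegers.ext
  have h := Algebra.norm_eq_prod_automorphisms ℚ (x : K)
  rw [← Algebra.coe_norm_int] at h
  simp only [map_prod, map_intCast, gR_coe] 
  simpa using h

theorem sh_trace {K : Type*} [Field K] [NumberField K] [IsGalois ℚ K]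
    (hdeg : Module.finrank ℚ K = 6) (σ : K ≃ₐ[ℚ] K) (hσ : ∀ τ, τ ∈ Subgroup.zpowers σ)
    (x : 𝓞 K) : ((Algebra.trace ℤ (𝓞 K) x : ℤ) : 𝓞 K) = ∑ i ∈ Finset.range 6, gR (σ ^ i) x := by
  rw [← sh_sum σ hσ (gen_order hdeg σ hσ) (fun τ => gR τ x)]
  apply RingOfIntegers.ext
  have h := trace_eq_sum_automorphisms (K := ℚ) (x : K)
  rw [← Algebra.coe_trace_int] at h
  simp only [map_sum, map_intCast, gR_coe] 
  simpa using h

/-- The running data of the whole proof. -/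
structure ShData (K : Type*) [Field K] [NumberField K] (σ : K ≃ₐ[ℚ] K) (z w : 𝓞 K) : Prop where
  deg : Module.finrank ℚ K = 6
  gal : IsGalois ℚ K
  gen : ∀ τ, τ ∈ Subgroup.zpowers σ
  hz : z ^ 3 = z ^ 2 + 2 * z - 1
  hw : w ^ 2 = - 1 - w
  sz : gR σ z = 2 - z ^ 2
  sw : gR σ w = - 1 - w

namespace ShData
variable {K : Type*} [Field K] [NumberField K] {σ : K ≃ₐ[ℚ] K} {z w : 𝓞 K}

theorem ord (D : ShData K σ z w) : orderOf σ = 6 := by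
  have := D.gal
  exact gen_order D.deg σ D.gen

theorem z0 (D : ShData K σ z w) : gR (σ ^ 0) z = z := by simp [gR]
theorem w0 (D : ShData K σ z w) : gR (σ ^ 0) w = w := by simp [gR]
theorem z1 (D : ShData K σ z w) : gR (σ ^ 1) z = 2 - z ^ 2 := by rw [pow_one]; exact D.sz
theorem w1 (D : ShData K σ z w) : gR (σ ^ 1) w = - 1 - w := by rw [pow_one]; exact D.sw
theorem z2 (D : ShData K σ z w) : gR (σ ^ 2) z = z ^ 2 - z - 1 := by
  rw [pow_succ', gR_mul, D.z1]; simp only [map_sub, map_pow, map_ofNat, D.sz]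
  linear_combination (-z - 1) * D.hz
theorem w2 (D : ShData K σ z w) : gR (σ ^ 2) w = w := by
  rw [pow_succ', gR_mul, D.w1]; simp only [map_sub, map_neg, map_one, D.sw]; ring
theorem z3 (D : ShData K σ z w) : gR (σ ^ 3) z = z := by
  rw [pow_succ', gR_mul, D.z2]; simp only [map_sub, map_pow, map_one, D.sz]
  linear_combination (z + 1) * D.hz
theorem w3 (D : ShData K σ z w) : gR (σ ^ 3) w = - 1 - w := by
  rw [pow_succ', gR_mul, D.w2, D.sw]
theorem z4 (D : ShData K σ z w) : gR (σ ^ 4) z = 2 - z ^ 2 := by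
  rw [pow_succ', gR_mul, D.z3, D.sz]
theorem w4 (D : ShData K σ z w) : gR (σ ^ 4) w = w := by
  rw [pow_succ', gR_mul, D.w3]; simp only [map_sub, map_neg, map_one, D.sw]; ring
theorem z5 (D : ShData K σ z w) : gR (σ ^ 5) z = z ^ 2 - z - 1 := by
  rw [pow_succ', gR_mul, D.z4]; simp only [map_sub, map_pow, map_ofNat, D.sz]
  linear_combination (-z - 1) * D.hz
theorem w5 (D : ShData K σ z w) : gR (σ ^ 5) w = - 1 - w := by
  rw [pow_succ', gR_mul, D.w4, D.sw]

theorem trace_mon (D : ShData K σ z w) (a b : ℕ) : ((Algebra.trace ℤ (𝓞 K) (w ^ a * z ^ b) : ℤ) : 𝓞 K) =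
    (w ^ a + (- 1 - w) ^ a) * (z ^ b + (2 - z ^ 2) ^ b + (z ^ 2 - z - 1) ^ b) := by
  have := D.gal
  rw [sh_trace D.deg σ D.gen]
  simp only [Finset.sum_range_succ, Finset.sum_range_zero, map_mul, map_pow, D.z0, D.z1, D.z2,
    D.z3, D.z4, D.z5, D.w0, D.w1, D.w2, D.w3, D.w4, D.w5]
  ring

theorem tw (D : ShData K σ z w) (a : ℕ) (ha : a < 3) : w ^ a + (- 1 - w) ^ a = ((![2, -1, -1] : Fin 3 → ℤ) ⟨a, ha⟩ : ℤ) := by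
  interval_cases a <;> norm_num
  linear_combination 2 * D.hw

theorem tz (D : ShData K σ z w) (a : ℕ) (ha : a < 5) : z ^ a + (2 - z ^ 2) ^ a + (z ^ 2 - z - 1) ^ a
    = ((![3, 1, 5, 4, 13] : Fin 5 → ℤ) ⟨a, ha⟩ : ℤ) := by
  have h4 : z ^ 4 = 3 * z ^ 2 + z - 1 := by linear_combination (z + 1) * D.hz
  have h6 : (2 - z ^ 2) ^ 2 = - z ^ 2 + z + 3 := by linear_combination h4
  have h7 : (z ^ 2 - z - 1) ^ 2 = 2 - z := by linear_combination h4 - 2 * D.hz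
  have e3 : ∀ x : 𝓞 K, x ^ 3 = x ^ 2 * x := fun x => by ring
  have e4 : ∀ x : 𝓞 K, x ^ 4 = (x ^ 2) ^ 2 := fun x => by ring
  interval_cases a
  · norm_num
  · norm_num; ring
  · simp [h6, h7]; ring
  · rw [e3 (2 - _), e3 (_ - 1), h6, h7]; simp
    linear_combination h4 - D.hz
  · rw [e4 (2 - _), e4 (_ - 1), h6, h7]; simp
    linear_combination 2 * h4 - 2 * D.hz

theorem discr_b (D : ShData K σ z w) : Algebra.discr ℤ (fun p : Fin 2 × Fin 3 => w ^ (p.1 : ℕ) * z ^ (p.2 : ℕ)) =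
    -64827 := by
  rw [Algebra.discr_def]
  have : Algebra.traceMatrix ℤ (fun p : Fin 2 × Fin 3 => w ^ (p.1 : ℕ) * z ^ (p.2 : ℕ)) =
      Matrix.kroneckerMap (· * ·) !![2, -1; -1, -1] !![3, 1, 5; 1, 5, 4; 5, 4, 13] := by
    ext ⟨i, j⟩ ⟨k, l⟩
    rw [Algebra.traceMatrix_apply, Algebra.traceForm_apply, Matrix.kroneckerMap_apply]
    have h1 : (w ^ (i : ℕ) * z ^ (j : ℕ)) * (w ^ (k : ℕ) * z ^ (l : ℕ)) =
      w ^ (i + k : ℕ) * z ^ (j + l : ℕ) := by ring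
    rw [h1]
    apply Int.cast_injective (α := 𝓞 K)
    rw [D.trace_mon, D.tw _ (by omega), D.tz _ (by omega), ← Int.cast_mul]
    congr 1
    fin_cases i <;> fin_cases j <;> fin_cases k <;> fin_cases l <;> rfl
  rw [this, Matrix.det_kronecker]
  simp [Matrix.det_fin_three]

theorem discr_le (D : ShData K σ z w) : |NumberField.discr K| ≤ 64827 := by
  have hc : Fintype.card (Module.Free.ChooseBasisIndex ℤ (𝓞 K)) = Fintype.card (Fin 2 × Fin 3) := by
    rw [← Module.finrank_eq_card_chooseBasisIndex, RingOfIntegers.rank, D.deg]; rfl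
  let e := Fintype.equivOfCardEq hc
  let B := (RingOfIntegers.basis K).reindex e
  have h1 : Algebra.discr ℤ B = NumberField.discr K := by
    rw [NumberField.discr, Module.Basis.coe_reindex]
    exact Algebra.discr_reindex _ _ _
  have h2 := D.discr_b
  rw [← Module.Basis.toMatrix_map_vecMul B (fun p : Fin 2 × Fin 3 => w ^ (p.1 : ℕ) * z ^ (p.2 : ℕ)), Algebra.discr_of_matrix_vecMul, h1] at h2
  generalize (B.toMatrix _).det = d at h2
  have h3 : d ^ 2 * |NumberField.discr K| = 64827 := by
    rw [← abs_of_nonneg (sq_nonneg d), ← abs_mul, h2]; rfl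
  have : 1 ≤ d ^ 2 := by
    by_contra h
    have : d ^ 2 = 0 := by nlinarith [sq_nonneg d]
    rw [this] at h3; norm_num at h3
  nlinarith [abs_nonneg (NumberField.discr K)]

theorem complexPlaces (D : ShData K σ z w) : InfinitePlace.nrComplexPlaces K = 3 := by
  have h := InfinitePlace.card_add_two_mul_card_eq_rank K
  rw [D.deg] at h
  have h0 : InfinitePlace.nrRealPlaces K = 0 := by
    classical
    rw [InfinitePlace.nrRealPlaces, Fintype.card_eq_zero_iff]
    refine ⟨fun ⟨v, hv⟩ => ?_⟩
    let f := InfinitePlace.embedding_of_isReal hv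
    have := congrArg (fun x : 𝓞 K => f x) D.hw
    simp at this
    nlinarith [sq_nonneg (f w + 1 / 2)]
  omega

theorem minkowski (D : ShData K σ z w) : (4 / Real.pi) ^ InfinitePlace.nrComplexPlaces K *
  ((Module.finrank ℚ K).factorial / (Module.finrank ℚ K) ^ (Module.finrank ℚ K) * √|(NumberField.discr K : ℝ)|) < 9 := by
  rw [D.deg, D.complexPlaces]
  have h1 : √|(NumberField.discr K : ℝ)| ≤ 255 := by
    rw [Real.sqrt_le_left (by norm_num)]
    have := D.discr_le
    have : ((|NumberField.discr K| : ℤ) : ℝ) ≤ 64827 := by exact_mod_cast this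
    push_cast at this
    linarith
  have h2 : 4 / Real.pi ≤ 1.28 := by
    rw [div_le_iff₀ Real.pi_pos]; linarith [Real.pi_gt_d2]
  have h3 : (4 / Real.pi) ^ 3 ≤ 1.28 ^ 3 := pow_le_pow_left₀ (by positivity) h2 3
  have h4 : (4 / Real.pi) ^ 3 * (((6 : ℕ).factorial : ℝ) / ((6 : ℕ) : ℝ) ^ 6 * √|(NumberField.discr K : ℝ)|)
    ≤ 1.28 ^ 3 * (((6 : ℕ).factorial : ℝ) / ((6 : ℕ) : ℝ) ^ 6 * 255) := by
    gcongr
  refine h4.trans_lt ?_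
  norm_num [Nat.factorial]

theorem norm_theta (D : ShData K σ z w) : (Algebra.norm ℤ (z + w)) = 7 := by
  have := D.gal
  apply Int.cast_injective (α := 𝓞 K)
  rw [sh_norm D.deg σ D.gen]
  simp only [Finset.prod_range_succ, Finset.prod_range_zero, map_add, D.z0, D.z1, D.z2,
    D.z3, D.z4, D.z5, D.w0, D.w1, D.w2, D.w3, D.w4, D.w5]
  have a : (z + w) * (z + (-1 - w)) = z ^ 2 - z + 1 := by linear_combination -D.hw
  have b : (2 - z ^ 2 + w) * (2 - z ^ 2 + (-1 - w)) = z + 2 := by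
    linear_combination -D.hw + (z + 1) * D.hz
  have c : (z ^ 2 - z - 1 + w) * (z ^ 2 - z - 1 + (-1 - w)) = 4 - z ^ 2 := by
    linear_combination -D.hw + (z - 1) * D.hz
  calc _ = ((z + w) * (z + (-1 - w))) * ((2 - z ^ 2 + w) * (2 - z ^ 2 + (-1 - w))) *
        ((z ^ 2 - z - 1 + w) * (z ^ 2 - z - 1 + (-1 - w))) := by ring
    _ = (z ^ 2 - z + 1) * (z + 2) * (4 - z ^ 2) := by rw [a, b, c]
    _ = _ := by
      push_cast
      linear_combination (- z ^ 2 - 2 * z + 1) * D.hz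
end ShData

theorem small_field {k : Type*} [Field k] (z w : k) (q : ℕ) (hq1 : 1 < q) (hq : q < 9) (h0 : (q : k) = 0)
    (hz : z ^ 3 = z ^ 2 + 2 * z - 1) (hw : w ^ 2 = - 1 - w) (hzq : z ^ q = z) (hwq : w ^ q = w) :
    z + w = 0 ∨ z + (-1 - w) = 0 := by
  interval_cases q
  · exfalso; push_cast at h0; grind
  · exfalso; push_cast at h0; grind
  · exfalso; push_cast at h0
    have : (2 : k) = 0 := by
      have : (2 : k) ^ 2 = 0 := by linear_combination h0
      exact pow_eq_zero_iff (by norm_num) |>.1 this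
    grind
  · exfalso; push_cast at h0
    have h1 : z ^ 2 + z + 3 = 0 := by
      linear_combination (z ^ 2 + z) * h0 - hzq + (z ^ 2 + z + 3) * hz
    have h2 : z + 1 = 0 := by
      linear_combination -2 * (hz - (z - 2) * h1) + (3 - z) * h0
    have : (1 : k) = 0 := by linear_combination 2 * (h1 - z * h2) - h0
    exact one_ne_zero this
  · exfalso; push_cast at h0
    have : (2 : k) * 3 = 0 := by linear_combination h0
    have h1 : w = 1 := by
      rw [← hwq]; linear_combination (w ^ 4 - w ^ 3 + w - 1) * hw
    have : (3 : k) = 0 := by rw [h1] at hw; linear_combination hw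
    grind
  · push_cast at h0
    have h5 : z = 5 := by
      have : (z - 5) ^ 3 = 0 := by linear_combination hz - (2 * z ^ 2 - 11 * z + 18) * h0
      exact sub_eq_zero.1 (pow_eq_zero_iff (by norm_num) |>.1 this)
    have : (w - 2) * (w - 4) = 0 := by linear_combination hw - (w - 1) * h0
    rcases mul_eq_zero.1 this with h | h
    · left; linear_combination h5 + h + h0
    · right; linear_combination h5 - h
  · exfalso; push_cast at h0
    have : (2 : k) = 0 := by
      have : (2 : k) ^ 3 = 0 := by linear_combination h0
      exact pow_eq_zero_iff (by norm_num) |>.1 this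
    have h3 : w ^ 3 = 1 := by linear_combination (w - 1) * hw
    have h8 : w ^ 8 = w ^ 2 := by linear_combination w ^ 2 * (w ^ 3 + 1) * h3
    have h9 : w ^ 2 = w := h8.symm.trans hwq
    have : (1:k) = 0 := by linear_combination hw - h9 - w * this
    exact one_ne_zero this

namespace ShData
variable {K : Type*} [Field K] [NumberField K] {σ : K ≃ₐ[ℚ] K} {z w : 𝓞 K}

theorem norm_theta' (D : ShData K σ z w) : (Algebra.norm ℤ (z + (-1 - w))) = 7 := by
  rw [← D.norm_theta, ← Algebra.norm_eq_of_algEquiv (gR (σ ^ 3)) (z + w), map_add (gR (σ ^ 3)), D.z3, D.w3]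

theorem pid_aux (θ : 𝓞 K) (hθ : Algebra.norm ℤ θ = 7) (Q : Ideal (𝓞 K)) (hQ : Q.IsPrime) (h : θ ∈ Q) :
    Q = Ideal.span {θ} := by
  have h1 : Ideal.absNorm (Ideal.span {θ}) = 7 := by
    rw [Ideal.absNorm_span_singleton, hθ]; rfl
  have h2 : (Ideal.span {θ}).IsPrime := by
    apply Ideal.isPrime_of_irreducible_absNorm
    rw [h1]
    exact Nat.prime_iff.1 (by norm_num) |>.irreducible
  have h3 : (Ideal.span {θ}).IsMaximal := h2.isMaximal (by
    intro h; rw [h] at h1; simp at h1)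
  exact (h3.eq_of_le hQ.ne_top ((Ideal.span_singleton_le_iff_mem _).2 h)).symm

theorem pid (D : ShData K σ z w) : IsPrincipalIdealRing (𝓞 K) := by
  apply RingOfIntegers.isPrincipalIdealRing_of_isPrincipal_of_norm_le_of_isPrime
  intro ⟨Q, hQ0⟩ hQ hn
  simp only at hQ hn ⊢
  have hn9 : Ideal.absNorm Q < 9 := by
    have := hn.trans_lt D.minkowski
    exact_mod_cast this
  have hQb : Q ≠ ⊥ := by
    have := nonZeroDivisors.ne_zero hQ0
    simpa using this
  have hmax := hQ.isMaximal hQb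
  letI := Ideal.Quotient.field Q
  have hfin : Finite (𝓞 K ⧸ Q) := Ideal.finiteQuotientOfFreeOfNeBot Q hQb
  letI := Fintype.ofFinite (𝓞 K ⧸ Q)
  have hcard : Ideal.absNorm Q = Fintype.card (𝓞 K ⧸ Q) := by
    rw [Ideal.absNorm_apply, Submodule.cardQuot_apply, Nat.card_eq_fintype_card]
  have hp : ∀ x : 𝓞 K ⧸ Q, x ^ Ideal.absNorm Q = x := by
    intro x; rw [hcard]; exact FiniteField.pow_card x
  have h1 : 1 < Ideal.absNorm Q := by rw [hcard]; exact Fintype.one_lt_card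
  have h0 : ((Ideal.absNorm Q : ℕ) : 𝓞 K ⧸ Q) = 0 := by rw [hcard]; exact Nat.cast_card_eq_zero _
  have hz := congrArg (Ideal.Quotient.mk Q) D.hz
  have hw := congrArg (Ideal.Quotient.mk Q) D.hw
  simp only [map_pow, map_add, map_sub, map_mul, map_ofNat, map_one, map_neg] at hz hw
  rcases small_field _ _ _ h1 hn9 h0 hz hw (hp _) (hp _) with h | h
  · rw [pid_aux _ D.norm_theta Q hQ (Ideal.Quotient.eq_zero_iff_mem.1 (by simpa using h))]
    exact ⟨_, rfl⟩
  · rw [pid_aux _ D.norm_theta' Q hQ (Ideal.Quotient.eq_zero_iff_mem.1 (by simpa using h))]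
    exact ⟨_, rfl⟩

end ShData

theorem zm7_z : ∀ t : ZMod 7, t ^ 3 = t ^ 2 + 2 * t - 1 → t = 5 := by decide
theorem zm7_t : ((2 : ZMod 7) - 5 ^ 2 + 2) = 0 := by decide
theorem zm7_w : ∀ t : ZMod 7, 5 + t = 0 → t = 2 := by decide

/-- the norm form of the cubic field -/
def nF {R : Type*} [CommRing R] (a b c : R) : R :=
  a ^ 3 + a ^ 2 * b + 5 * a ^ 2 * c - 2 * a * b ^ 2 + a * b * c + 6 * a * c ^ 2 - b ^ 3 - b ^ 2 * c
    + 2 * b * c ^ 2 + c ^ 3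

theorem nF_eq {R : Type*} [CommRing R] (z a b c : R) (hz : z ^ 3 = z ^ 2 + 2 * z - 1) :
    (a + b * z + c * z ^ 2) * (a + b * (2 - z ^ 2) + c * (2 - z ^ 2) ^ 2) *
      (a + b * (z ^ 2 - z - 1) + c * (z ^ 2 - z - 1) ^ 2) = nF a b c := by
  unfold nF
  linear_combination ((-1)*z^0*a^0*b^0*c^3 + (-2)*z^0*a^0*b^1*c^2 + (1)*z^0*a^0*b^2*c^1 + (1)*z^0*a^0*b^3*c^0 + (-2)*z^0*a^1*b^0*c^2 + (-3)*z^0*a^1*b^1*c^1 + (-2)*z^1*a^0*b^0*c^3 + (4)*z^1*a^1*b^0*c^2 + (-1)*z^1*a^1*b^1*c^1 + (-1)*z^1*a^1*b^2*c^0 + (2)*z^1*a^2*b^0*c^1 + (-1)*z^2*a^0*b^0*c^3 + (4)*z^2*a^0*b^1*c^2 + (-1)*z^2*a^0*b^2*c^1 + (-1)*z^2*a^0*b^3*c^0 + (3)*z^2*a^1*b^0*c^2 + (3)*z^2*a^1*b^1*c^1 + (5)*z^3*a^0*b^0*c^3 + (2)*z^3*a^0*b^1*c^2 + (-2)*z^3*a^1*b^0*c^2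 + (3)*z^4*a^0*b^0*c^3 + (-3)*z^4*a^0*b^1*c^2 + (-1)*z^4*a^1*b^0*c^2 + (-4)*z^5*a^0*b^0*c^3 + (-1)*z^5*a^0*b^1*c^2 + (1)*z^5*a^1*b^0*c^2 + (-1)*z^6*a^0*b^0*c^3 + (1)*z^6*a^0*b^1*c^2 + (1)*z^7*a^0*b^0*c^3) * hz

theorem sh_dvd_prod {R : Type*} [CommRing R] {β x1 x2 x3 y1 y2 y3 : R} (h1 : β ∣ x1 - y1)
    (h2 : β ∣ x2 - y2) (h3 : β ∣ x3 - y3) : β ∣ x1 * x2 * x3 - y1 * y2 * y3 := by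
  have : x1 * x2 * x3 - y1 * y2 * y3 = (x1 - y1) * (x2 * x3) + (x2 - y2) * (y1 * x3)
      + (x3 - y3) * (y1 * y2) := by ring
  rw [this]
  exact dvd_add (dvd_add (h1.mul_right _) (h2.mul_right _)) (h3.mul_right _)

namespace ShData
variable {K : Type*} [Field K] [NumberField K] {σ : K ≃ₐ[ℚ] K} {z w : 𝓞 K}

theorem pow6 (D : ShData K σ z w) : σ ^ 6 = 1 := by rw [← D.ord]; exact pow_orderOf_eq_one σ

theorem b1 (D : ShData K σ z w) : gR σ (1 + 2 * w) = - (1 + 2 * w) := by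
  rw [map_add, map_mul, map_one, map_ofNat, D.sw]; ring

theorem b_sq (D : ShData K σ z w) : (1 + 2 * w) ^ 2 = -3 := by linear_combination 4 * D.hw

theorem bpow (D : ShData K σ z w) (n : ℕ) : gR (σ ^ n) (1 + 2 * w) = (1 + 2 * w) ∨
    gR (σ ^ n) (1 + 2 * w) = - (1 + 2 * w) := by
  induction n with
  | zero => left; simp [gR]
  | succ n ih =>
    rw [pow_succ', gR_mul]
    rcases ih with h | h
    · right; rw [h, D.b1]
    · left; rw [h, map_neg, D.b1, neg_neg]

theorem dvd_conj (D : ShData K σ z w) (n : ℕ) {x : 𝓞 K} (h : (1 + 2 * w) ∣ x) : (1 + 2 * w) ∣ gR (σ ^ n) x := by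
  have := map_dvd (gR (σ ^ n)) h
  rcases D.bpow n with h | h
  · rwa [h] at this
  · rwa [h, neg_dvd] at this

theorem norm_b (D : ShData K σ z w) : Algebra.norm ℤ (1 + 2 * w) = 27 := by
  have := D.gal
  apply Int.cast_injective (α := 𝓞 K)
  rw [sh_norm D.deg σ D.gen]
  simp only [Finset.prod_range_succ, Finset.prod_range_zero, map_add, map_mul, map_one, map_ofNat,
    D.w0, D.w1, D.w2, D.w3, D.w4, D.w5]
  have h := D.b_sq
  calc _ = - ((1 + 2 * w) ^ 2) ^ 3 := by ring
    _ = _ := by rw [h]; push_cast; ring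

theorem three_dvd (D : ShData K σ z w) (n : ℤ) (h : (1 + 2 * w) ∣ (n : 𝓞 K)) : (3 : ℤ) ∣ n := by
  have h1 := map_dvd (Algebra.norm ℤ) h
  rw [D.norm_b] at h1
  have h2 : Algebra.norm ℤ ((n : ℤ) : 𝓞 K) = n ^ 6 := by
    have := Algebra.norm_algebraMap_of_basis (RingOfIntegers.basis K) n
    rw [← Module.finrank_eq_card_chooseBasisIndex, RingOfIntegers.rank, D.deg] at this
    simpa using this
  rw [h2] at h1
  exact Int.prime_three.dvd_of_dvd_pow ((by norm_num : (3:ℤ) ∣ 27).trans h1)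

theorem T_poly (D : ShData K σ z w) (a b c : ℤ) :
    ((a : 𝓞 K) + (b : 𝓞 K) * z + (c : 𝓞 K) * z ^ 2) * gR (σ ^ 4) ((a : 𝓞 K) + (b : 𝓞 K) * z + (c : 𝓞 K) * z ^ 2) *
      gR (σ ^ 5) ((a : 𝓞 K) + (b : 𝓞 K) * z + (c : 𝓞 K) * z ^ 2) = ((nF a b c : ℤ) : 𝓞 K) := by
  simp only [map_add, map_mul, map_pow, map_intCast, D.z4, D.z5]
  rw [nF_eq _ _ _ _ D.hz]
  simp [nF]

theorem poly_dvd (D : ShData K σ z w) (a b c : ℤ) (h : (1 + 2 * w) ∣ (a : 𝓞 K) + b * z + c * z ^ 2) :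
    (a : ZMod 3) = 0 ∧ (b : ZMod 3) = 0 ∧ (c : ZMod 3) = 0 := by
  have h1 := D.three_dvd (nF a b c) (by
    rw [← D.T_poly]
    exact (h.mul_right _).mul_right _)
  have h2 := (ZMod.intCast_zmod_eq_zero_iff_dvd _ 3).2 (by exact_mod_cast h1)
  simp only [nF] at h2
  push_cast at h2
  generalize (a : ZMod 3) = a at *
  generalize (b : ZMod 3) = b at *
  generalize (c : ZMod 3) = c at *
  revert a b c
  decide

theorem span_mod (D : ShData K σ z w) (x : 𝓞 K) : ∃ a b c : ℤ, (1 + 2 * w) ∣ x - ((a : 𝓞 K) + (b : 𝓞 K) * z + (c : 𝓞 K) * z ^ 2) := by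
  have hb0 : Ideal.span {1 + 2 * w} ≠ ⊥ := by
    intro h
    rw [Ideal.span_singleton_eq_bot] at h
    have := D.norm_b
    rw [h] at this
    have h7 := D.b_sq
    rw [h] at h7; norm_num at h7
  have hfin : Finite (𝓞 K ⧸ Ideal.span {1 + 2 * w}) := Ideal.finiteQuotientOfFreeOfNeBot _ hb0
  letI := Fintype.ofFinite (𝓞 K ⧸ Ideal.span {1 + 2 * w})
  have hcard : Fintype.card (𝓞 K ⧸ Ideal.span {1 + 2 * w}) = 27 := by
    rw [← Nat.card_eq_fintype_card, ← Submodule.cardQuot_apply, ← Ideal.absNorm_apply,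
      Ideal.absNorm_span_singleton, D.norm_b]; rfl
  let f : ZMod 3 × ZMod 3 × ZMod 3 → 𝓞 K ⧸ Ideal.span {1 + 2 * w} := fun t =>
    Ideal.Quotient.mk _ (((t.1.val : ℤ) : 𝓞 K) + ((t.2.1.val : ℤ) : 𝓞 K) * z + ((t.2.2.val : ℤ) : 𝓞 K) * z ^ 2)
  have hinj : Function.Injective f := by
    rintro ⟨a, b, c⟩ ⟨a', b', c'⟩ h
    have h1 := Ideal.mem_span_singleton.1 (Ideal.Quotient.eq.1 h)
    have h2 := D.poly_dvd ((a.val : ℤ) - a'.val) ((b.val : ℤ) - b'.val) ((c.val : ℤ) - c'.val) (by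
      convert h1 using 1
      push_cast
      ring)
    push_cast at h2
    simp only [ZMod.natCast_val, ZMod.cast_id', id_eq, sub_eq_zero] at h2
    obtain ⟨rfl, rfl, rfl⟩ := h2
    rfl
  have hbij : Function.Bijective f := by
    rw [Fintype.bijective_iff_injective_and_card]
    exact ⟨hinj, by rw [hcard]; rfl⟩
  obtain ⟨t, ht⟩ := hbij.2 (Ideal.Quotient.mk _ x)
  exact ⟨_, _, _, Ideal.mem_span_singleton.1 (Ideal.Quotient.eq.1 ht.symm)⟩

theorem T_mod (D : ShData K σ z w) (x : 𝓞 K) : ∃ n : ℤ, (1 + 2 * w) ∣ x * gR (σ ^ 4) x * gR (σ ^ 5) x - n := by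
  obtain ⟨a, b, c, h⟩ := D.span_mod x
  refine ⟨nF a b c, ?_⟩
  rw [← D.T_poly]
  refine sh_dvd_prod h ?_ ?_
  · rw [← map_sub]; exact D.dvd_conj 4 h
  · rw [← map_sub]; exact D.dvd_conj 5 h

theorem T_unit (D : ShData K σ z w) (x y : 𝓞 K) (h : (1 + 2 * w) ∣ x * y - 1) :
    (1 + 2 * w) ∣ x * gR (σ ^ 4) x * gR (σ ^ 5) x - 1 ∨
    (1 + 2 * w) ∣ - (x * gR (σ ^ 4) x * gR (σ ^ 5) x) - 1 := by
  obtain ⟨n, hn⟩ := D.T_mod x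
  obtain ⟨m, hm⟩ := D.T_mod y
  have h1 : (1 + 2 * w) ∣ (x * y) * gR (σ ^ 4) (x * y) * gR (σ ^ 5) (x * y) - 1 * 1 * 1 := by
    refine sh_dvd_prod h ?_ ?_
    · have := D.dvd_conj 4 h
      rwa [map_sub, map_one] at this
    · have := D.dvd_conj 5 h
      rwa [map_sub, map_one] at this
  simp only [map_mul] at h1
  have h2 : (1 + 2 * w) ∣ ((n * m - 1 : ℤ) : 𝓞 K) := by
    have := dvd_sub (dvd_sub h1 (hn.mul_right (y * gR (σ ^ 4) y * gR (σ ^ 5) y))) (hm.mul_left (n : 𝓞 K))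
    convert this using 1
    push_cast; ring
  have h3 := D.three_dvd _ h2
  have hb3 : (1 + 2 * w) ∣ (3 : 𝓞 K) := ⟨-(1 + 2 * w), by linear_combination D.b_sq⟩
  have h4 : (3 : ℤ) ∣ n - 1 ∨ (3 : ℤ) ∣ - n - 1 := by
    have h5 : ((n * m - 1 : ℤ) : ZMod 3) = 0 := (ZMod.intCast_zmod_eq_zero_iff_dvd _ 3).2 (by exact_mod_cast h3)
    have h6 : ((n - 1 : ℤ) : ZMod 3) = 0 ∨ ((- n - 1 : ℤ) : ZMod 3) = 0 := by
      push_cast at *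
      generalize (n : ZMod 3) = n at *
      generalize (m : ZMod 3) = m at *
      revert n m; decide
    rcases h6 with h6 | h6
    · left; exact_mod_cast (ZMod.intCast_zmod_eq_zero_iff_dvd _ 3).1 h6
    · right; exact_mod_cast (ZMod.intCast_zmod_eq_zero_iff_dvd _ 3).1 h6
  rcases h4 with ⟨k, hk⟩ | ⟨k, hk⟩
  · left
    have hk' : (n : 𝓞 K) - 1 = 3 * k := by exact_mod_cast congrArg (Int.cast : ℤ → 𝓞 K) hk
    have := dvd_add hn (hb3.mul_right (k : 𝓞 K))
    rw [← hk'] at this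
    simpa using this
  · right
    have hk' : - (n : 𝓞 K) - 1 = 3 * k := by exact_mod_cast congrArg (Int.cast : ℤ → 𝓞 K) hk
    have := dvd_sub (hb3.mul_right (k : 𝓞 K)) hn
    rw [← hk'] at this
    convert this using 1
    ring

/-- reduction modulo a prime above 7 -/
theorem exists_pi (D : ShData K σ z w) : ∃ π : 𝓞 K →+* ZMod 7, π z = 5 ∧ π w = 2 ∧
    ∀ x, π (gR (σ ^ 4) x) = π x := by
  have hp : Nat.Prime 7 := by norm_num
  have : Fact (Nat.Prime 7) := ⟨hp⟩
  have hb0 : Ideal.span {z + w} ≠ ⊥ := by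
    intro h
    rw [Ideal.span_singleton_eq_bot] at h
    have h2 := D.norm_theta
    have := Algebra.norm_zero (R := ℤ) (S := 𝓞 K)
    rw [h, this] at h2
    norm_num at h2
  have hfin : Finite (𝓞 K ⧸ Ideal.span {z + w}) := Ideal.finiteQuotientOfFreeOfNeBot _ hb0
  letI := Fintype.ofFinite (𝓞 K ⧸ Ideal.span {z + w})
  have hcard : Fintype.card (𝓞 K ⧸ Ideal.span {z + w}) = 7 := by
    rw [← Nat.card_eq_fintype_card, ← Submodule.cardQuot_apply, ← Ideal.absNorm_apply,
      Ideal.absNorm_span_singleton, D.norm_theta]; rfl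
  let e := ZMod.ringEquivOfPrime (𝓞 K ⧸ Ideal.span {z + w}) hp hcard
  let π : 𝓞 K →+* ZMod 7 := (e.symm.toRingHom).comp (Ideal.Quotient.mk _)
  have hπ : ∀ x, π x = 0 → (z + w) ∣ x := by
    intro x hx
    have : Ideal.Quotient.mk (Ideal.span {z + w}) x = 0 := by
      simpa [π] using hx
    exact Ideal.mem_span_singleton.1 (Ideal.Quotient.eq_zero_iff_mem.1 this)
  have hθ : π (z + w) = 0 := by
    have : Ideal.Quotient.mk (Ideal.span {z + w}) (z + w) = 0 :=
      Ideal.Quotient.eq_zero_iff_mem.2 (Ideal.mem_span_singleton_self _)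
    simp only [π, RingHom.comp_apply, this, map_zero]
  have hz : π z = 5 := by
    have := congrArg π D.hz
    simp only [map_pow, map_add, map_sub, map_mul, map_ofNat, map_one] at this
    exact zm7_z _ this
  have hw : π w = 2 := by
    rw [map_add, hz] at hθ
    exact zm7_w _ hθ
  refine ⟨π, hz, hw, fun x => ?_⟩
  obtain ⟨c, hc⟩ := hπ (x - ((π x).val : 𝓞 K)) (by simp)
  have h1 : x = ((π x).val : 𝓞 K) + (z + w) * c := by linear_combination hc
  conv_lhs => rw [h1]
  rw [map_add, map_natCast, map_mul, map_add (gR (σ ^ 4)) z w, D.z4, D.w4]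
  simp only [map_add, map_mul, map_sub, map_ofNat, map_pow, hz, hw, map_natCast]
  rw [zm7_t]
  simp

end ShData

theorem zm7_a : ∀ a b : ZMod 7, a ≠ 0 → b ≠ 0 → ∃ j : Fin 3,
    (2 ^ (j : ℕ) * (a * a * b)) ^ 2 = 1 ∧ (4 ^ (j : ℕ) * (b * b * a)) ^ 2 = 1 := by decide

namespace ShData
variable {K : Type*} [Field K] [NumberField K] {σ : K ≃ₐ[ℚ] K} {z w : 𝓞 K}

theorem conj_eq (D : ShData K σ z w) (φ : K →+* ℂ) (x : K) : (starRingEnd ℂ) (φ x) = φ ((σ ^ 3) x) := by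
  have := D.gal
  obtain ⟨τ, hτ⟩ := ComplexEmbedding.exists_comp_symm_eq_of_comp_eq (k := ℚ) φ
    ((starRingEnd ℂ).comp φ) (by ext; simp)
  have h1 : ∀ x, (starRingEnd ℂ) (φ x) = φ (τ⁻¹ x) := fun x => (RingHom.congr_fun hτ x).symm
  have h2 : τ⁻¹ * τ⁻¹ = 1 := by
    ext x
    apply φ.injective
    change φ (τ⁻¹ (τ⁻¹ x)) = φ x
    rw [← h1, ← h1, Complex.conj_conj]
  have h3 : τ⁻¹ ≠ 1 := by
    intro h
    have h4 := h1 ((1 + 2 * w : 𝓞 K) : K)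
    rw [h] at h4
    obtain ⟨r, hr⟩ := Complex.conj_eq_iff_real.1 h4
    have h5 := congrArg (fun x : 𝓞 K => φ x) D.b_sq
    simp only [map_pow] at h5
    rw [hr] at h5
    have h6 : ((r ^ 2 : ℝ) : ℂ) = ((-3 : ℝ) : ℂ) := by
      push_cast; rw [h5]; simp; rw [map_ofNat, map_ofNat]
    have := Complex.ofReal_injective h6
    nlinarith [sq_nonneg r]
  obtain ⟨i, hi, hi'⟩ : ∃ i < 6, σ ^ i = τ⁻¹ := by
    have := D.gen τ⁻¹
    rw [← mem_powers_iff_mem_zpowers, Submonoid.mem_powers_iff] at this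
    obtain ⟨n, hn⟩ := this
    refine ⟨n % 6, Nat.mod_lt _ (by norm_num), ?_⟩
    rw [← hn]
    conv_rhs => rw [← pow_mod_orderOf, D.ord]
  rw [h1, ← hi']
  rw [← hi', ← pow_add] at h2
  rw [← hi'] at h3
  have h7 := orderOf_dvd_of_pow_eq_one h2
  rw [D.ord] at h7
  have : i ≠ 0 := by rintro rfl; simp at h3
  have : i = 3 := by omega
  rw [this]

theorem nonneg (D : ShData K σ z w) (y : 𝓞 K) (n : ℤ) (h : y * gR (σ ^ 3) y = n) : 0 ≤ n := by
  obtain ⟨φ⟩ : Nonempty (K →+* ℂ) := inferInstance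
  have h1 := congrArg (fun x : 𝓞 K => φ x) h
  simp only [map_mul, gR_coe, map_intCast] at h1
  rw [← D.conj_eq, Complex.mul_conj] at h1
  have h2 : ((Complex.normSq (φ y) : ℝ)) = ((n : ℤ) : ℝ) := by
    exact_mod_cast h1
  have h3 := Complex.normSq_nonneg (φ y)
  rw [h2] at h3
  exact_mod_cast h3

theorem T_norm (D : ShData K σ z w) (x : 𝓞 K) :
    (x * gR (σ ^ 4) x * gR (σ ^ 5) x) * gR (σ ^ 3) (x * gR (σ ^ 4) x * gR (σ ^ 5) x) =
      ((Ideal.absNorm (Ideal.span {x}) : ℕ) : 𝓞 K) := by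
  have := D.gal
  have h : (x * gR (σ ^ 4) x * gR (σ ^ 5) x) * gR (σ ^ 3) (x * gR (σ ^ 4) x * gR (σ ^ 5) x) =
      ((Algebra.norm ℤ x : ℤ) : 𝓞 K) := by
    rw [sh_norm D.deg σ D.gen]
    simp only [Finset.prod_range_succ, Finset.prod_range_zero, map_mul]
    rw [← gR_mul, ← gR_mul, ← pow_add, ← pow_add, show σ ^ (3 + 4) = σ ^ 1 by
      rw [show 3 + 4 = 6 + 1 from rfl, pow_add, D.pow6, one_mul], show σ ^ (3 + 5) = σ ^ 2 by
      rw [show 3 + 5 = 6 + 2 from rfl, pow_add, D.pow6, one_mul]]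
    have : gR (σ ^ 0) x = x := by simp [gR]
    rw [this]
    ring
  rw [h, Ideal.absNorm_span_singleton]
  have h2 := D.nonneg _ _ h
  rw [← Int.cast_natCast, Int.natAbs_of_nonneg h2]

theorem unit_eq_one (D : ShData K σ z w) (π : 𝓞 K →+* ZMod 7) (hw : π w = 2) (v : 𝓞 K) (hv : v * gR (σ ^ 3) v = 1)
    (hb : (1 + 2 * w) ∣ v - 1) (hπ : π v ^ 2 = 1) : v = 1 := by
  obtain ⟨n, hn, hvn⟩ := Embeddings.pow_eq_one_of_norm_eq_one K ℂ (x := (v : K)) v.isIntegral_coe (by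
    intro φ
    have h1 := congrArg (fun x : 𝓞 K => φ x) hv
    simp only [map_mul, gR_coe, map_one] at h1
    rw [← D.conj_eq, Complex.mul_conj] at h1
    have h2 : Complex.normSq (φ v) = 1 := by exact_mod_cast h1
    rw [Complex.normSq_eq_norm_sq] at h2
    exact (pow_eq_one_iff_of_nonneg (norm_nonneg _) two_ne_zero).1 h2)
  have hvn' : v ^ n = 1 := by
    apply RingOfIntegers.ext
    simpa using hvn
  by_contra hne
  have hm0 : orderOf v ≠ 0 := (orderOf_pos_iff.2 (isOfFinOrder_iff_pow_eq_one.2 ⟨n, hn, hvn'⟩)).ne'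
  have hm1 : orderOf v ≠ 1 := fun h => hne (orderOf_eq_one_iff.1 h)
  obtain ⟨p, hp, hpm⟩ := Nat.exists_prime_and_dvd hm1
  have hord := orderOf_pow_orderOf_div hm0 hpm
  set k := orderOf v / p with hk
  obtain ⟨u, hu⟩ : ∃ u, u = v ^ k := ⟨_, rfl⟩
  rw [← hu] at hord
  have hbu : (1 + 2 * w) ∣ u - 1 := by
    rw [hu]
    have := sub_dvd_pow_sub_pow v 1 k
    rw [one_pow] at this
    exact hb.trans this
  have hπu : π u ^ 2 = 1 := by
    rw [hu, map_pow, ← pow_mul, mul_comm, pow_mul, hπ, one_pow]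
  have hup : u ^ p = 1 := by rw [← hord]; exact pow_orderOf_eq_one u
  have hu1 : u ≠ 1 := by
    intro h; rw [h, orderOf_one] at hord; exact hp.one_lt.ne hord
  have hgeom : ∑ i ∈ Finset.range p, u ^ i = 0 := by
    have := mul_geom_sum u p
    rw [hup, sub_self] at this
    exact (mul_eq_zero.1 this).resolve_left (sub_ne_zero.2 hu1)
  have hpd : (1 + 2 * w) ∣ ((p : ℤ) : 𝓞 K) := by
    have h1 : (u - 1) ∣ ∑ i ∈ Finset.range p, (u ^ i - 1) := by
      apply Finset.dvd_sum
      intro i _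
      have := sub_dvd_pow_sub_pow u 1 i
      rwa [one_pow] at this
    rw [Finset.sum_sub_distrib, hgeom] at h1
    simp at h1
    simpa using hbu.trans h1
  have h3 := D.three_dvd _ hpd
  have hp3 : p = 3 := ((Nat.prime_dvd_prime_iff_eq Nat.prime_three hp).1 (by exact_mod_cast h3)).symm
  rw [hp3] at hgeom
  simp only [Finset.sum_range_succ, Finset.sum_range_zero] at hgeom
  have h4 : (u - w) * (u - (-1 - w)) = 0 := by linear_combination hgeom - D.hw
  rcases mul_eq_zero.1 h4 with h | h
  · rw [sub_eq_zero.1 h, hw] at hπu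
    revert hπu; decide
  · rw [sub_eq_zero.1 h, map_sub, map_neg, map_one, hw] at hπu
    revert hπu; decide

end ShData

theorem idealConj_span {K : Type*} [Field K] [NumberField K] (τ : K ≃ₐ[ℚ] K) (x : 𝓞 K) :
    idealConj τ (Ideal.span {x}) = Ideal.span {gR τ x} := by
  unfold idealConj
  rw [Ideal.map_span, Set.image_singleton]
  rfl

theorem idealConj_mul {K : Type*} [Field K] [NumberField K] (τ : K ≃ₐ[ℚ] K) (I J : Ideal (𝓞 K)) :
    idealConj τ (I * J) = idealConj τ I * idealConj τ J := by
  unfold idealConj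
  rw [Ideal.map_mul]

theorem zm7_b : ∀ a b : ZMod 7, a ≠ 0 → b ≠ 0 → ∃ j : Fin 3,
    (2 ^ (j : ℕ) * (a * a * b)) ^ 2 = 1 ∧ ((-1 - 2) ^ (j : ℕ) * (b * b * a)) ^ 2 = 1 := by decide

theorem zm7_d : (0 : ZMod 7) ≠ 1 := by decide

theorem zm7_c : (21 : ZMod 7) = 0 := by decide

/-- The condition that pins down the value of the character at an ideal. -/
structure ShC {K : Type*} [Field K] [NumberField K] (σ : K ≃ₐ[ℚ] K) (w : 𝓞 K)
    (π : 𝓞 K →+* ZMod 7) (I : Ideal (𝓞 K)) (W : 𝓞 K) : Prop where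
  span : Ideal.span {W} = I * idealConj (σ ^ 4) I * idealConj (σ ^ 5) I
  norm : W * gR (σ ^ 3) W = ((Ideal.absNorm I : ℕ) : 𝓞 K)
  mod3 : (1 + 2 * w) ∣ W - 1
  mod7 : π W ^ 2 = 1
  mod7' : π (gR (σ ^ 3) W) ^ 2 = 1

namespace ShData
variable {K : Type*} [Field K] [NumberField K] {σ : K ≃ₐ[ℚ] K} {z w : 𝓞 K}

theorem b_dvd (D : ShData K σ z w) : (1 + 2 * w) ∣ (21 : 𝓞 K) := ⟨-7 * (1 + 2 * w), by linear_combination 7 * D.b_sq⟩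

theorem g33 (D : ShData K σ z w) (x : 𝓞 K) : gR (σ ^ 3) (gR (σ ^ 3) x) = x := by
  rw [← gR_mul, ← pow_add, D.pow6]; simp [gR]

theorem g34 (x : 𝓞 K) : gR (σ ^ 3) (gR (σ ^ 4) x) = gR (σ ^ 4) (gR (σ ^ 3) x) := by
  rw [← gR_mul, ← gR_mul, ← pow_add, ← pow_add]

theorem g35 (x : 𝓞 K) : gR (σ ^ 3) (gR (σ ^ 5) x) = gR (σ ^ 5) (gR (σ ^ 3) x) := by
  rw [← gR_mul, ← gR_mul, ← pow_add, ← pow_add]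

theorem g5 (D : ShData K σ z w) (x : 𝓞 K) : gR (σ ^ 5) x = gR (σ ^ 4) (gR (σ ^ 4) (gR (σ ^ 3) x)) := by
  rw [← gR_mul, ← gR_mul, ← pow_add, ← pow_add, show σ ^ (4 + (4 + 3)) = σ ^ 5 by
    rw [show 4 + (4 + 3) = 6 + 5 from rfl, pow_add, D.pow6, one_mul]]

theorem ex_gen (D : ShData K σ z w) (I : Ideal (𝓞 K)) : ∃ s, I = Ideal.span {s} := by
  have := D.pid
  exact ⟨_, (Ideal.span_singleton_generator I).symm⟩

theorem piT (D : ShData K σ z w) {π : 𝓞 K →+* ZMod 7} (h4 : ∀ x, π (gR (σ ^ 4) x) = π x) (s : 𝓞 K) :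
    π (s * gR (σ ^ 4) s * gR (σ ^ 5) s) = π s * π s * π (gR (σ ^ 3) s) := by
  rw [map_mul, map_mul, h4, D.g5, h4, h4]

theorem piT' (D : ShData K σ z w) {π : 𝓞 K →+* ZMod 7} (h4 : ∀ x, π (gR (σ ^ 4) x) = π x) (s : 𝓞 K) :
    π (gR (σ ^ 3) (s * gR (σ ^ 4) s * gR (σ ^ 5) s)) =
      π (gR (σ ^ 3) s) * π (gR (σ ^ 3) s) * π s := by
  rw [map_mul (gR (σ ^ 3)), map_mul (gR (σ ^ 3)), g34, g35, D.piT h4, D.g33]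

theorem C_exists (D : ShData K σ z w) {π : 𝓞 K →+* ZMod 7} (hw : π w = 2) (h4 : ∀ x, π (gR (σ ^ 4) x) = π x)
    (I : Ideal (𝓞 K)) (hI : IsCoprime I (Ideal.span {21})) : ∃ W, ShC σ w π I W := by
  obtain ⟨s, rfl⟩ := D.ex_gen I
  rw [Ideal.isCoprime_span_singleton_iff] at hI
  obtain ⟨t, r, h⟩ := hI
  have hb : (1 + 2 * w) ∣ s * t - 1 := by
    rw [show s * t - 1 = 21 * (-r) by linear_combination h]
    exact D.b_dvd.mul_right _
  have h1 : π s ≠ 0 := by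
    intro h0
    have := congrArg π h
    rw [map_add, map_mul, map_mul, h0, map_ofNat, zm7_c, map_one] at this
    rw [mul_zero, mul_zero, add_zero] at this
    exact zm7_d this
  have h2 : π (gR (σ ^ 3) s) ≠ 0 := by
    intro h0
    have := congrArg (fun x => π (gR (σ ^ 3) x)) h
    simp only [map_add, map_mul, h0, map_ofNat, zm7_c, map_one] at this
    rw [mul_zero, mul_zero, add_zero] at this
    exact zm7_d this
  obtain ⟨j, hj, hj'⟩ := zm7_b _ _ h1 h2
  obtain ⟨e, he, he2, heb⟩ : ∃ e : 𝓞 K, (e = 1 ∨ e = -1) ∧ e * e = 1 ∧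
      (1 + 2 * w) ∣ e * (s * gR (σ ^ 4) s * gR (σ ^ 5) s) - 1 := by
    rcases D.T_unit s t hb with h | h
    · exact ⟨1, Or.inl rfl, by ring, by rwa [one_mul]⟩
    · exact ⟨-1, Or.inr rfl, by ring, by rwa [neg_one_mul]⟩
  have heρ : gR (σ ^ 3) e = e := by rcases he with rfl | rfl <;> simp
  have heπ : π e ^ 2 = 1 := by rw [← map_pow, pow_two, he2, map_one]
  have hwb : (1 + 2 * w) ∣ w ^ (j : ℕ) - 1 := by
    have h3 := sub_dvd_pow_sub_pow w 1 (j : ℕ)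
    rw [one_pow] at h3
    refine Dvd.dvd.trans ⟨1 + w, ?_⟩ h3
    linear_combination -2 * D.hw
  have hww : w ^ (j : ℕ) * (-1 - w) ^ (j : ℕ) = 1 := by
    rw [← mul_pow, show w * (-1 - w) = 1 by linear_combination -D.hw, one_pow]
  refine ⟨e * w ^ (j : ℕ) * (s * gR (σ ^ 4) s * gR (σ ^ 5) s), ?_, ?_, ?_, ?_, ?_⟩
  · rw [idealConj_span, idealConj_span, Ideal.span_singleton_mul_span_singleton,
      Ideal.span_singleton_mul_span_singleton, Ideal.span_singleton_eq_span_singleton]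
    have hu : IsUnit (e * w ^ (j : ℕ)) :=
      IsUnit.of_mul_eq_one (e * (-1 - w) ^ (j : ℕ)) (by linear_combination e * e * hww + he2)
    exact associated_unit_mul_left _ _ hu
  · rw [← D.T_norm, map_mul, map_mul, map_pow, heρ, D.w3]
    linear_combination (s * gR (σ ^ 4) s * gR (σ ^ 5) s *
      gR (σ ^ 3) (s * gR (σ ^ 4) s * gR (σ ^ 5) s)) * (e * e * hww + he2)
  · rw [show e * w ^ (j : ℕ) * (s * gR (σ ^ 4) s * gR (σ ^ 5) s) - 1 =
      (w ^ (j : ℕ) - 1) * (e * (s * gR (σ ^ 4) s * gR (σ ^ 5) s)) +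
        (e * (s * gR (σ ^ 4) s * gR (σ ^ 5) s) - 1) by ring]
    exact dvd_add (hwb.mul_right _) heb
  · rw [map_mul, map_mul, map_pow, D.piT h4, hw, mul_assoc, mul_pow, heπ, hj, one_mul]
  · rw [map_mul, map_mul, map_mul, map_mul, map_pow, heρ, D.piT' h4, D.w3, map_pow, map_sub,
      map_neg, map_one, hw, mul_assoc, mul_pow, heπ, hj', one_mul]

theorem C_unique (D : ShData K σ z w) {π : 𝓞 K →+* ZMod 7} (hw : π w = 2)
    {I : Ideal (𝓞 K)} (hI : I ≠ ⊥) {W W' : 𝓞 K} (h : ShC σ w π I W) (h' : ShC σ w π I W') :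
    W = W' := by
  have h1 := h.span.trans h'.span.symm
  rw [Ideal.span_singleton_eq_span_singleton] at h1
  obtain ⟨u, hu⟩ := h1
  have hN : ((Ideal.absNorm I : ℕ) : 𝓞 K) ≠ 0 := by
    rw [Nat.cast_ne_zero]
    exact Ideal.absNorm_ne_zero_iff_mem_nonZeroDivisors.2 (mem_nonZeroDivisors_of_ne_zero hI)
  have hu1 : (u : 𝓞 K) = 1 := by
    refine D.unit_eq_one π hw u ?_ ?_ ?_
    · have h2 := h'.norm
      rw [← hu, map_mul] at h2
      apply mul_left_cancel₀ hN
      rw [mul_one]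
      conv_rhs => rw [← h2]
      rw [← h.norm]; ring
    · have h2 := h'.mod3
      rw [← hu] at h2
      have h3 := dvd_sub h2 (h.mod3.mul_right (u : 𝓞 K))
      rwa [show W * (u : 𝓞 K) - 1 - (W - 1) * u = u - 1 by ring] at h3
    · have h2 := h'.mod7
      rwa [← hu, map_mul, mul_pow, h.mod7, one_mul] at h2
  rw [← hu, hu1, mul_one]

theorem C_mul (D : ShData K σ z w) {π : 𝓞 K →+* ZMod 7}
    {I J : Ideal (𝓞 K)} {W W' : 𝓞 K} (h : ShC σ w π I W) (h' : ShC σ w π J W') :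
    ShC σ w π (I * J) (W * W') := by
  refine ⟨?_, ?_, ?_, ?_, ?_⟩
  · rw [idealConj_mul, idealConj_mul, ← Ideal.span_singleton_mul_span_singleton, h.span, h'.span]
    ring
  · rw [map_mul, map_mul, Nat.cast_mul, ← h.norm, ← h'.norm]; ring
  · rw [show W * W' - 1 = (W - 1) * W' + (W' - 1) by ring]
    exact dvd_add (h.mod3.mul_right _) h'.mod3
  · rw [map_mul, mul_pow, h.mod7, h'.mod7, one_mul]
  · rw [map_mul, map_mul, mul_pow, h.mod7', h'.mod7', one_mul]

theorem C_conj (D : ShData K σ z w) {π : 𝓞 K →+* ZMod 7}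
    {I : Ideal (𝓞 K)} {W : 𝓞 K} (h : ShC σ w π I W) :
    ShC σ w π (idealConj (σ ^ 3) I) (gR (σ ^ 3) W) := by
  have hsp := h.span
  have hn := h.norm
  obtain ⟨s, rfl⟩ := D.ex_gen I
  refine ⟨?_, ?_, ?_, ?_, ?_⟩
  · rw [← idealConj_span, hsp]
    simp only [idealConj_mul, idealConj_span, g34, g35]
  · rw [D.g33, mul_comm, hn, ← D.T_norm, idealConj_span, ← D.T_norm]
    simp only [map_mul, D.g33, g34, g35]
    ring
  · rw [show gR (σ ^ 3) W - 1 = gR (σ ^ 3) (W - 1) by rw [map_sub, map_one]]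
    exact D.dvd_conj 3 h.mod3
  · exact h.mod7'
  · rw [D.g33]; exact h.mod7

theorem C_one (D : ShData K σ z w) {π : 𝓞 K →+* ZMod 7} (h4 : ∀ x, π (gR (σ ^ 4) x) = π x)
    (s : 𝓞 K) (hs : s - 1 ∈ Ideal.span {(21 : 𝓞 K)}) :
    ShC σ w π (Ideal.span {s}) (s * gR (σ ^ 4) s * gR (σ ^ 5) s) := by
  rw [Ideal.mem_span_singleton] at hs
  obtain ⟨r, hr⟩ := hs
  have hs : s = 1 + 21 * r := by linear_combination hr
  have hb : (1 + 2 * w) ∣ s - 1 := hr ▸ D.b_dvd.mul_right _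
  have h1 : π s = 1 := by rw [hs]; simp only [map_add, map_mul, map_one, map_ofNat, zm7_c, zero_mul, add_zero]
  have h2 : π (gR (σ ^ 3) s) = 1 := by rw [hs]; simp only [map_add, map_mul, map_one, map_ofNat, zm7_c, zero_mul, add_zero]
  refine ⟨?_, D.T_norm s, ?_, ?_, ?_⟩
  · simp only [idealConj_span, Ideal.span_singleton_mul_span_singleton]
  · have h5 : ∀ n, (1 + 2 * w) ∣ gR (σ ^ n) s - 1 := by
      intro n
      have := D.dvd_conj n hb
      rwa [map_sub, map_one] at this
    have := sh_dvd_prod hb (h5 4) (h5 5)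
    rwa [one_mul, one_mul] at this
  · rw [D.piT h4, h1, h2]; simp
  · rw [D.piT' h4, h1, h2]; simp

end ShData

theorem ff_three {k : Type*} [Field k] [Finite k] (x : k) (h : x ^ 3 = 1) (h1 : x ≠ 1) :
    3 ∣ Nat.card k - 1 := by
  letI := Fintype.ofFinite k
  rw [← orderOf_eq_prime (p := 3) h h1, Nat.card_eq_fintype_card]
  apply orderOf_dvd_of_pow_eq_one
  apply FiniteField.pow_card_sub_one_eq_one
  rintro rfl
  norm_num at h

theorem ff_root {k k' : Type*} [Field k] [Finite k] [Field k'] (f : k →+* k') (x : k')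
    (hx : x ^ 2 = -1 - x) (h3 : 3 ∣ Nat.card k - 1) : ∃ a, f a = x := by
  letI := Fintype.ofFinite k
  classical
  rw [Nat.card_eq_fintype_card, ← Fintype.card_units] at h3
  have : Fact (Nat.Prime 3) := ⟨Nat.prime_three⟩
  obtain ⟨u, hu⟩ := exists_prime_orderOf_dvd_card 3 h3
  have hu3 : (u : k) ^ 3 = 1 := by
    have := pow_orderOf_eq_one u
    rw [hu] at this
    rw [← Units.val_pow_eq_pow_val, this, Units.val_one]
  have hu1 : (u : k) ≠ 1 := by
    intro h
    rw [Units.val_eq_one] at h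
    rw [h, orderOf_one] at hu
    norm_num at hu
  have hq : (u : k) ^ 2 + u + 1 = 0 := by
    have : ((u : k) - 1) * ((u : k) ^ 2 + u + 1) = 0 := by linear_combination hu3
    exact (mul_eq_zero.1 this).resolve_left (sub_ne_zero.2 hu1)
  have hq' := congrArg f hq
  simp only [map_add, map_pow, map_one, map_zero] at hq'
  have : (x - f u) * (x - (-1 - f u)) = 0 := by linear_combination hx - hq'
  rcases mul_eq_zero.1 this with h | h
  · exact ⟨u, (sub_eq_zero.1 h).symm⟩
  · exact ⟨-1 - u, by rw [map_sub, map_neg, map_one]; exact (sub_eq_zero.1 h).symm⟩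

namespace ShData
variable {K : Type*} [Field K] [NumberField K] {σ : K ≃ₐ[ℚ] K} {z w : 𝓞 K}

theorem finrank_F (D : ShData K σ z w) : Module.finrank (𝓞 (cubicFixedField σ)) (𝓞 K) = 2 := by
  rw [← IsFractionRing.finrank_eq (𝓞 (cubicFixedField σ)) (cubicFixedField σ) (𝓞 K) K]
  have h := IntermediateField.finrank_fixedField_eq_card (F := ℚ) (E := K)
    (Subgroup.zpowers (σ ^ 3))
  rw [Nat.card_zpowers, orderOf_pow, D.ord] at h
  exact h

theorem rho_F (a : 𝓞 (cubicFixedField σ)) :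
    gR (σ ^ 3) (algebraMap (𝓞 (cubicFixedField σ)) (𝓞 K) a) =
      algebraMap (𝓞 (cubicFixedField σ)) (𝓞 K) a := by
  apply RingOfIntegers.ext
  rw [gR_coe]
  exact (a : cubicFixedField σ).2 ⟨σ ^ 3, Subgroup.mem_zpowers _⟩

theorem rho_map (P : Ideal (𝓞 (cubicFixedField σ))) :
    idealConj (σ ^ 3) (P.map (algebraMap (𝓞 (cubicFixedField σ)) (𝓞 K))) =
      P.map (algebraMap (𝓞 (cubicFixedField σ)) (𝓞 K)) := by
  change Ideal.map (gR (σ ^ 3)).toRingHom _ = _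
  rw [Ideal.map_map]
  congr 1
  ext1 a
  exact rho_F a

/-- a prime away from 21 does not contain `√-3` -/
theorem b_not_mem (D : ShData K σ z w) {Q : Ideal (𝓞 K)} (hQ : Q.IsPrime) (h : IsCoprime Q (Ideal.span {21})) :
    1 + 2 * w ∉ Q := by
  intro hb
  apply hQ.ne_top
  have h1 : Ideal.span {(21 : 𝓞 K)} ≤ Q := by
    rw [Ideal.span_singleton_le_iff_mem]
    exact Q.mem_of_dvd D.b_dvd hb
  rw [Ideal.isCoprime_iff_sup_eq, sup_eq_left.2 h1] at h
  exact h

theorem C_F (D : ShData K σ z w) {π : 𝓞 K →+* ZMod 7} (hw : π w = 2) {P : Ideal (𝓞 (cubicFixedField σ))}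
    (h0 : P ≠ ⊥) {W : 𝓞 K}
    (h : ShC σ w π (P.map (algebraMap (𝓞 (cubicFixedField σ)) (𝓞 K))) W) :
    (W = (Nat.card (𝓞 (cubicFixedField σ) ⧸ P) : 𝓞 K) ∧
      (3 : ℤ) ∣ (Nat.card (𝓞 (cubicFixedField σ) ⧸ P) : ℤ) - 1) ∨
    (W = - (Nat.card (𝓞 (cubicFixedField σ) ⧸ P) : 𝓞 K) ∧
      (3 : ℤ) ∣ - (Nat.card (𝓞 (cubicFixedField σ) ⧸ P) : ℤ) - 1) := by
  have h1 : P.map (algebraMap (𝓞 (cubicFixedField σ)) (𝓞 K)) ≠ ⊥ := by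
    rwa [Ne, Ideal.map_eq_bot_iff_of_injective (FaithfulSMul.algebraMap_injective _ _)]
  have h2 := D.C_conj h
  rw [rho_map] at h2
  have h3 := D.C_unique hw h1 h2 h
  have h4 := h.norm
  rw [h3, Ideal.absNorm_algebraMap, D.finrank_F, Ideal.absNorm_apply, Submodule.cardQuot_apply] at h4
  generalize Nat.card (𝓞 (cubicFixedField σ) ⧸ P) = q at *
  have h5 : (W - q) * (W + q) = 0 := by
    push_cast at h4
    linear_combination h4
  have h6 := h.mod3
  rcases mul_eq_zero.1 h5 with h7 | h7
  · left
    rw [sub_eq_zero] at h7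
    refine ⟨h7, D.three_dvd _ ?_⟩
    rw [h7] at h6
    push_cast
    exact h6
  · right
    rw [add_eq_zero_iff_eq_neg] at h7
    refine ⟨h7, D.three_dvd _ ?_⟩
    rw [h7] at h6
    push_cast
    exact h6

theorem card_le {P : Ideal (𝓞 (cubicFixedField σ))} (hP : P.IsPrime) (h0 : P ≠ ⊥)
    {Q : Ideal (𝓞 K)} (hQ : Q.IsPrime) (hQ0 : Q ≠ ⊥)
    (hle : P.map (algebraMap (𝓞 (cubicFixedField σ)) (𝓞 K)) ≤ Q) :
    Nat.card (𝓞 (cubicFixedField σ) ⧸ P) ≤ Nat.card (𝓞 K ⧸ Q) := by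
  have := Ideal.finiteQuotientOfFreeOfNeBot _ hQ0
  have hm := hP.isMaximal h0
  letI := Ideal.Quotient.field P
  have := Ideal.Quotient.nontrivial_iff.2 hQ.ne_top
  exact Nat.card_le_card_of_injective (Ideal.quotientMap Q
    (algebraMap (𝓞 (cubicFixedField σ)) (𝓞 K)) (Ideal.map_le_iff_le_comap.1 hle))
    (RingHom.injective _)

theorem split (D : ShData K σ z w) {P : Ideal (𝓞 (cubicFixedField σ))} (hP : P.IsPrime) (h0 : P ≠ ⊥)
    (hc : IsCoprime (P.map (algebraMap (𝓞 (cubicFixedField σ)) (𝓞 K))) (Ideal.span {21}))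
    {Q₁ Q₂ : Ideal (𝓞 K)} (h1 : Q₁.IsPrime) (h2 : Q₂.IsPrime)
    (h : P.map (algebraMap (𝓞 (cubicFixedField σ)) (𝓞 K)) = Q₁ * Q₂) :
    3 ∣ Nat.card (𝓞 (cubicFixedField σ) ⧸ P) - 1 := by
  have hne : P.map (algebraMap (𝓞 (cubicFixedField σ)) (𝓞 K)) ≠ ⊥ := by
    rwa [Ne, Ideal.map_eq_bot_iff_of_injective (FaithfulSMul.algebraMap_injective _ _)]
  have h10 : Q₁ ≠ ⊥ := by
    rintro rfl
    rw [h, Ideal.bot_mul] at hne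
    exact hne rfl
  have h20 : Q₂ ≠ ⊥ := by
    rintro rfl
    rw [h, Ideal.mul_bot] at hne
    exact hne rfl
  have hl1 := card_le hP h0 h1 h10 (h ▸ Ideal.mul_le_left)
  have hl2 := card_le hP h0 h2 h20 (h ▸ Ideal.mul_le_right)
  have hN := congrArg Ideal.absNorm h
  rw [Ideal.absNorm_algebraMap, D.finrank_F, map_mul] at hN
  simp only [Ideal.absNorm_apply, Submodule.cardQuot_apply] at hN
  have hf := Ideal.finiteQuotientOfFreeOfNeBot _ h10
  have hf2 := Ideal.finiteQuotientOfFreeOfNeBot _ h20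
  have hpos : 0 < Nat.card (𝓞 K ⧸ Q₂) := Nat.card_pos
  have heq : Nat.card (𝓞 (cubicFixedField σ) ⧸ P) = Nat.card (𝓞 K ⧸ Q₁) := by
    apply le_antisymm hl1
    nlinarith
  rw [heq]
  have hm := h1.isMaximal h10
  letI := Ideal.Quotient.field Q₁
  apply ff_three (Ideal.Quotient.mk Q₁ w)
  · rw [← map_pow, ← map_one (Ideal.Quotient.mk Q₁)]
    congr 1
    linear_combination (w - 1) * D.hw
  · intro h3
    have h4 : w - 1 ∈ Q₁ := by
      rw [← Ideal.Quotient.eq_zero_iff_mem, map_sub, h3, map_one, sub_self]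
    apply D.b_not_mem h1 (hc.mono (h ▸ Ideal.dvd_iff_le.2 Ideal.mul_le_left) dvd_rfl)
    have h5 := Q₁.mul_mem_left (-w) h4
    rwa [show -w * (w - 1) = 1 + 2 * w by linear_combination -D.hw] at h5

theorem inert (D : ShData K σ z w) {P : Ideal (𝓞 (cubicFixedField σ))} (hP : P.IsPrime) (h0 : P ≠ ⊥)
    (hc : IsCoprime (P.map (algebraMap (𝓞 (cubicFixedField σ)) (𝓞 K))) (Ideal.span {21}))
    (h : (P.map (algebraMap (𝓞 (cubicFixedField σ)) (𝓞 K))).IsPrime) :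
    ¬ 3 ∣ Nat.card (𝓞 (cubicFixedField σ) ⧸ P) - 1 := by
  intro h3
  have hne : P.map (algebraMap (𝓞 (cubicFixedField σ)) (𝓞 K)) ≠ ⊥ := by
    rwa [Ne, Ideal.map_eq_bot_iff_of_injective (FaithfulSMul.algebraMap_injective _ _)]
  obtain ⟨Q, hQ⟩ : ∃ Q, Q = P.map (algebraMap (𝓞 (cubicFixedField σ)) (𝓞 K)) := ⟨_, rfl⟩
  have hρ : idealConj (σ ^ 3) Q = Q := by rw [hQ]; exact rho_map P
  have hle : P ≤ Q.comap (algebraMap (𝓞 (cubicFixedField σ)) (𝓞 K)) := by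
    rw [← Ideal.map_le_iff_le_comap, hQ]
  rw [← hQ] at hc h hne
  have hm := hP.isMaximal h0
  have hm' := h.isMaximal hne
  letI := Ideal.Quotient.field P
  letI := Ideal.Quotient.field Q
  have := Ideal.finiteQuotientOfFreeOfNeBot _ h0
  obtain ⟨a', ha⟩ := ff_root (Ideal.quotientMap Q
    (algebraMap (𝓞 (cubicFixedField σ)) (𝓞 K)) hle) (Ideal.Quotient.mk Q w) (by
      rw [← map_pow, D.hw, map_sub, map_neg, map_one]) h3
  obtain ⟨a, rfl⟩ := Ideal.Quotient.mk_surjective a'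
  rw [Ideal.quotientMap_mk, Ideal.Quotient.eq] at ha
  have h1 : gR (σ ^ 3) (algebraMap (𝓞 (cubicFixedField σ)) (𝓞 K) a - w) ∈ idealConj (σ ^ 3) Q :=
    Ideal.mem_map_of_mem _ ha
  rw [hρ, map_sub, rho_F, D.w3] at h1
  apply D.b_not_mem h hc
  have h2 := Q.sub_mem h1 ha
  convert h2 using 1
  ring

end ShData

theorem sh_final {K : Type*} [Field K] [NumberField K] {σ : K ≃ₐ[ℚ] K} {z w : 𝓞 K}
    (D : ShData K σ z w) : ∃ ψ : Ideal (𝓞 K) → K,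
      IsShimuraIdealCharRho σ (Ideal.span {(21 : 𝓞 K)}) ψ := by
  classical
  obtain ⟨π, -, hw, h4⟩ := D.exists_pi
  have hex : ∀ I : Ideal (𝓞 K), ∃ W : 𝓞 K,
      IsCoprime I (Ideal.span {(21 : 𝓞 K)}) → ShC σ w π I W := by
    intro I
    by_cases h : IsCoprime I (Ideal.span {(21 : 𝓞 K)})
    · obtain ⟨W, hW⟩ := D.C_exists hw h4 I h
      exact ⟨W, fun _ => hW⟩
    · exact ⟨0, fun h' => absurd h' h⟩
  choose f hf using hex
  have hval : ∀ I : Ideal (𝓞 K), I ≠ ⊥ → ∀ W, ShC σ w π I W →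
      IsCoprime I (Ideal.span {(21 : 𝓞 K)}) → f I = W :=
    fun I h0 W hW hc => D.C_unique hw h0 (hf I hc) hW
  refine ⟨fun I => (f I : K), ?_, ?_, ?_, ?_, ?_, ?_⟩
  · intro I h0 hc h
    have h1 := (hf I hc).norm
    have h2 : f I = 0 := RingOfIntegers.ext (by simpa using h)
    rw [h2, zero_mul] at h1
    exact Ideal.absNorm_ne_zero_iff_mem_nonZeroDivisors.2 (mem_nonZeroDivisors_of_ne_zero h0)
      (by exact_mod_cast h1.symm)
  · intro I J hI hJ hcI hcJ
    have := hval (I * J) (mul_ne_zero hI hJ) _ (D.C_mul (hf I hcI) (hf J hcJ)) (hcI.mul_left hcJ)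
    simp only [this, map_mul]
  · intro s hc hs
    have h0 : Ideal.span {s} ≠ ⊥ := by
      intro h
      rw [Ideal.span_singleton_eq_bot] at h
      rw [h, Ideal.mem_span_singleton] at hs
      obtain ⟨r, hr⟩ := hs
      have := congrArg π hr
      rw [map_mul, map_ofNat, zm7_c, zero_mul, zero_sub, map_neg, map_one, neg_eq_zero] at this
      exact zm7_d this.symm
    have := hval _ h0 _ (D.C_one h4 s hs) hc
    simp only [this, map_mul, gR_coe]
  · intro P hP h0 hc
    have hq : 0 < Nat.card (𝓞 (cubicFixedField σ) ⧸ P) := by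
      have := Ideal.finiteQuotientOfFreeOfNeBot _ h0
      exact Nat.card_pos
    have h := D.C_F hw h0 (hf _ hc)
    constructor
    · rintro ⟨Q₁, Q₂, h1, h2, -, h3⟩
      have h5 := D.split hP h0 hc h1 h2 h3
      rcases h with ⟨h, -⟩ | ⟨-, h⟩
      · simp only [h, map_natCast]
      · exfalso; omega
    · intro h1
      have h5 := D.inert hP h0 hc h1
      rcases h with ⟨-, h⟩ | ⟨h, -⟩
      · exfalso; omega
      · simp only [h, map_neg, map_natCast]
  · intro I h0 hc
    constructor
    · have h1 := congrArg (fun x : 𝓞 K => (x : K)) (hf I hc).norm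
      simp only [map_mul, gR_coe, map_natCast] at h1
      rw [Ideal.absNorm_apply, Submodule.cardQuot_apply] at h1
      exact h1
    · rw [← (hf I hc).span, FractionalIdeal.coeIdeal_span_singleton]
  · intro I h0 hc
    have h1 : IsCoprime (idealConj (σ ^ 3) I) (Ideal.span {(21 : 𝓞 K)}) := by
      obtain ⟨s, rfl⟩ := D.ex_gen I
      rw [idealConj_span]
      rw [Ideal.isCoprime_span_singleton_iff] at hc ⊢
      have := hc.map (gR (σ ^ 3)).toRingHom
      have h3 : (gR (σ ^ 3)).toRingHom (21 : 𝓞 K) = 21 := map_ofNat _ 21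
      rw [h3] at this
      exact this
    have h2 : idealConj (σ ^ 3) I ≠ ⊥ := by
      intro h
      apply h0
      exact (Ideal.map_eq_bot_iff_of_injective (gR (σ ^ 3)).injective).1 h
    have := hval _ h2 _ (D.C_conj (hf I hc)) h1
    simp only [this, gR_coe]

/-- For the sextic cyclic CM field ℚ(α, √-3) of conductor 21 (whose group of roots of unity
has order 6) there exists a map satisfying conditions (i)–(iv) of a Shimura ideal character
together with ρ-equivariance in place of condition (v). -/
theorem stmt_13 (K : Type*) [Field K] [NumberField K]
    (hdeg : Module.finrank ℚ K = 6) [IsGalois ℚ K] (hcyc : IsCyclic (K ≃ₐ[ℚ] K))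
    (α β : K) (hα : α ^ 3 = 21 * α - 7) (hβ : β ^ 2 = (-3 : K)) :
    ∃ (σ : K ≃ₐ[ℚ] K) (𝔠 : Ideal (𝓞 K)) (ψ : Ideal (𝓞 K) → K),
      (∀ τ : K ≃ₐ[ℚ] K, τ ∈ Subgroup.zpowers σ) ∧ 𝔠 ≠ ⊥ ∧
      IsShimuraIdealCharRho σ 𝔠 ψ := by
  obtain ⟨σ, hσ, z, w, hz, hw, sz, sw⟩ := sh_data K hdeg hcyc α β hα hβ
  have D : ShData K σ z w := ⟨hdeg, inferInstance, hσ, hz, hw, sz, sw⟩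
  obtain ⟨ψ, hψ⟩ := sh_final D
  refine ⟨σ, Ideal.span {(21 : 𝓞 K)}, ψ, hσ, ?_, hψ⟩
  rw [Ne, Ideal.span_singleton_eq_bot]
  norm_num
end
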